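/- arXiv:1802.08663 — 15 statements merged into one kernel-verified Lean document; each statement's English description precedes it below -/
import Mathlib

section
/- Let Σ be an alphabet of size q ≥ 2 and let n, t, s be nonnegative integers with t + s ≤ n. Suppose C ⊆ Σ^n is a code such that no word is obtainable from two distinct codewords of C by at most t deletions followed by at most s insertions (i.e., C admits unique decoding against t deletions and s insertions). Then |C| ≤ q^{n−t−s}. -/
/-- `w` is obtainable from `x` by at most `t` deletions followed by at most `s`
insertions: there is a common subsequence `v` of `x` and `w` with
`|v| ≥ |x| − t` and `|w| ≤ |v| + s`. -/
def Obtainable {α : Type*} (t s : ℕ) (x w : List α) : Prop :=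
  ∃ v : List α, v.Sublist x ∧ v.Sublist w ∧ x.length ≤ v.length + t ∧ w.length ≤ v.length + s

/-- Words with a common prefix `p` followed by tails of length at most `t + s` can be turned into
the same word by at most `t` deletions followed by at most `s` insertions. -/
theorem Obtainable.of_append {α : Type*} {t s : ℕ} (p a b : List α)
    (ha : a.length ≤ t + s) (hb : b.length ≤ t + s) :
    Obtainable t s (p ++ a) (p ++ (a.drop t ++ b.drop t)) ∧
      Obtainable t s (p ++ b) (p ++ (a.drop t ++ b.drop t)) := by
  refine ⟨⟨p ++ a.drop t, (List.drop_sublist t a).append_left p,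
    (List.sublist_append_left _ _).append_left p, ?_, ?_⟩,
    ⟨p ++ b.drop t, (List.drop_sublist t b).append_left p,
    (List.sublist_append_right _ _).append_left p, ?_, ?_⟩⟩ <;>
  simp only [List.length_append, List.length_drop] <;> omega

/-- If `C ⊆ Σ^n` (with `|Σ| = q ≥ 2`) admits unique decoding against `t` deletions and
`s` insertions with `t + s ≤ n`, then `|C| ≤ q^{n−t−s}`. -/
theorem stmt_0 {A : Type*} [Fintype A] (q n t s : ℕ) (hq : 2 ≤ q)
    (hcard : Fintype.card A = q) (hts : t + s ≤ n)
    (C : Finset (List A)) (hlen : ∀ x ∈ C, x.length = n)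
    (huniq : ∀ x ∈ C, ∀ y ∈ C, x ≠ y →
      ∀ w : List A, ¬ (Obtainable t s x w ∧ Obtainable t s y w)) :
    C.card ≤ q ^ (n - t - s) := by
  let f : C → List.Vector A (n - t - s) := fun x =>
    ⟨x.1.take (n - t - s), by rw [List.length_take, hlen x.1 x.2]; omega⟩
  have hf : Function.Injective f := by
    rintro ⟨x, hx⟩ ⟨y, hy⟩ hxy
    have htake : x.take (n - t - s) = y.take (n - t - s) := congrArg Subtype.val hxy
    by_contra hne
    have h := Obtainable.of_append (t := t) (s := s) (x.take (n - t - s))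
      (x.drop (n - t - s)) (y.drop (n - t - s))
      (by rw [List.length_drop, hlen x hx]; omega) (by rw [List.length_drop, hlen y hy]; omega)
    have hy_split : x.take (n - t - s) ++ y.drop (n - t - s) = y := by
      rw [htake, List.take_append_drop]
    rw [List.take_append_drop, hy_split] at h
    exact huniq x hx y hy (fun e => hne (Subtype.ext e)) _ h
  simpa [hcard] using Fintype.card_le_of_injective f hf
end

section
/- Let q ≥ 2, n ≥ 1, g ≥ 1 and L ≥ 1 be integers. If a code C ⊆ (Fin q)^n is list-decodable from 0 deletions and g insertions with list size L (i.e., every word z over Fin q with |z| ≤ n + g contains at most L codewords of C as subsequences), then |C| · (n+g choose n) · (q−1)^g ≤ L · q^{n+g}. Equivalently, if |C| · (n+g choose n) · (q−1)^g > L · q^{n+g}, then there exists z ∈ (Fin q)^{n+g} having more than L codewords of C as subsequences. -/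
/-- Every word `x` has at least `(|x|+g choose |x|) (|α|-1)^g` superwords of length `|x| + g`. -/
theorem exists_finset_superwords {α : Type*} [Fintype α] [DecidableEq α] [Nonempty α]
    (x : List α) (g : ℕ) :
    ∃ S : Finset (List α), (∀ z ∈ S, z.length = x.length + g ∧ x.Sublist z) ∧
      S.card = Nat.choose (x.length + g) x.length * (Fintype.card α - 1) ^ g := by
  induction x generalizing g with
  | nil =>
    obtain ⟨a⟩ := ‹Nonempty α›
    let T : Finset (List.Vector α g) := Finset.univ
    have hT : (Fintype.card α - 1) ^ g ≤ (T.image List.Vector.toList).card := by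
      rw [Finset.card_image_of_injective _ List.Vector.toList_injective, Finset.card_univ,
        card_vector]
      exact Nat.pow_le_pow_left (Nat.sub_le _ _) g
    obtain ⟨S, hST, hS⟩ := Finset.exists_subset_card_eq hT
    refine ⟨S, fun z hz => ?_, by simpa using hS⟩
    obtain ⟨v, -, rfl⟩ := Finset.mem_image.1 (hST hz)
    simp
  | cons a x ih =>
    induction g with
    | zero => exact ⟨{a :: x}, by simp, by simp⟩
    | succ g ihg =>
      obtain ⟨S, hS, hScard⟩ := ih (g + 1)
      obtain ⟨T, hT, hTcard⟩ := ihg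
      have hinj : Function.Injective (fun p : α × List α => p.1 :: p.2) := by
        rintro ⟨b, y⟩ ⟨c, z⟩ h
        simpa using h
      refine ⟨(({a} ×ˢ S) ∪ (Finset.univ.erase a ×ˢ T)).image fun p => p.1 :: p.2, ?_, ?_⟩
      · simp only [Finset.mem_image, Finset.mem_union, Finset.mem_product, Finset.mem_singleton]
        rintro z ⟨⟨b, y⟩, ⟨rfl, hy⟩ | ⟨-, hy⟩, rfl⟩
        · obtain ⟨hl, hs⟩ := hS y hy
          exact ⟨by simp only [List.length_cons] at hl ⊢; omega, hs.cons_cons _⟩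
        · obtain ⟨hl, hs⟩ := hT y hy
          exact ⟨by simp only [List.length_cons] at hl ⊢; omega, hs.cons _⟩
      · rw [Finset.card_image_of_injective _ hinj, Finset.card_union_of_disjoint,
          Finset.card_product, Finset.card_product, hScard, hTcard, Finset.card_singleton,
          Finset.card_erase_of_mem (Finset.mem_univ a), Finset.card_univ, List.length_cons,
          show x.length + 1 + (g + 1) = (x.length + (g + 1)) + 1 by ring,
          Nat.choose_succ_succ, show x.length + 1 + g = x.length + (g + 1) by ring]
        · ring
        · rw [Finset.disjoint_left]
          rintro ⟨b, y⟩ h h'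
          simp only [Finset.mem_product, Finset.mem_singleton, Finset.mem_erase] at h h'
          exact h'.1.1 h.1

/-- If `C ⊆ (Fin q)^n` is list-decodable from `0` deletions and `g` insertions with list
size `L` (every word `z` with `|z| ≤ n + g` contains at most `L` codewords as
subsequences), then `|C| · (n+g choose n) · (q−1)^g ≤ L · q^{n+g}`. -/
theorem stmt_1 (q n g L : ℕ) (hq : 2 ≤ q) (hn : 1 ≤ n) (hg : 1 ≤ g) (hL : 1 ≤ L)
    (C : Finset (List (Fin q))) (hlen : ∀ x ∈ C, x.length = n)
    (hlist : ∀ z : List (Fin q), z.length ≤ n + g →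
      (C.filter (fun x => x.Sublist z)).card ≤ L) :
    C.card * Nat.choose (n + g) n * (q - 1) ^ g ≤ L * q ^ (n + g) := by
  have : NeZero q := ⟨by omega⟩
  let U : Finset (List (Fin q)) :=
    (Finset.univ : Finset (List.Vector (Fin q) (n + g))).image List.Vector.toList
  have hU : U.card = q ^ (n + g) := by
    rw [Finset.card_image_of_injective _ List.Vector.toList_injective, Finset.card_univ,
      card_vector, Fintype.card_fin]
  have hmem : ∀ z : List (Fin q), z ∈ U ↔ z.length = n + g := fun z => by
    simp only [U, Finset.mem_image, Finset.mem_univ, true_and]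
    exact ⟨fun ⟨v, hv⟩ => hv ▸ v.toList_length, fun h => ⟨⟨z, h⟩, rfl⟩⟩
  rw [mul_assoc, ← hU, mul_comm L]
  refine Finset.card_mul_le_card_mul (fun x z : List (Fin q) => x.Sublist z)
    (fun x hx => ?_) (fun z hz => hlist z ((hmem z).1 hz).le)
  obtain ⟨S, hS, hcard⟩ := exists_finset_superwords x g
  rw [hlen x hx, Fintype.card_fin] at hcard
  rw [← hcard]
  refine Finset.card_le_card fun z hz => ?_
  obtain ⟨hl, hs⟩ := hS z hz
  exact Finset.mem_filter.2 ⟨(hmem z).2 (by rw [hl, hlen x hx]), hs⟩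
end

section
/- For all integers q ≥ 2 and 0 ≤ n ≤ m, and every word y ∈ (Fin q)^n, the number of words z ∈ (Fin q)^m that contain y as a subsequence is at least (m choose n) · (q−1)^{m−n}. -/
theorem card_superwords_succ {α : Type*} [Fintype α] [DecidableEq α] (m : ℕ) (y : List α) :
    (Finset.univ.filter (fun z : Fin (m + 1) → α => y.Sublist (List.ofFn z))).card =
      ∑ b : α, (Finset.univ.filter
        (fun z : Fin m → α => y.Sublist (b :: List.ofFn z))).card := by
  simp only [Finset.card_filter]
  rw [← (Fin.consEquiv (fun _ : Fin (m + 1) => α)).sum_comp, Fintype.sum_prod_type]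
  simp [Fin.consEquiv, List.ofFn_succ]

theorem card_superwords_cons_succ {α : Type*} [Fintype α] [DecidableEq α] (m : ℕ) (a : α)
    (y : List α) :
    (Finset.univ.filter (fun z : Fin (m + 1) → α => (a :: y).Sublist (List.ofFn z))).card =
      (Finset.univ.filter (fun z : Fin m → α => y.Sublist (List.ofFn z))).card +
      (Fintype.card α - 1) *
        (Finset.univ.filter (fun z : Fin m → α => (a :: y).Sublist (List.ofFn z))).card := by
  rw [card_superwords_succ, ← Finset.add_sum_erase _ _ (Finset.mem_univ a)]
  congr 1
  · simp only [List.cons_sublist_cons]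
  · rw [← Finset.card_univ, ← Finset.card_erase_of_mem (Finset.mem_univ a), ← smul_eq_mul]
    refine Finset.sum_eq_card_nsmul fun b hb => ?_
    have hab : a ≠ b := (Finset.ne_of_mem_erase hb).symm
    simp [List.sublist_cons_iff, hab]

theorem choose_mul_pow_le_card_superwords {α : Type*} [Fintype α] [DecidableEq α] (m : ℕ)
    (y : List α) :
    m.choose y.length * (Fintype.card α - 1) ^ (m - y.length) ≤
      (Finset.univ.filter (fun z : Fin m → α => y.Sublist (List.ofFn z))).card := by
  induction m generalizing y with
  | zero => cases y <;> simp
  | succ m ih =>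
    cases y with
    | nil => simpa using Nat.pow_le_pow_left (Nat.sub_le (Fintype.card α) 1) (m + 1)
    | cons a y =>
      rw [card_superwords_cons_succ, List.length_cons, Nat.choose_succ_succ, add_mul,
        Nat.add_sub_add_right]
      refine add_le_add (ih y) ?_
      rcases lt_or_ge y.length m with h | h
      · have key := Nat.mul_le_mul_left (Fintype.card α - 1) (ih (a :: y))
        rw [List.length_cons] at key
        rw [show m - y.length = m - (y.length + 1) + 1 by omega, pow_succ]
        linarith
      · simp [Nat.choose_eq_zero_of_lt (Nat.lt_succ_of_le h)]


/-- For `q ≥ 2`, `n ≤ m`, and any word `y ∈ (Fin q)^n`, the number of words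
`z ∈ (Fin q)^m` containing `y` as a subsequence is at least
`(m choose n) · (q−1)^{m−n}`. -/
theorem stmt_2 (q n m : ℕ) (hq : 2 ≤ q) (hnm : n ≤ m)
    (y : List (Fin q)) (hy : y.length = n) :
    Nat.choose m n * (q - 1) ^ (m - n) ≤
      ((Finset.univ : Finset (Fin m → Fin q)).filter
        (fun z => y.Sublist (List.ofFn z))).card := by
  subst hy
  simpa using choose_mul_pow_le_card_superwords m y
end

section
/- For all integers q ≥ 1 and 1 ≤ n ≤ m, and every word y ∈ (Fin q)^n, the number of words z ∈ (Fin q)^m that contain y as a subsequence equals Σ_{l=n}^{m} (l−1 choose n−1) · (q−1)^{l−n} · q^{m−l}; in particular, this number does not depend on y. -/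
namespace SupersequenceCount

/-- The sum `Σ_{l=n+1}^{m} (l−1 choose n) · r^{l−n−1} · q^{m−l}`, indexed by `k = l − 1`; the terms
with `k < n` vanish. -/
def embeddingSum (q r n m : ℕ) : ℕ :=
  ∑ k ∈ Finset.range m, k.choose n * r ^ (k - n) * q ^ (m - 1 - k)

theorem embeddingSum_zero_succ (q r m : ℕ) :
    embeddingSum q r 0 (m + 1) = q ^ m + r * embeddingSum q r 0 m := by
  unfold embeddingSum
  rw [Finset.sum_range_succ', Finset.mul_sum, add_comm]
  congr 1
  · simp
  · refine Finset.sum_congr rfl fun k _ => ?_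
    rw [show m + 1 - 1 - (k + 1) = m - 1 - k by omega]
    simp only [Nat.choose_zero_right, Nat.sub_zero]
    ring

theorem embeddingSum_succ_succ (q r n m : ℕ) :
    embeddingSum q r (n + 1) (m + 1) =
      embeddingSum q r n m + r * embeddingSum q r (n + 1) m := by
  unfold embeddingSum
  rw [Finset.sum_range_succ', Finset.mul_sum, ← Finset.sum_add_distrib]
  simp only [Nat.choose_zero_succ, zero_mul, add_zero]
  refine Finset.sum_congr rfl fun k _ => ?_
  rw [show m + 1 - 1 - (k + 1) = m - 1 - k by omega, Nat.choose_succ_succ,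
    show k + 1 - (n + 1) = k - n by omega]
  rcases lt_or_ge k (n + 1) with hk | hk
  · simp [Nat.choose_eq_zero_of_lt hk]
  · rw [show k - n = k - (n + 1) + 1 by omega]
    ring

theorem sum_Icc_eq_embeddingSum (q r n m : ℕ) :
    ∑ l ∈ Finset.Icc (n + 1) m, (l - 1).choose n * r ^ (l - (n + 1)) * q ^ (m - l) =
      embeddingSum q r n m := by
  unfold embeddingSum
  rw [← Finset.sum_subset (s₁ := Finset.Ico n m) (s₂ := Finset.range m)]
  · rw [← Finset.Ico_add_one_right_eq_Icc, ← Finset.sum_Ico_add' _ n m 1]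
    refine Finset.sum_congr rfl fun k _ => ?_
    rw [Nat.add_sub_cancel, Nat.add_sub_add_right, Nat.sub_sub, Nat.add_comm 1 k]
  · intro k hk
    simp only [Finset.mem_Ico, Finset.mem_range] at hk ⊢
    exact hk.2
  · intro k hkm hk
    simp only [Finset.mem_Ico, Finset.mem_range] at hkm hk
    simp [Nat.choose_eq_zero_of_lt (show k < n by omega)]

theorem cons_sublist_cons_iff_of_ne {α : Type*} {a b : α} (h : a ≠ b) (y z : List α) :
    (a :: y).Sublist (b :: z) ↔ (a :: y).Sublist z := by
  simp [List.sublist_cons_iff, h]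

/-- The number of words of length `m` containing `y` as a subsequence. -/
def supersequenceCount {q : ℕ} (m : ℕ) (y : List (Fin q)) : ℕ :=
  ((Finset.univ : Finset (Fin m → Fin q)).filter (fun z => y.Sublist (List.ofFn z))).card

theorem supersequenceCount_nil {q : ℕ} (m : ℕ) :
    supersequenceCount m ([] : List (Fin q)) = q ^ m := by
  simp [supersequenceCount]

theorem supersequenceCount_cons_zero {q : ℕ} (a : Fin q) (y : List (Fin q)) :
    supersequenceCount 0 (a :: y) = 0 := by
  simp [supersequenceCount]

theorem supersequenceCount_cons_succ {q : ℕ} (m : ℕ) (a : Fin q) (y : List (Fin q)) :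
    supersequenceCount (m + 1) (a :: y) =
      supersequenceCount m y + (q - 1) * supersequenceCount m (a :: y) := by
  have split : supersequenceCount (m + 1) (a :: y) =
      ∑ b : Fin q, ((Finset.univ : Finset (Fin m → Fin q)).filter
        (fun z => (a :: y).Sublist (b :: List.ofFn z))).card := by
    simp only [supersequenceCount, Finset.card_filter]
    rw [← (Fin.consEquiv fun _ : Fin (m + 1) => Fin q).sum_comp, Fintype.sum_prod_type]
    simp [Fin.consEquiv, List.ofFn_succ]
  rw [split, ← Finset.add_sum_erase _ _ (Finset.mem_univ a)]
  congr 1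
  · simp [supersequenceCount]
  · rw [Finset.sum_congr rfl (g := fun _ => supersequenceCount m (a :: y))]
    · simp
    · intro b hb
      simp only [cons_sublist_cons_iff_of_ne (Finset.ne_of_mem_erase hb).symm, supersequenceCount]

theorem supersequenceCount_cons {q : ℕ} (m : ℕ) (a : Fin q) (y : List (Fin q)) :
    supersequenceCount m (a :: y) = embeddingSum q (q - 1) y.length m := by
  induction m generalizing a y with
  | zero => simp [supersequenceCount_cons_zero, embeddingSum]
  | succ m ih =>
    rw [supersequenceCount_cons_succ, ih]
    cases y with
    | nil => rw [supersequenceCount_nil, List.length_nil, embeddingSum_zero_succ]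
    | cons b y => rw [ih, List.length_cons, embeddingSum_succ_succ]

end SupersequenceCount

/-- For `q ≥ 1`, `1 ≤ n ≤ m`, and any word `y ∈ (Fin q)^n`, the number of words
`z ∈ (Fin q)^m` containing `y` as a subsequence equals
`Σ_{l=n}^{m} (l−1 choose n−1) · (q−1)^{l−n} · q^{m−l}`; in particular it does not
depend on `y`. -/
theorem stmt_3 (q n m : ℕ) (hq : 1 ≤ q) (hn : 1 ≤ n) (hnm : n ≤ m)
    (y : List (Fin q)) (hy : y.length = n) :
    ((Finset.univ : Finset (Fin m → Fin q)).filter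
        (fun z => y.Sublist (List.ofFn z))).card =
      ∑ l ∈ Finset.Icc n m, Nat.choose (l - 1) (n - 1) * (q - 1) ^ (l - n) * q ^ (m - l) := by
  cases y with
  | nil => simp only [List.length_nil] at hy; omega
  | cons a y =>
    subst hy
    exact (SupersequenceCount.supersequenceCount_cons m a y).trans
      (SupersequenceCount.sum_Icc_eq_embeddingSum q (q - 1) y.length m).symm
end

section
/- Let q ≥ 2 and 0 ≤ d < q be integers, let n ≥ 1, and set t = ⌈dn/q⌉. If a code C ⊆ (Fin q)^n is list-decodable from t deletions with list size L (i.e., every word w over Fin q with n − t ≤ |w| ≤ n is a subsequence of at most L codewords of C), then |C| ≤ L · (q choose q−d) · (q−d)^{n−t}. -/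
/-- Any finite family of naturals has, for each size, a subfamily whose average is at least the
overall average. -/
theorem Finset.exists_card_eq_and_mul_sum_le {α : Type*} [DecidableEq α] (s : Finset α)
    (f : α → ℕ) (d : ℕ) (hd : d ≤ s.card) :
    ∃ u ⊆ s, u.card = s.card - d ∧ (s.card - d) * ∑ a ∈ s, f a ≤ s.card * ∑ a ∈ u, f a := by
  induction d with
  | zero => exact ⟨s, subset_rfl, rfl, le_rfl⟩
  | succ d ih =>
    obtain ⟨u, hus, hcard, hsum⟩ := ih (by omega)
    obtain ⟨k, hk⟩ : ∃ k, s.card - d = k + 1 := ⟨s.card - d - 1, by omega⟩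
    have hk' : s.card - (d + 1) = k := by omega
    rw [hk] at hcard hsum
    obtain ⟨i, hi, hmin⟩ := u.exists_min_image f (Finset.card_pos.mp (by omega))
    refine ⟨u.erase i, (Finset.erase_subset _ _).trans hus, ?_, ?_⟩
    · rw [Finset.card_erase_of_mem hi]; omega
    · have hle : k * f i ≤ ∑ a ∈ u.erase i, f a := by
        have := Finset.card_nsmul_le_sum (u.erase i) f (f i)
          fun a ha => hmin a (Finset.mem_of_mem_erase ha)
        rwa [Finset.card_erase_of_mem hi, hcard, smul_eq_mul, Nat.add_sub_cancel] at this
      rw [← Finset.add_sum_erase u f hi] at hsum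
      rw [hk']
      refine Nat.le_of_mul_le_mul_left (c := k + 1) ?_ k.succ_pos
      have h₁ := Nat.mul_le_mul_left k hsum
      have h₂ := Nat.mul_le_mul_left s.card hle
      linarith

theorem List.length_filter_mem_finset {α : Type*} [DecidableEq α] (s : Finset α) (l : List α) :
    (l.filter (· ∈ s)).length = ∑ a ∈ s, l.count a := by
  induction l with
  | nil => simp
  | cons b l ih =>
    simp only [List.count_cons, Finset.sum_add_distrib, ← ih, List.filter_cons]
    by_cases hb : b ∈ s <;> simp [hb]

/-- A list over `q` symbols of length `n` contains a sublist of any length at most `(q - d) n / q`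
that uses at most `q - d` symbols. -/
theorem List.exists_sublist_over_card_eq {α : Type*} [DecidableEq α] [Fintype α] (d m : ℕ)
    (hd : d < Fintype.card α) (x : List α)
    (hm : Fintype.card α * m ≤ (Fintype.card α - d) * x.length) :
    ∃ u : Finset α, u.card = Fintype.card α - d ∧
      ∃ w : List α, w.length = m ∧ (∀ a ∈ w, a ∈ u) ∧ w.Sublist x := by
  obtain ⟨u, -, hcard, hsum⟩ := Finset.univ.exists_card_eq_and_mul_sum_le (x.count ·) d hd.le
  have htotal : ∑ a, x.count a = x.length := by
    simpa using (List.length_filter_mem_finset Finset.univ x).symm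
  rw [htotal, ← List.length_filter_mem_finset, Finset.card_univ] at hsum
  have hlen : m ≤ (x.filter (· ∈ u)).length :=
    Nat.le_of_mul_le_mul_left (hm.trans hsum) (by omega)
  refine ⟨u, hcard, (x.filter (· ∈ u)).take m, by simpa using hlen, fun a ha => ?_,
    (List.take_sublist _ _).trans List.filter_sublist⟩
  simpa using (List.mem_filter.mp (List.mem_of_mem_take ha)).2

/-- The words of length `m` over the alphabet `u`. -/
def Finset.wordsOfLength {α : Type*} [DecidableEq α] (u : Finset α) (m : ℕ) :
    Finset (List α) :=
  (Fintype.piFinset fun _ : Fin m => u).image List.ofFn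

theorem Finset.mem_wordsOfLength {α : Type*} [DecidableEq α] {u : Finset α} {m : ℕ}
    {w : List α} : w ∈ u.wordsOfLength m ↔ w.length = m ∧ ∀ a ∈ w, a ∈ u := by
  simp only [Finset.wordsOfLength, Finset.mem_image, Fintype.mem_piFinset]
  constructor
  · rintro ⟨g, hg, rfl⟩
    simpa [List.mem_ofFn] using hg
  · rintro ⟨rfl, hw⟩
    exact ⟨w.get, fun i => hw _ (List.get_mem w i), List.ofFn_get w⟩

theorem Finset.card_wordsOfLength_le {α : Type*} [DecidableEq α] (u : Finset α) (m : ℕ) :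
    (u.wordsOfLength m).card ≤ u.card ^ m :=
  Finset.card_image_le.trans (by simp)


/-- Deletion converse, first bullet (Theorem 3 of the paper), exact finite form.
Let `q ≥ 2`, `0 ≤ d < q`, `n ≥ 1` and `t = ⌈dn/q⌉`. If `C ⊆ (Fin q)^n` is
list-decodable from `t` deletions with list size `L` (every word `w` with
`n − t ≤ |w| ≤ n` is a subsequence of at most `L` codewords), then
`|C| ≤ L · (q choose q−d) · (q−d)^{n−t}`. -/
theorem stmt_5 (q d n t L : ℕ) (hq : 2 ≤ q) (hd : d < q) (hn : 1 ≤ n)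
    (ht : t = (d * n) ⌈/⌉ q)
    (C : Finset (List (Fin q))) (hlen : ∀ x ∈ C, x.length = n)
    (hlist : ∀ w : List (Fin q), n - t ≤ w.length → w.length ≤ n →
      (C.filter (fun x => w.Sublist x)).card ≤ L) :
    C.card ≤ L * Nat.choose q (q - d) * (q - d) ^ (n - t) := by
  have hdn : d * n ≤ q * t := by
    rw [ht]
    simpa using le_smul_ceilDiv (b := d * n) (show 0 < q by omega)
  have hm : q * (n - t) ≤ (q - d) * n := by
    rw [Nat.mul_sub, Nat.sub_mul]
    omega
  have hcover : C ⊆ (Finset.univ.powersetCard (q - d)).biUnion fun u =>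
      (u.wordsOfLength (n - t)).biUnion fun w => C.filter fun x => w.Sublist x := by
    intro x hx
    obtain ⟨u, hu, w, hw, hwu, hwx⟩ :=
      List.exists_sublist_over_card_eq d (n - t) (by simpa using hd) x
        (by simpa [hlen x hx] using hm)
    simp only [Finset.mem_biUnion, Finset.mem_powersetCard, Finset.mem_filter,
      Finset.mem_wordsOfLength]
    exact ⟨u, ⟨Finset.subset_univ u, by simpa using hu⟩, w, ⟨hw, hwu⟩, hx, hwx⟩
  calc C.card
      ≤ (Finset.univ.powersetCard (q - d) : Finset (Finset (Fin q))).card *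
          ((q - d) ^ (n - t) * L) := by
        refine (Finset.card_le_card hcover).trans
          (Finset.card_biUnion_le_card_mul _ _ _ fun u hu => ?_)
        refine (Finset.card_biUnion_le_card_mul _ _ L fun w hw => ?_).trans
          (Nat.mul_le_mul_right L ?_)
        · have hw' := (Finset.mem_wordsOfLength.mp hw).1
          exact hlist w hw'.ge (by omega)
        · simpa [(Finset.mem_powersetCard.mp hu).2] using u.card_wordsOfLength_le (n - t)
    _ = L * Nat.choose q (q - d) * (q - d) ^ (n - t) := by
        rw [Finset.card_powersetCard, Finset.card_univ, Fintype.card_fin]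
        ring
end

section
/- Let q ≥ 2 and 0 ≤ d ≤ q−1 be integers, let 0 ≤ n₁ ≤ n, and set t := ⌈(d+1)n₁/q⌉ + ⌈d(n−n₁)/q⌉. If a code C ⊆ (Fin q)^n is list-decodable from t deletions with list size L, then |C| ≤ L · (q choose q−d−1) · (q−d−1)^{n₁ − ⌈(d+1)n₁/q⌉} · (q choose q−d) · (q−d)^{(n−n₁) − ⌈d(n−n₁)/q⌉}. -/
/-- Some `k`-element subset carries at least its proportional share of a sum. -/
theorem exists_subset_card_eq_mul_sum_le {α : Type*} [DecidableEq α] (s : Finset α) (f : α → ℕ)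
    {k : ℕ} (hk : k ≤ s.card) :
    ∃ A ⊆ s, A.card = k ∧ k * ∑ a ∈ s, f a ≤ s.card * ∑ a ∈ A, f a := by
  induction hk using Nat.decreasingInduction with
  | self => exact ⟨s, Finset.Subset.refl s, rfl, le_rfl⟩
  | of_succ k _ ih =>
    obtain ⟨A, hAs, hA, hsum⟩ := ih
    obtain ⟨a, ha, hmin⟩ := A.exists_min_image f (Finset.card_pos.mp (by omega))
    refine ⟨A.erase a, (A.erase_subset a).trans hAs, by simp [ha, hA], ?_⟩
    have hle : (k + 1) * f a ≤ ∑ b ∈ A, f b := by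
      simpa [hA] using A.card_nsmul_le_sum f (f a) hmin
    have hadd := A.add_sum_erase f ha
    have hshare : k * ∑ b ∈ A, f b ≤ (k + 1) * ∑ b ∈ A.erase a, f b := by
      rw [← hadd] at hle ⊢
      linarith
    refine Nat.le_of_mul_le_mul_left ?_ (Nat.succ_pos k)
    calc (k + 1) * (k * ∑ b ∈ s, f b) = k * ((k + 1) * ∑ b ∈ s, f b) := by ring
      _ ≤ k * (s.card * ∑ b ∈ A, f b) := by gcongr
      _ = s.card * (k * ∑ b ∈ A, f b) := by ring
      _ ≤ s.card * ((k + 1) * ∑ b ∈ A.erase a, f b) := by gcongr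
      _ = (k + 1) * (s.card * ∑ b ∈ A.erase a, f b) := by ring

theorem length_filter_mem_eq_sum_count {α : Type*} [DecidableEq α] (A : Finset α) (x : List α) :
    (x.filter (· ∈ A)).length = ∑ a ∈ A, x.count a := by
  induction x with
  | nil => simp
  | cons b x ih =>
    by_cases hb : b ∈ A <;>
      simp [hb, ih, List.count_cons, Finset.sum_add_distrib]

/-- The words of length `m` using only symbols from some `k`-element set. -/
def wordsOverCard (q k m : ℕ) : Finset (List (Fin q)) :=
  (Finset.powersetCard k Finset.univ).biUnion fun A =>
    (Fintype.piFinset fun _ : Fin m => A).image List.ofFn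

theorem mem_wordsOverCard {q k m : ℕ} {y : List (Fin q)} {A : Finset (Fin q)}
    (hA : A.card = k) (hy : y.length = m) (hyA : ∀ a ∈ y, a ∈ A) : y ∈ wordsOverCard q k m := by
  subst hy
  simp only [wordsOverCard, Finset.mem_biUnion, Finset.mem_powersetCard_univ, Finset.mem_image,
    Fintype.mem_piFinset]
  exact ⟨A, hA, y.get, fun i => hyA _ (y.get_mem i), List.ofFn_get y⟩

theorem card_wordsOverCard_le (q k m : ℕ) :
    (wordsOverCard q k m).card ≤ q.choose k * k ^ m := by
  refine (Finset.card_biUnion_le_card_mul _ _ (k ^ m) fun A hA => ?_).trans_eq (by simp)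
  refine Finset.card_image_le.trans_eq ?_
  simp [Finset.mem_powersetCard_univ.mp hA]

theorem mul_ceilDiv_le {q k : ℕ} (hk : k ≤ q) (hq : 0 < q) (m : ℕ) : (k * m) ⌈/⌉ q ≤ m := by
  rw [ceilDiv_le_iff_le_mul hq]
  exact Nat.mul_le_mul_right m hk

/-- Removing the `k` least frequent symbols costs at most `⌈k m / q⌉` deletions. -/
theorem exists_sublist_mem_wordsOverCard {q k : ℕ} (hq : 0 < q) (hk : k ≤ q)
    (x : List (Fin q)) :
    ∃ y, y.Sublist x ∧ y ∈ wordsOverCard q (q - k) (x.length - (k * x.length) ⌈/⌉ q) := by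
  obtain ⟨A, -, hA, hsum⟩ := exists_subset_card_eq_mul_sum_le
    (Finset.univ : Finset (Fin q)) (fun a => x.count a) (k := q - k) (by simp)
  rw [← length_filter_mem_eq_sum_count, ← length_filter_mem_eq_sum_count] at hsum
  simp only [Finset.mem_univ, decide_true, List.filter_true, Finset.card_univ,
    Fintype.card_fin] at hsum
  have hceil : k * x.length ≤ q * ((k * x.length) ⌈/⌉ q) := le_smul_ceilDiv hq
  have hlen : x.length - (k * x.length) ⌈/⌉ q ≤ (x.filter (· ∈ A)).length := by
    rw [Nat.sub_le_iff_le_add]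
    refine Nat.le_of_mul_le_mul_left ?_ hq
    calc q * x.length = (q - k) * x.length + k * x.length := by
          rw [← add_mul, Nat.sub_add_cancel hk]
      _ ≤ q * ((x.filter (· ∈ A)).length + (k * x.length) ⌈/⌉ q) := by
          rw [mul_add]
          exact Nat.add_le_add hsum hceil
  refine ⟨(x.filter (· ∈ A)).take (x.length - (k * x.length) ⌈/⌉ q),
    (List.take_sublist _ _).trans List.filter_sublist,
    mem_wordsOverCard hA (List.length_take_of_le hlen) fun a ha => ?_⟩
  simpa using (List.mem_filter.mp (List.mem_of_mem_take ha)).2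

theorem length_of_mem_wordsOverCard {q k m : ℕ} {y : List (Fin q)}
    (hy : y ∈ wordsOverCard q k m) : y.length = m := by
  simp only [wordsOverCard, Finset.mem_biUnion, Finset.mem_image] at hy
  obtain ⟨_, _, _, _, rfl⟩ := hy
  exact List.length_ofFn


/-- Deletion converse, general form (Theorem 3 of the paper). Let `q ≥ 2`,
`0 ≤ d ≤ q−1`, `0 ≤ n₁ ≤ n`, and `t := ⌈(d+1)n₁/q⌉ + ⌈d(n−n₁)/q⌉`. If
`C ⊆ (Fin q)^n` is list-decodable from `t` deletions with list size `L`, then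
`|C| ≤ L · (q choose q−d−1) · (q−d−1)^{n₁ − ⌈(d+1)n₁/q⌉} · (q choose q−d) ·
(q−d)^{(n−n₁) − ⌈d(n−n₁)/q⌉}`. -/
theorem stmt_6 (q d n n₁ t L : ℕ) (hq : 2 ≤ q) (hd : d ≤ q - 1) (hn₁ : n₁ ≤ n)
    (ht : t = ((d + 1) * n₁) ⌈/⌉ q + (d * (n - n₁)) ⌈/⌉ q)
    (C : Finset (List (Fin q))) (hlen : ∀ x ∈ C, x.length = n)
    (hlist : ∀ w : List (Fin q), n - t ≤ w.length → w.length ≤ n →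
      (C.filter (fun x => w.Sublist x)).card ≤ L) :
    C.card ≤ L * Nat.choose q (q - d - 1) * (q - d - 1) ^ (n₁ - ((d + 1) * n₁) ⌈/⌉ q) *
      Nat.choose q (q - d) * (q - d) ^ ((n - n₁) - (d * (n - n₁)) ⌈/⌉ q) := by
  have hq₀ : 0 < q := by omega
  have hk : d + 1 ≤ q := by omega
  have hc₁ := mul_ceilDiv_le hk hq₀ n₁
  have hc₂ := mul_ceilDiv_le (show d ≤ q by omega) hq₀ (n - n₁)
  choose g₁ hsub₁ hmem₁ using exists_sublist_mem_wordsOverCard hq₀ hk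
  choose g₂ hsub₂ hmem₂ using exists_sublist_mem_wordsOverCard hq₀ (show d ≤ q by omega)
  set m₁ := n₁ - ((d + 1) * n₁) ⌈/⌉ q with hm₁
  set m₂ := (n - n₁) - (d * (n - n₁)) ⌈/⌉ q with hm₂
  have hmaps : ∀ x ∈ C, (g₁ (x.take n₁), g₂ (x.drop n₁)) ∈
      wordsOverCard q (q - (d + 1)) m₁ ×ˢ wordsOverCard q (q - d) m₂ := by
    intro x hx
    have h₁ := hmem₁ (x.take n₁)
    have h₂ := hmem₂ (x.drop n₁)
    rw [List.length_take_of_le (by rw [hlen x hx]; exact hn₁)] at h₁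
    rw [List.length_drop, hlen x hx] at h₂
    exact Finset.mem_product.mpr ⟨h₁, h₂⟩
  have hcard := Finset.card_le_mul_card_image_of_maps_to hmaps L fun p hp => by
    obtain ⟨hp₁, hp₂⟩ := Finset.mem_product.mp hp
    have hl₁ := length_of_mem_wordsOverCard hp₁
    have hl₂ := length_of_mem_wordsOverCard hp₂
    have hl : (p.1 ++ p.2).length = m₁ + m₂ := by rw [List.length_append, hl₁, hl₂]
    refine (Finset.card_le_card ?_).trans
      (hlist (p.1 ++ p.2) (by omega) (by omega))
    intro x hx
    obtain ⟨hxC, rfl⟩ := Finset.mem_filter.mp hx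
    refine Finset.mem_filter.mpr ⟨hxC, ?_⟩
    simpa using (hsub₁ (x.take n₁)).append (hsub₂ (x.drop n₁))
  rw [Finset.card_product] at hcard
  calc C.card ≤ L * ((wordsOverCard q (q - (d + 1)) m₁).card *
        (wordsOverCard q (q - d) m₂).card) := hcard
    _ ≤ L * ((q.choose (q - (d + 1)) * (q - (d + 1)) ^ m₁) *
        (q.choose (q - d) * (q - d) ^ m₂)) := by
      gcongr <;> exact card_wordsOverCard_le _ _ _
    _ = _ := by rw [← Nat.sub_sub]; ring
end

section
/- Define f(δ) := (2/5)·min(δ, 1−δ). Let q ≥ 2 be an integer, let δ be a real number with 0 < δ < (q−1)/q, set d := ⌊qδ⌋ and δ' := δ − d/q, and suppose n is a positive integer such that n₁ := qδ'n, (d+1)n₁/q, and d(n−n₁)/q are all integers (so that δn is an integer). Let ε > 0 satisfy q < 2^{f(δ)/ε}. Then every code C ⊆ (Fin q)^n that is list-decodable from δn deletions with list size L satisfies |C| ≤ L · 4^q · q^{n(1−δ−ε)}. -/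
open Real

/-- Among the subsets of `T` with `k` elements, some one carries at least the average weight. -/
lemma exists_subset_card_eq_sum_ge {α : Type*} [DecidableEq α] (f : α → ℕ) (k : ℕ) (T : Finset α)
    (hk : k ≤ T.card) :
    ∃ S ⊆ T, S.card = k ∧ k * ∑ a ∈ T, f a ≤ T.card * ∑ a ∈ S, f a := by
  induction T using Finset.strongInduction with
  | H T ih =>
    rcases hk.eq_or_lt with h | h
    · exact ⟨T, subset_rfl, h.symm, by rw [h]⟩
    have hT : T.Nonempty := Finset.card_pos.mp (by omega)
    obtain ⟨a, ha, hmin⟩ := Finset.exists_min_image T f hT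
    have hle : T.card * f a ≤ ∑ b ∈ T, f b := by
      simpa using Finset.card_nsmul_le_sum T f (f a) hmin
    have hcard := Finset.card_erase_add_one ha
    have hsum := Finset.add_sum_erase T f ha
    obtain ⟨S, hS, hSk, hSf⟩ := ih (T.erase a) (Finset.erase_ssubset ha) (by omega)
    refine ⟨S, hS.trans (Finset.erase_subset a T), hSk, ?_⟩
    rcases Nat.eq_zero_or_pos k with rfl | hk0
    · simp
    set c := (T.erase a).card
    have hc : 0 < c := by omega
    rw [← hcard] at hle ⊢
    have hstep : c * ∑ b ∈ T, f b ≤ (c + 1) * ∑ b ∈ T.erase a, f b := by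
      rw [← hsum] at hle ⊢
      linarith
    refine Nat.le_of_mul_le_mul_left ?_ hc
    calc c * (k * ∑ b ∈ T, f b) = k * (c * ∑ b ∈ T, f b) := by ring
      _ ≤ k * ((c + 1) * ∑ b ∈ T.erase a, f b) := by gcongr
      _ = (c + 1) * (k * ∑ b ∈ T.erase a, f b) := by ring
      _ ≤ (c + 1) * (c * ∑ b ∈ S, f b) := by gcongr
      _ = c * ((c + 1) * ∑ b ∈ S, f b) := by ring

/-- The lists of length `s` over `Fin q` that use only the symbols of some `k`-element set. -/
def listsOfFewSymbols (q k s : ℕ) : Finset (List (Fin q)) :=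
  (Finset.powersetCard k Finset.univ).biUnion
    fun S => (Fintype.piFinset fun _ : Fin s => S).image List.ofFn

lemma mem_listsOfFewSymbols {q k s : ℕ} {w : List (Fin q)} {S : Finset (Fin q)}
    (hS : S.card = k) (hw : w.length = s) (hwS : ∀ a ∈ w, a ∈ S) :
    w ∈ listsOfFewSymbols q k s := by
  subst hw
  simp only [listsOfFewSymbols, Finset.mem_biUnion, Finset.mem_powersetCard, Finset.mem_image,
    Fintype.mem_piFinset]
  exact ⟨S, ⟨Finset.subset_univ S, hS⟩, w.get, fun i => hwS _ (w.get_mem i), List.ofFn_get w⟩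

lemma length_of_mem_listsOfFewSymbols {q k s : ℕ} {w : List (Fin q)}
    (hw : w ∈ listsOfFewSymbols q k s) : w.length = s := by
  simp only [listsOfFewSymbols, Finset.mem_biUnion, Finset.mem_image] at hw
  obtain ⟨_, _, _, _, rfl⟩ := hw
  exact List.length_ofFn

lemma card_listsOfFewSymbols_le (q k s : ℕ) :
    (listsOfFewSymbols q k s).card ≤ 2 ^ q * k ^ s := by
  calc (listsOfFewSymbols q k s).card
      ≤ (Finset.powersetCard k (Finset.univ : Finset (Fin q))).card * k ^ s := by
        refine Finset.card_biUnion_le_card_mul _ _ _ fun S hS => ?_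
        refine Finset.card_image_le.trans ?_
        simp [(Finset.mem_powersetCard.mp hS).2]
    _ ≤ 2 ^ q * k ^ s := by
        gcongr
        simpa using Nat.choose_le_two_pow q k

/-- Keeping only the `k` most frequent symbols keeps at least a `k / q` fraction of a list. -/
lemma exists_sublist_mem_listsOfFewSymbols {q k s : ℕ} (hq : 0 < q) (hk : k ≤ q) (x : List (Fin q))
    (hs : s * q ≤ k * x.length) : ∃ w ∈ listsOfFewSymbols q k s, w.Sublist x := by
  obtain ⟨S, -, hSk, hS⟩ := exists_subset_card_eq_sum_ge (fun a => x.count a) k Finset.univ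
    (by simpa using hk)
  have hall : ∑ a, x.count a = x.length := by
    simpa using Multiset.sum_count_eq_card (s := Finset.univ) (m := (x : Multiset (Fin q)))
      (fun a _ => Finset.mem_univ a)
  have hlen : (x.filter (· ∈ S)).length = ∑ a ∈ S, x.count a := by
    rw [← Multiset.coe_card, ← Multiset.sum_count_eq_card (s := S) (by simp)]
    refine Finset.sum_congr rfl fun a ha => ?_
    simp [List.count_filter, ha]
  rw [hall, Finset.card_univ, Fintype.card_fin, ← hlen] at hS
  have hle : s ≤ (x.filter (· ∈ S)).length :=
    Nat.le_of_mul_le_mul_left ((mul_comm q s).trans_le (hs.trans hS)) hq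
  refine ⟨(x.filter (· ∈ S)).take s, mem_listsOfFewSymbols hSk (by simpa using hle) fun a ha => ?_,
    (List.take_sublist _ _).trans List.filter_sublist⟩
  simpa using (List.mem_filter.mp (List.mem_of_mem_take ha)).2

lemma le_negMulLog_of_le_half {u : ℝ} (h0 : 0 < u) (h1 : u ≤ 1 / 2) :
    u * log 2 ≤ negMulLog u := by
  have h := log_le_log h0 h1
  rw [one_div, log_inv] at h
  rw [negMulLog]
  nlinarith

lemma le_negMulLog_of_half_le {u : ℝ} (h0 : 1 / 2 ≤ u) (h1 : u ≤ 1) :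
    (1 - u) * log 2 ≤ negMulLog u := by
  have h := concaveOn_negMulLog.2 (Set.mem_Ici.mpr (by norm_num : (0 : ℝ) ≤ 1 / 2))
    (Set.mem_Ici.mpr zero_le_one) (by linarith : 0 ≤ 2 * (1 - u)) (by linarith : 0 ≤ 2 * u - 1)
    (by ring)
  have hhalf : negMulLog (1 / 2) = 1 / 2 * log 2 := by
    rw [negMulLog, one_div, log_inv]; ring
  rw [hhalf, negMulLog_one] at h
  simp only [smul_eq_mul] at h
  have hu : 2 * (1 - u) * (1 / 2) + (2 * u - 1) * 1 = u := by ring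
  rw [hu] at h
  linarith

/-- Piecewise linear interpolation of `negMulLog` on the multiples of `1 / q` stays above
a multiple of the tent function. -/
lemma min_le_interpolate_negMulLog {q d : ℕ} (hd : d + 2 ≤ q) {x : ℝ} (hx0 : 0 ≤ x) (hx1 : x ≤ 1) :
    2 / 5 * min ((d + x) / q) (1 - (d + x) / q) * log 2 ≤
      x * negMulLog (1 - (d + 1) / q) + (1 - x) * negMulLog (1 - d / q) := by
  have hq : (0 : ℝ) < q := by exact_mod_cast (by omega : 0 < q)
  have hdq : (d : ℝ) + 2 ≤ q := by exact_mod_cast hd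
  have hδ0 : 0 ≤ (d + x) / q := by positivity
  have hδ1 : 0 ≤ 1 - (d + x) / q := by
    rw [sub_nonneg, div_le_one hq]; linarith
  have hx1' : 0 ≤ 1 - x := by linarith
  have hu1 : 0 < 1 - ((d : ℝ) + 1) / q := by
    rw [sub_pos, div_lt_one hq]; linarith
  have hu2 : 0 < 1 - (d : ℝ) / q := by
    rw [sub_pos, div_lt_one hq]; linarith
  have huu : (d : ℝ) / q ≤ (d + 1) / q := by gcongr; linarith
  have hdq0 : 0 ≤ (d : ℝ) / q := by positivity
  rcases le_or_gt (2 * (d + 1)) q with h | h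
  · have h' : ((d : ℝ) + 1) / q ≤ 1 / 2 := by
      have : 2 * ((d : ℝ) + 1) ≤ q := by exact_mod_cast h
      rw [div_le_iff₀ hq]; linarith
    have e1 := mul_le_mul_of_nonneg_left
      (le_negMulLog_of_half_le (u := 1 - (d + 1) / q) (by linarith) (by linarith)) hx0
    have e2 := mul_le_mul_of_nonneg_left
      (le_negMulLog_of_half_le (u := 1 - d / q) (by linarith) (by linarith)) hx1'
    calc _ ≤ (d + x) / q * log 2 := by
          gcongr
          linarith [min_le_left ((d + x) / q) (1 - (d + x) / q)]
      _ = x * ((1 - (1 - (d + 1) / q)) * log 2) + (1 - x) * ((1 - (1 - d / q)) * log 2) := by ring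
      _ ≤ _ := add_le_add e1 e2
  rcases le_or_gt q (2 * d) with h2 | h2
  · have h' : 1 / 2 ≤ (d : ℝ) / q := by
      have : (q : ℝ) ≤ 2 * d := by exact_mod_cast h2
      rw [le_div_iff₀ hq]; linarith
    have e1 := mul_le_mul_of_nonneg_left
      (le_negMulLog_of_le_half (u := 1 - (d + 1) / q) hu1 (by linarith)) hx0
    have e2 := mul_le_mul_of_nonneg_left
      (le_negMulLog_of_le_half (u := 1 - d / q) hu2 (by linarith)) hx1'
    calc _ ≤ (1 - (d + x) / q) * log 2 := by
          gcongr
          linarith [min_le_right ((d + x) / q) (1 - (d + x) / q)]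
      _ = x * ((1 - (d + 1) / q) * log 2) + (1 - x) * ((1 - d / q) * log 2) := by ring
      _ ≤ _ := add_le_add e1 e2
  · obtain rfl : q = 2 * d + 1 := by omega
    have hd1 : (1 : ℝ) ≤ d := by exact_mod_cast (by omega : 1 ≤ d)
    have hsum : 1 - ((d : ℝ) + 1) / ((2 * d + 1 : ℕ) : ℝ) = d / ((2 * d + 1 : ℕ) : ℝ) := by
      field_simp; push_cast; ring
    have hthird : 1 / 3 ≤ (d : ℝ) / ((2 * d + 1 : ℕ) : ℝ) := by
      rw [le_div_iff₀ hq]; push_cast; linarith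
    have hhalf : (d : ℝ) / ((2 * d + 1 : ℕ) : ℝ) ≤ 1 / 2 := by
      rw [div_le_iff₀ hq]; push_cast; linarith
    set v := (d : ℝ) / ((2 * d + 1 : ℕ) : ℝ)
    rw [hsum]
    have e1 := mul_le_mul_of_nonneg_left
      (le_negMulLog_of_le_half (u := v) (by linarith) hhalf) hx0
    have e2 := mul_le_mul_of_nonneg_left
      (le_negMulLog_of_half_le (u := 1 - v) (by linarith) (by linarith)) hx1'
    set δ := (d + x) / ((2 * d + 1 : ℕ) : ℝ)
    calc _ ≤ v * log 2 := by
          gcongr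
          linarith [min_le_left δ (1 - δ), min_le_right δ (1 - δ)]
      _ = x * (v * log 2) + (1 - x) * ((1 - (1 - v)) * log 2) := by ring
      _ ≤ _ := add_le_add e1 e2

/-- Deleting the rare symbols separately in a prefix and in the corresponding suffix of each
codeword bounds the size of a list-decodable code. -/
lemma card_le_of_listDecodable {q n n₁ k₁ k₂ s₁ s₂ L : ℕ} (hq : 0 < q) (hk₁ : k₁ ≤ q) (hk₂ : k₂ ≤ q) (hn₁ : n₁ ≤ n)
    (hs₁ : s₁ * q ≤ k₁ * n₁) (hs₂ : s₂ * q ≤ k₂ * (n - n₁))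
    (C : Finset (List (Fin q))) (hlen : ∀ x ∈ C, x.length = n)
    (hlist : ∀ w : List (Fin q), w.length = s₁ + s₂ →
      (C.filter (fun x => w.Sublist x)).card ≤ L) :
    C.card ≤ L * 4 ^ q * (k₁ ^ s₁ * k₂ ^ s₂) := by
  set W := Finset.image₂ (· ++ ·) (listsOfFewSymbols q k₁ s₁) (listsOfFewSymbols q k₂ s₂)
  have hW : W.card ≤ (2 ^ q * k₁ ^ s₁) * (2 ^ q * k₂ ^ s₂) :=
    (Finset.card_image₂_le _ _ _).trans
      (Nat.mul_le_mul (card_listsOfFewSymbols_le _ _ _) (card_listsOfFewSymbols_le _ _ _))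
  have hcover : C ⊆ W.biUnion fun w => C.filter (fun x => w.Sublist x) := by
    intro x hx
    have hxn := hlen x hx
    obtain ⟨w₁, hw₁, hsub₁⟩ := exists_sublist_mem_listsOfFewSymbols hq hk₁ (x.take n₁) (s := s₁)
      (by rwa [List.length_take, hxn, min_eq_left hn₁])
    obtain ⟨w₂, hw₂, hsub₂⟩ := exists_sublist_mem_listsOfFewSymbols hq hk₂ (x.drop n₁) (s := s₂)
      (by rwa [List.length_drop, hxn])
    refine Finset.mem_biUnion.mpr ⟨w₁ ++ w₂, Finset.mem_image₂_of_mem hw₁ hw₂,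
      Finset.mem_filter.mpr ⟨hx, ?_⟩⟩
    simpa using hsub₁.append hsub₂
  calc C.card ≤ _ := Finset.card_le_card hcover
    _ ≤ W.card * L := by
      refine Finset.card_biUnion_le_card_mul _ _ _ fun w hw => hlist w ?_
      obtain ⟨w₁, hw₁, w₂, hw₂, rfl⟩ := Finset.mem_image₂.mp hw
      rw [List.length_append, length_of_mem_listsOfFewSymbols hw₁,
        length_of_mem_listsOfFewSymbols hw₂]
    _ ≤ (2 ^ q * k₁ ^ s₁) * (2 ^ q * k₂ ^ s₂) * L := by gcongr
    _ = L * 4 ^ q * (k₁ ^ s₁ * k₂ ^ s₂) := by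
      rw [show (4 : ℕ) = 2 * 2 from rfl, mul_pow]; ring


/-- Concrete form of the paper's Corollary 4, with `f(δ) := (2/5)·min(δ, 1−δ)`.
Let `q ≥ 2`, `0 < δ < (q−1)/q`, `d := ⌊qδ⌋`, `δ' := δ − d/q`, and let `n > 0` be such
that `n₁ := qδ'n`, `(d+1)n₁/q` and `d(n−n₁)/q` are all integers (so `t := δn` is an
integer). If `q < 2^{f(δ)/ε}` for some `ε > 0`, then every code `C ⊆ (Fin q)^n` that
is list-decodable from `δn` deletions with list size `L` satisfies
`|C| ≤ L · 4^q · q^{n(1−δ−ε)}`. -/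
theorem stmt_7 (q : ℕ) (hq : 2 ≤ q) (δ ε : ℝ) (hδ0 : 0 < δ)
    (hδ1 : δ < ((q : ℝ) - 1) / q) (hε : 0 < ε)
    (hqsmall : (q : ℝ) < 2 ^ ((2 / 5 * min δ (1 - δ)) / ε))
    (n : ℕ) (hn : 0 < n)
    (n₁ t₁ t₂ : ℕ)
    (hn₁ : (n₁ : ℝ) = q * (δ - (⌊(q : ℝ) * δ⌋₊ : ℝ) / q) * n)
    (ht₁ : (t₁ : ℝ) = ((⌊(q : ℝ) * δ⌋₊ : ℝ) + 1) * n₁ / q)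
    (ht₂ : (t₂ : ℝ) = (⌊(q : ℝ) * δ⌋₊ : ℝ) * ((n : ℝ) - n₁) / q)
    (t : ℕ) (ht : (t : ℝ) = δ * n)
    (C : Finset (List (Fin q))) (hlen : ∀ x ∈ C, x.length = n)
    (L : ℕ)
    (hlist : ∀ w : List (Fin q), n - t ≤ w.length → w.length ≤ n →
      (C.filter (fun x => w.Sublist x)).card ≤ L) :
    (C.card : ℝ) ≤ L * 4 ^ q * (q : ℝ) ^ ((n : ℝ) * (1 - δ - ε)) := by
  have hq0 : (0 : ℝ) < q := by exact_mod_cast (by omega : 0 < q)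
  have hqne := hq0.ne'
  have hn0 : (0 : ℝ) < n := by exact_mod_cast hn
  set d := ⌊(q : ℝ) * δ⌋₊
  have hdle : (d : ℝ) ≤ q * δ := Nat.floor_le (by positivity)
  have hdlt : (q : ℝ) * δ < d + 1 := Nat.lt_floor_add_one _
  have hqδ : (q : ℝ) * δ < q - 1 := by
    rw [lt_div_iff₀ hq0] at hδ1; linarith
  have hd : d + 2 ≤ q := by
    have : (d : ℝ) + 1 < q := by linarith
    exact_mod_cast this
  set x := (q : ℝ) * δ - d with hx
  have hx0 : 0 ≤ x := by linarith
  have hx1 : x ≤ 1 := by linarith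
  have hδx : (d + x) / q = δ := by rw [hx]; field_simp; ring
  have hn₁x : (n₁ : ℝ) = x * n := by rw [hn₁, hx]; field_simp
  have hn₁n : n₁ ≤ n := by
    have : (n₁ : ℝ) ≤ n := by rw [hn₁x]; nlinarith
    exact_mod_cast this
  have hmin := min_le_interpolate_negMulLog hd hx0 hx1
  rw [hδx] at hmin
  have hlogq : ε * log q < 2 / 5 * min δ (1 - δ) * log 2 := by
    have h := log_lt_log hq0 hqsmall
    rw [log_rpow two_pos, div_mul_eq_mul_div, lt_div_iff₀ hε] at h
    linarith
  clear_value d x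
  obtain ⟨k, rfl⟩ := Nat.exists_eq_add_of_le hd
  obtain ⟨m, rfl⟩ := Nat.exists_eq_add_of_le hn₁n
  have ht₁' : t₁ * (d + 2 + k) = (d + 1) * n₁ := by
    have : (t₁ : ℝ) * ((d + 2 + k : ℕ) : ℝ) = (d + 1) * n₁ := by rw [ht₁]; field_simp
    exact_mod_cast this
  have ht₂' : t₂ * (d + 2 + k) = d * m := by
    have : (t₂ : ℝ) * ((d + 2 + k : ℕ) : ℝ) = d * m := by
      rw [ht₂]; field_simp; push_cast; ring
    exact_mod_cast this
  have htt : t = t₁ + t₂ := by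
    have : (t : ℝ) = t₁ + t₂ := by
      rw [ht, ht₁, ht₂, hn₁x, ← hδx]; field_simp; ring
    exact_mod_cast this
  have ht₁n : t₁ ≤ n₁ := by nlinarith
  have ht₂n : t₂ ≤ m := by nlinarith
  obtain ⟨s₁, rfl⟩ := Nat.exists_eq_add_of_le ht₁n
  obtain ⟨s₂, rfl⟩ := Nat.exists_eq_add_of_le ht₂n
  have hcard := card_le_of_listDecodable (L := L) (k₁ := k + 1) (k₂ := k + 2) (s₁ := s₁) (s₂ := s₂)
    (n₁ := t₁ + s₁) (by omega) (by omega) (by omega) (by omega)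
    (by nlinarith) (by rw [Nat.add_sub_cancel_left]; nlinarith) C hlen
    (fun w hw => hlist w (by omega) (by omega))
  refine (Nat.cast_le (α := ℝ).mpr hcard).trans ?_
  rw [Nat.cast_mul, Nat.cast_mul, Nat.cast_pow, Nat.cast_mul, Nat.cast_pow, Nat.cast_pow,
    Nat.cast_ofNat]
  gcongr
  have hk₁ : (0 : ℝ) < (k + 1 : ℕ) := by positivity
  have hk₂ : (0 : ℝ) < (k + 2 : ℕ) := by positivity
  set n := t₁ + s₁ + (t₂ + s₂)
  have hs₁ : (s₁ : ℝ) = x * n * ((k + 1 : ℕ) / (d + 2 + k : ℕ)) := by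
    have h : (s₁ : ℝ) = (t₁ + s₁ : ℕ) - t₁ := by push_cast; ring
    rw [h, ht₁, hn₁x]; field_simp; push_cast; ring
  have hs₂ : (s₂ : ℝ) = (1 - x) * n * ((k + 2 : ℕ) / (d + 2 + k : ℕ)) := by
    have h : (s₂ : ℝ) = n - (t₁ + s₁ : ℕ) - t₂ := by simp only [n]; push_cast; ring
    rw [h, ht₂, hn₁x]; field_simp; push_cast; ring
  have hu₁ : 1 - ((d : ℝ) + 1) / (d + 2 + k : ℕ) = (k + 1 : ℕ) / (d + 2 + k : ℕ) := by
    field_simp; push_cast; ring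
  have hu₂ : 1 - (d : ℝ) / (d + 2 + k : ℕ) = (k + 2 : ℕ) / (d + 2 + k : ℕ) := by
    field_simp; push_cast; ring
  have hδ' : 1 - δ = x * ((k + 1 : ℕ) / (d + 2 + k : ℕ)) +
      (1 - x) * ((k + 2 : ℕ) / (d + 2 + k : ℕ)) := by
    rw [← hδx]; field_simp; push_cast; ring
  rw [hu₁, hu₂, negMulLog, negMulLog, log_div hk₁.ne' hqne, log_div hk₂.ne' hqne] at hmin
  rw [← log_le_log_iff (by positivity) (by positivity), log_mul (by positivity) (by positivity),
    log_pow, log_pow, log_rpow hq0, hs₁, hs₂, hδ']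
  have h := mul_le_mul_of_nonneg_left (hlogq.le.trans hmin) hn0.le
  linarith
end

section
/- Let q ≥ 2 be an integer and let δ be a real number with 0 ≤ δ < (q−1)/q. Set d := ⌊qδ⌋ and δ' := δ − d/q (so 0 ≤ δ' < 1/q and d ≤ q−2). Then qδ'·((q−d−1)/q)·log₂(q/(q−d−1)) + (1−qδ')·((q−d)/q)·log₂(q/(q−d)) ≥ (2/5)·min(δ, 1−δ). -/
open Real

/-- The quadratic `x (1 - x)` is a lower bound for `-x log₂ x` on `(0, 1]`. -/
lemma mul_one_sub_le_mul_logb_inv {x : ℝ} (hx : 0 < x) (hx1 : x ≤ 1) :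
    x * (1 - x) ≤ x * Real.logb 2 x⁻¹ := by
  have hlog : 1 - x ≤ Real.log x⁻¹ := by
    rw [Real.log_inv]
    linarith [Real.log_le_sub_one_of_pos hx]
  have hlog_two : Real.log 2 ≤ 1 := by linarith [Real.log_two_lt_d9]
  refine mul_le_mul_of_nonneg_left (hlog.trans ?_) hx.le
  exact le_div_self (by linarith) (Real.log_pos one_lt_two) hlog_two

/-- The chord of `x (1 - x)` between consecutive points `(k - 1) / q` and `k / q` of the grid
dominates `(2 / 5) min (1 - y) y`, provided `2 ≤ k ≤ q`. -/
lemma min_le_chord_mul_one_sub {q k : ℕ} (hk : 2 ≤ k) (hkq : k ≤ q) {a b t : ℝ}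
    (ha : a = ((k : ℝ) - 1) / q) (hb : b = (k : ℝ) / q) (ht : 0 ≤ t) (ht1 : t ≤ 1) :
    (2 / 5) * min (1 - (t * a + (1 - t) * b)) (t * a + (1 - t) * b) ≤
      t * (a * (1 - a)) + (1 - t) * (b * (1 - b)) := by
  have hq : (0 : ℝ) < q := by exact_mod_cast (by omega : 0 < q)
  have hk' : (2 : ℝ) ≤ k := by exact_mod_cast hk
  have hab : a ≤ b := by rw [ha, hb]; gcongr; linarith
  have ha0 : 0 ≤ a := by rw [ha]; exact div_nonneg (by linarith) hq.le
  have hb1 : b ≤ 1 := by rw [hb, div_le_one hq]; exact_mod_cast hkq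
  rcases le_or_gt b (3 / 5) with h | h
  · have hpa : 2 / 5 * a ≤ a * (1 - a) := by nlinarith
    have hpb : 2 / 5 * b ≤ b * (1 - b) := by nlinarith
    have := mul_le_mul_of_nonneg_left hpa ht
    have := mul_le_mul_of_nonneg_left hpb (sub_nonneg.2 ht1)
    linarith [min_le_right (1 - (t * a + (1 - t) * b)) (t * a + (1 - t) * b)]
  rcases le_or_gt (2 / 5) a with h' | h'
  · have hpa : 2 / 5 * (1 - a) ≤ a * (1 - a) := by nlinarith
    have hpb : 2 / 5 * (1 - b) ≤ b * (1 - b) := by nlinarith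
    have := mul_le_mul_of_nonneg_left hpa ht
    have := mul_le_mul_of_nonneg_left hpb (sub_nonneg.2 ht1)
    linarith [min_le_left (1 - (t * a + (1 - t) * b)) (t * a + (1 - t) * b)]
  rw [hb, lt_div_iff₀ hq] at h
  rw [ha, div_lt_iff₀ hq] at h'
  have h₁ : 3 * q < 5 * k := by
    have : (3 : ℝ) * q < 5 * k := by linarith
    exact_mod_cast this
  have h₂ : 5 * k < 2 * q + 5 := by
    have : (5 : ℝ) * k < 2 * q + 5 := by linarith
    exact_mod_cast this
  obtain rfl : q = 3 := by omega
  obtain rfl : k = 2 := by omega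
  norm_num at ha hb
  subst ha hb
  linarith [min_le_left (1 - (t * (1 / 3) + (1 - t) * (2 / 3))) (t * (1 / 3) + (1 - t) * (2 / 3)),
    min_le_right (1 - (t * (1 / 3) + (1 - t) * (2 / 3))) (t * (1 / 3) + (1 - t) * (2 / 3))]

/-- Key analytic inequality in the proof of the paper's Corollary 4. For `q ≥ 2` and
`0 ≤ δ < (q−1)/q`, with `d := ⌊qδ⌋` and `δ' := δ − d/q`, the convex combination
`qδ'·((q−d−1)/q)·log₂(q/(q−d−1)) + (1−qδ')·((q−d)/q)·log₂(q/(q−d))` is at least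
`f(δ) = (2/5)·min(δ, 1−δ)`. -/
theorem stmt_8 (q : ℕ) (hq : 2 ≤ q) (δ : ℝ) (hδ0 : 0 ≤ δ)
    (hδ1 : δ < ((q : ℝ) - 1) / q) :
    (2 / 5) * min δ (1 - δ) ≤
      (q : ℝ) * (δ - (⌊(q : ℝ) * δ⌋₊ : ℝ) / q) *
          (((q : ℝ) - (⌊(q : ℝ) * δ⌋₊ : ℝ) - 1) / q) *
          Real.logb 2 ((q : ℝ) / ((q : ℝ) - (⌊(q : ℝ) * δ⌋₊ : ℝ) - 1)) +
        (1 - (q : ℝ) * (δ - (⌊(q : ℝ) * δ⌋₊ : ℝ) / q)) *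
          (((q : ℝ) - (⌊(q : ℝ) * δ⌋₊ : ℝ)) / q) *
          Real.logb 2 ((q : ℝ) / ((q : ℝ) - (⌊(q : ℝ) * δ⌋₊ : ℝ))) := by
  have hq0 : (0 : ℝ) < q := by exact_mod_cast (by omega : 0 < q)
  have hqδ : 0 ≤ (q : ℝ) * δ := by positivity
  have hfloor_le := Nat.floor_le hqδ
  have hlt_floor := Nat.lt_floor_add_one ((q : ℝ) * δ)
  generalize ⌊(q : ℝ) * δ⌋₊ = d at *
  rw [lt_div_iff₀ hq0] at hδ1
  have hdq : d + 2 ≤ q := by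
    have : (d : ℝ) + 1 < q := by linarith
    exact_mod_cast this
  have hdq' : (d : ℝ) + 2 ≤ q := by exact_mod_cast hdq
  have ht : (q : ℝ) * (δ - (d : ℝ) / q) = q * δ - d := by field_simp
  set t : ℝ := (q : ℝ) * (δ - (d : ℝ) / q)
  set a : ℝ := ((q : ℝ) - d - 1) / q with ha
  set b : ℝ := ((q : ℝ) - d) / q with hb
  have ht0 : 0 ≤ t := by linarith
  have ht1 : t ≤ 1 := by linarith
  have hy : t * a + (1 - t) * b = 1 - δ := by
    rw [ht, ha, hb]
    field_simp
    ring
  have hpa := mul_one_sub_le_mul_logb_inv (x := a) (div_pos (by linarith) hq0)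
    ((div_le_one hq0).2 (by linarith [Nat.cast_nonneg (α := ℝ) d]))
  have hpb := mul_one_sub_le_mul_logb_inv (x := b) (div_pos (by linarith) hq0)
    ((div_le_one hq0).2 (by linarith [Nat.cast_nonneg (α := ℝ) d]))
  have hchord := min_le_chord_mul_one_sub (q := q) (k := q - d) (a := a) (b := b)
    (by omega) (Nat.sub_le q d) (by rw [Nat.cast_sub (by omega)])
    (by rw [Nat.cast_sub (by omega)]) ht0 ht1
  rw [hy, sub_sub_cancel] at hchord
  rw [← inv_div ((q : ℝ) - d - 1), ← inv_div ((q : ℝ) - d), ← ha, ← hb, mul_assoc t, mul_assoc (1 - t)]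
  exact hchord.trans (add_le_add (mul_le_mul_of_nonneg_left hpa ht0)
    (mul_le_mul_of_nonneg_left hpb (sub_nonneg.2 ht1)))
end

section
/- Let A be a string of length n and B a string of length m over the same alphabet, and let K ≥ 1. Let M₁, …, M_K be monotone matchings between A and B whose sets of B-coordinates are pairwise disjoint, and suppose that for each t, M_t has maximum cardinality among all monotone matchings between A and B whose B-coordinates avoid the B-coordinates of M₁, …, M_{t−1}. Then for every monotone matching M' between A and B, the number of pairs of M' whose B-coordinate does not occur as a B-coordinate of any of M₁, …, M_K is at most m/K. -/
/-- A monotone matching between words `X` and `Y`: a finite set of pairs of positions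
`(i, j)` with `X[i] = Y[j]`, increasing in both coordinates simultaneously. -/
def IsMonotoneMatching {A : Type*} (X Y : List A) (M : Finset (ℕ × ℕ)) : Prop :=
  (∀ p ∈ M, p.1 < X.length ∧ p.2 < Y.length ∧ X[p.1]? = Y[p.2]?) ∧
  (∀ p ∈ M, ∀ q ∈ M, (p.1 < q.1 ↔ p.2 < q.2))

theorem IsMonotoneMatching.subset {A : Type*} {X Y : List A} {M N : Finset (ℕ × ℕ)}
    (hM : IsMonotoneMatching X Y M) (hN : N ⊆ M) : IsMonotoneMatching X Y N :=
  ⟨fun p hp => hM.1 p (hN hp), fun p hp q hq => hM.2 p (hN hp) q (hN hq)⟩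

theorem IsMonotoneMatching.injOn_snd {A : Type*} {X Y : List A} {M : Finset (ℕ × ℕ)}
    (hM : IsMonotoneMatching X Y M) : Set.InjOn Prod.snd (M : Set (ℕ × ℕ)) := by
  intro p hp q hq h
  have h₁ := hM.2 p hp q hq
  have h₂ := hM.2 q hq p hp
  exact Prod.ext (by omega) h

/-- Greedy covering lemma (core of Lemma 3.2 of the paper). Let `M₁, …, M_K` be
monotone matchings between `X` (length `n`) and `Y` (length `m`) with pairwise disjoint
`Y`-coordinates, each `M_t` of maximum cardinality among monotone matchings whose
`Y`-coordinates avoid those of `M₁, …, M_{t−1}`. Then for every monotone matching `M'`,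
the number of pairs of `M'` whose `Y`-coordinate occurs in none of the `M_t` is at most
`m/K`. -/
theorem stmt_11 {A : Type*} (X Y : List A) (n m K : ℕ)
    (hX : X.length = n) (hY : Y.length = m) (hK : 1 ≤ K)
    (M : Fin K → Finset (ℕ × ℕ))
    (hmm : ∀ t, IsMonotoneMatching X Y (M t))
    (hdisj : ∀ t t', t ≠ t' → ∀ p ∈ M t, ∀ p' ∈ M t', p.2 ≠ p'.2)
    (hmax : ∀ t : Fin K, ∀ N : Finset (ℕ × ℕ), IsMonotoneMatching X Y N →
      (∀ p ∈ N, ∀ t' : Fin K, t' < t → ∀ p' ∈ M t', p.2 ≠ p'.2) →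
      N.card ≤ (M t).card)
    (M' : Finset (ℕ × ℕ)) (hM' : IsMonotoneMatching X Y M') :
    K * (M'.filter (fun p => ∀ t, ∀ p' ∈ M t, p.2 ≠ p'.2)).card ≤ m := by
  set L := M'.filter (fun p => ∀ t, ∀ p' ∈ M t, p.2 ≠ p'.2)
  have hle : ∀ t, L.card ≤ (M t).card := fun t =>
    hmax t L (hM'.subset (Finset.filter_subset _ _))
      fun p hp t' _ => (Finset.mem_filter.mp hp).2 t'
  have hpair : ((Finset.univ : Finset (Fin K)) : Set (Fin K)).PairwiseDisjoint
      fun t => (M t).image Prod.snd := by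
    intro t _ t' _ htt'
    simp only [Function.onFun, Finset.disjoint_left, Finset.mem_image]
    rintro _ ⟨p, hp, rfl⟩ ⟨p', hp', h⟩
    exact hdisj t t' htt' p hp p' hp' h.symm
  have hsub : (Finset.univ.biUnion fun t => (M t).image Prod.snd) ⊆ Finset.range m := by
    intro j hj
    simp only [Finset.mem_biUnion, Finset.mem_image] at hj
    obtain ⟨t, -, p, hp, rfl⟩ := hj
    exact Finset.mem_range.mpr (hY ▸ ((hmm t).1 p hp).2.1)
  calc K * L.card = ∑ _t : Fin K, L.card := by simp
    _ ≤ ∑ t, (M t).card := Finset.sum_le_sum fun t _ => hle t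
    _ = ∑ t, ((M t).image Prod.snd).card :=
      Finset.sum_congr rfl fun t _ => (Finset.card_image_of_injOn (hmm t).injOn_snd).symm
    _ = (Finset.univ.biUnion fun t => (M t).image Prod.snd).card :=
      (Finset.card_biUnion hpair).symm
    _ ≤ m := by simpa using Finset.card_le_card hsub
end

section
/- Let ε, γ > 0 and 0 ≤ δ < 1 be reals such that K := 2(1+γ)/ε is a positive integer. Let S be an (ε²/(4(1+γ)))-synchronization string of length n over an alphabet Σ, and let S' be a string over Σ of length m ≤ (1+γ)n. Then there exist sets A₁, …, A_n of positions of S' (depending only on S and S') with |A_i| ≤ 2(1+γ)/ε for every i and Σ_i |A_i| ≤ (1+γ)n, such that for every monotone matching M' between S and S' with |M'| ≥ (1−δ)n, the number of indices i ∈ {1, …, n} for which some pair (i, j) ∈ M' has j ∈ A_i is at least (1 − δ − ε)·n. -/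
/-- A strictly increasing family of positions of `S` inside `[i, j)` spells a subsequence of
`S[i, j)`. -/
theorem map_getD_sublist_take_drop {A : Type*} (S : List A) (a : A) {L : List ℕ} {i j : ℕ}
    (hL : L.Pairwise (· < ·)) (hmem : ∀ x ∈ L, i ≤ x ∧ x < j) (hj : j ≤ S.length) :
    (L.map fun x => S.getD x a).Sublist ((S.drop i).take (j - i)) := by
  have hsub : L.Sublist (List.range' i (j - i)) := by
    refine List.sublist_of_subperm_of_pairwise (r := (· < ·)) ?_ hL List.pairwise_lt_range'
    refine List.subperm_of_subset (hL.imp fun h => h.ne) fun x hx => ?_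
    have := hmem x hx
    rw [List.mem_range'_1]
    omega
  have heq : (S.drop i).take (j - i) = (List.range' i (j - i)).map fun x => S.getD x a := by
    apply List.ext_getElem
    · simp
      omega
    · intro k h₁ h₂
      simp at h₁ h₂ ⊢
      rw [List.getElem?_eq_getElem (by omega)]
      rfl
  rw [heq]
  exact hsub.map _

/-- In an `η`-synchronization string, a monotone self-matching whose pairs all move strictly
to the right, from positions at least `x` to positions at least `y`, has at most
`η * ((n - x) + (n - y)) / 2` pairs. -/
theorem card_le_of_sync_of_lt {A : Type*} {S : List A} {η : ℝ} (hη : 0 ≤ η)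
    (hsync : ∀ i j k : ℕ, i < j → j < k → k ≤ S.length → ∀ v : List A,
      v.Sublist ((S.drop i).take (j - i)) → v.Sublist ((S.drop j).take (k - j)) →
      (v.length : ℝ) < η * ((k : ℝ) - i) / 2)
    {f g : ℕ → ℕ} (D : Finset ℕ) {x y : ℕ} (hf : StrictMonoOn f D) (hg : StrictMonoOn g D)
    (hfg : ∀ j ∈ D, f j < g j) (hlt : ∀ j ∈ D, g j < S.length)
    (heq : ∀ j ∈ D, S[f j]? = S[g j]?) (hx : ∀ j ∈ D, x ≤ f j) (hy : ∀ j ∈ D, y ≤ g j)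
    (hxn : x ≤ S.length) (hyn : y ≤ S.length) :
    (D.card : ℝ) ≤ η * ((S.length - x) + (S.length - y)) / 2 := by
  induction D using Finset.strongInduction generalizing x y with
  | H D ih =>
  rcases D.eq_empty_or_nonempty with rfl | hD
  · have h₁ : (x : ℝ) ≤ S.length := by exact_mod_cast hxn
    have h₂ : (y : ℝ) ≤ S.length := by exact_mod_cast hyn
    have : 0 ≤ η * (((S.length : ℝ) - x) + (S.length - y)) := mul_nonneg hη (by linarith)
    simp only [Finset.card_empty, Nat.cast_zero]
    linarith
  set d := D.min' hD
  have hd : d ∈ D := D.min'_mem hD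
  have hdmin : ∀ j ∈ D, d ≤ j := fun j hj => D.min'_le j hj
  set G := D.filter (fun j => f j < g d)
  have hGD : G ⊆ D := Finset.filter_subset _ _
  have hdG : d ∈ G := Finset.mem_filter.2 ⟨hd, hfg d hd⟩
  set l := G.max' ⟨d, hdG⟩
  have hlG : l ∈ G := G.max'_mem _
  have hlmax : ∀ j ∈ G, j ≤ l := fun j hj => G.le_max' j hj
  have hl := Finset.mem_filter.1 hlG
  have hgroup : (G.card : ℝ) < η * (((g l + 1 : ℕ) : ℝ) - f d) / 2 := by
    have hlen := hlt l hl.1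
    have hlend : g d ≤ g l := hg.monotoneOn hd hl.1 (hdmin l hl.1)
    have hfd : f d < S.length := by have := hfg d hd; omega
    set a := S[f d]
    have hpair : ∀ h : ℕ → ℕ, StrictMonoOn h D →
        ((G.sort (· ≤ ·)).map h).Pairwise (· < ·) := by
      intro h hh
      rw [List.pairwise_map]
      refine (G.sortedLT_sort).pairwise.imp_of_mem fun hu hv huv => ?_
      exact hh (hGD ((Finset.mem_sort _).1 hu)) (hGD ((Finset.mem_sort _).1 hv)) huv
    have h₁ := map_getD_sublist_take_drop S a (hpair f hf) (i := f d) (j := g d)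
      (by
        intro z hz
        obtain ⟨j, hj, rfl⟩ := List.mem_map.1 hz
        have hj := (Finset.mem_sort _).1 hj
        exact ⟨hf.monotoneOn hd (hGD hj) (hdmin j (hGD hj)), (Finset.mem_filter.1 hj).2⟩)
      (by omega)
    have h₂ := map_getD_sublist_take_drop S a (hpair g hg) (i := g d) (j := g l + 1)
      (by
        intro z hz
        obtain ⟨j, hj, rfl⟩ := List.mem_map.1 hz
        have hj := (Finset.mem_sort _).1 hj
        have := hg.monotoneOn (hGD hj) hl.1 (hlmax j hj)
        exact ⟨hg.monotoneOn hd (hGD hj) (hdmin j (hGD hj)), by omega⟩)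
      (by omega)
    have hv : ((G.sort (· ≤ ·)).map g).map (fun x => S.getD x a) =
        ((G.sort (· ≤ ·)).map f).map (fun x => S.getD x a) := by
      rw [List.map_map, List.map_map]
      refine List.map_congr_left fun j hj => ?_
      simp only [Function.comp, List.getD_eq_getElem?_getD]
      rw [heq j (hGD ((Finset.mem_sort _).1 hj))]
    rw [hv] at h₂
    simpa using hsync (f d) (g d) (g l + 1) (hfg d hd) (by omega) (by omega) _ h₁ h₂
  have hrest := ih (D.filter fun j => ¬ f j < g d) (x := g d) (y := g l + 1)
    (Finset.filter_ssubset.2 ⟨d, hd, by simpa using hfg d hd⟩)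
    (hf.mono fun j hj => (Finset.mem_filter.1 hj).1)
    (hg.mono fun j hj => (Finset.mem_filter.1 hj).1)
    (fun j hj => hfg j (Finset.mem_filter.1 hj).1)
    (fun j hj => hlt j (Finset.mem_filter.1 hj).1)
    (fun j hj => heq j (Finset.mem_filter.1 hj).1)
    (fun j hj => not_lt.1 (Finset.mem_filter.1 hj).2)
    (fun j hj => by
      obtain ⟨hj, hjd⟩ := Finset.mem_filter.1 hj
      refine hg hl.1 hj ?_
      by_contra! hle
      have := hf.monotoneOn hj hl.1 hle
      omega)
    (hlt d hd).le (hlt l hl.1)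
  have hcard : (D.card : ℝ) = G.card + (D.filter fun j => ¬ f j < g d).card := by
    exact_mod_cast (Finset.card_filter_add_card_filter_not (fun j => f j < g d)).symm
  have hxd : (x : ℝ) ≤ f d := by exact_mod_cast hx d hd
  have hyd : (y : ℝ) ≤ g d := by exact_mod_cast hy d hd
  have := mul_le_mul_of_nonneg_left (add_le_add hxd hyd) hη
  linarith

/-- An `η`-synchronization string has no fixed-point-free monotone self-matching with more
than `η * n` pairs. -/
theorem card_le_of_sync_of_ne {A : Type*} {S : List A} {η : ℝ} (hη : 0 ≤ η)
    (hsync : ∀ i j k : ℕ, i < j → j < k → k ≤ S.length → ∀ v : List A,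
      v.Sublist ((S.drop i).take (j - i)) → v.Sublist ((S.drop j).take (k - j)) →
      (v.length : ℝ) < η * ((k : ℝ) - i) / 2)
    {f g : ℕ → ℕ} {D : Finset ℕ} (hf : StrictMonoOn f D) (hg : StrictMonoOn g D)
    (hfg : ∀ j ∈ D, f j ≠ g j) (hflt : ∀ j ∈ D, f j < S.length)
    (hglt : ∀ j ∈ D, g j < S.length) (heq : ∀ j ∈ D, S[f j]? = S[g j]?) :
    (D.card : ℝ) ≤ η * S.length := by
  have := card_le_of_sync_of_lt hη hsync (f := fun j => min (f j) (g j))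
    (g := fun j => max (f j) (g j)) D (x := 0) (y := 0)
    (fun i hi j hj hij => min_lt_min (hf hi hj hij) (hg hi hj hij))
    (fun i hi j hj hij => max_lt_max (hf hi hj hij) (hg hi hj hij))
    (fun j hj => min_lt_max.2 (hfg j hj))
    (fun j hj => max_lt (hflt j hj) (hglt j hj))
    (fun j hj => by
      rcases le_total (f j) (g j) with h | h
      · simpa [h] using heq j hj
      · simpa [h] using (heq j hj).symm)
    (by simp) (by simp) (by simp) (by simp)
  simp only [Nat.cast_zero, sub_zero] at this
  linarith

/-- `f` embeds the positions `D` of `Y` monotonically into `X`, preserving letters. -/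
def IsLetterEmbedding {A : Type*} (X Y : List A) (D : Finset ℕ) (f : ℕ → ℕ) : Prop :=
  StrictMonoOn f D ∧ ∀ j ∈ D, f j < X.length ∧ X[f j]? = Y[j]?

theorem IsLetterEmbedding.mono {A : Type*} {X Y : List A} {D E : Finset ℕ} {f : ℕ → ℕ}
    (h : IsLetterEmbedding X Y D f) (hE : E ⊆ D) : IsLetterEmbedding X Y E f :=
  ⟨h.1.mono (by exact_mod_cast hE), fun j hj => h.2 j (hE hj)⟩

theorem exists_max_isLetterEmbedding {A : Type*} (X Y : List A) (R : Finset ℕ) :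
    ∃ (D : Finset ℕ) (f : ℕ → ℕ), D ⊆ R ∧ IsLetterEmbedding X Y D f ∧
      ∀ (Q : Finset ℕ) (g : ℕ → ℕ), Q ⊆ R → IsLetterEmbedding X Y Q g → Q.card ≤ D.card := by
  classical
  obtain ⟨D, hD, hmax⟩ := Finset.exists_max_image
    (R.powerset.filter fun D => ∃ f, IsLetterEmbedding X Y D f) Finset.card
    ⟨∅, by simp [IsLetterEmbedding, StrictMonoOn]⟩
  simp only [Finset.mem_filter, Finset.mem_powerset] at hD hmax
  obtain ⟨hDR, f, hf⟩ := hD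
  exact ⟨D, f, hDR, hf, fun Q g hQ hg => hmax Q ⟨hQ, g, hg⟩⟩

/-- Extracting a largest common subsequence of `X` and the remaining letters of `Y`,
repeatedly: `R t` are the positions of `Y` left after `t` rounds, and `D t`, `f t` is the
matching found in round `t`. -/
theorem exists_greedy_isLetterEmbedding {A : Type*} (X Y : List A) (m : ℕ) :
    ∃ (R D : ℕ → Finset ℕ) (f : ℕ → ℕ → ℕ), R 0 = Finset.range m ∧
      (∀ t, R (t + 1) = R t \ D t) ∧ (∀ t, D t ⊆ R t) ∧
      (∀ t, IsLetterEmbedding X Y (D t) (f t)) ∧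
      ∀ t (Q : Finset ℕ) (g : ℕ → ℕ), Q ⊆ R t → IsLetterEmbedding X Y Q g →
        Q.card ≤ (D t).card := by
  choose E F hsub hemb hmax using exists_max_isLetterEmbedding X Y
  let R : ℕ → Finset ℕ := fun t => (fun R => R \ E R)^[t] (Finset.range m)
  exact ⟨R, fun t => E (R t), fun t => F (R t), rfl,
    fun t => Function.iterate_succ_apply' _ _ _, fun t => hsub _, fun t => hemb _,
    fun t => hmax _⟩

/-- A monotone matching, viewed as a letter embedding of the matched positions of `Y`. -/
theorem IsMonotoneMatching.exists_isLetterEmbedding {A : Type*} {X Y : List A}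
    {M : Finset (ℕ × ℕ)} (hM : IsMonotoneMatching X Y M) :
    ∃ f, IsLetterEmbedding X Y (M.image Prod.snd) f ∧
      (∀ j ∈ M.image Prod.snd, (f j, j) ∈ M) ∧ (M.image Prod.snd).card = M.card := by
  have hex : ∀ j, ∃ i, j ∈ M.image Prod.snd → (i, j) ∈ M := by
    intro j
    by_cases h : j ∈ M.image Prod.snd
    · obtain ⟨p, hp, rfl⟩ := Finset.mem_image.1 h
      exact ⟨p.1, fun _ => hp⟩
    · exact ⟨0, fun h' => absurd h' h⟩
  choose f hf using hex
  refine ⟨f, ⟨fun i hi j hj hij => (hM.2 _ (hf i hi) _ (hf j hj)).2 hij, fun j hj => ?_⟩, hf, ?_⟩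
  · have := hM.1 _ (hf j hj)
    exact ⟨this.1, this.2.2⟩
  · refine Finset.card_image_of_injOn fun p hp q hq hpq => ?_
    have h₁ := hM.2 p hp q hq
    have h₂ := hM.2 q hq p hp
    have hpq : p.2 = q.2 := hpq
    exact Prod.ext (by omega) hpq

/-- Theorem 3.3 of the paper. Let `ε, γ > 0` and `0 ≤ δ < 1` with `K := 2(1+γ)/ε` a
positive integer, let `S` be an `(ε²/(4(1+γ)))`-synchronization string of length `n`
and `S'` a string of length `m ≤ (1+γ)n`. Then there are candidate lists
`A₁, …, A_n` of positions of `S'`, each of size at most `2(1+γ)/ε` and of total size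
at most `(1+γ)n`, such that any monotone matching `M'` between `S` and `S'` with
`|M'| ≥ (1−δ)n` places pairs `(i, j)` with `j ∈ A_i` for at least `(1−δ−ε)n` indices
`i`. -/
theorem stmt_13 {A : Type*} (ε γ δ : ℝ) (hε : 0 < ε) (hγ : 0 < γ)
    (hδ0 : 0 ≤ δ) (hδ1 : δ < 1)
    (K : ℕ) (hKpos : 0 < K) (hK : (K : ℝ) = 2 * (1 + γ) / ε)
    (n m : ℕ) (S S' : List A) (hS : S.length = n) (hS' : S'.length = m)
    (hm : (m : ℝ) ≤ (1 + γ) * n)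
    (hsync : ∀ i j k : ℕ, i < j → j < k → k ≤ n → ∀ v : List A,
      v.Sublist ((S.drop i).take (j - i)) →
      v.Sublist ((S.drop j).take (k - j)) →
      (v.length : ℝ) < (ε ^ 2 / (4 * (1 + γ))) * ((k : ℝ) - i) / 2) :
    ∃ Lists : Fin n → Finset ℕ,
      (∀ i, ∀ j ∈ Lists i, j < m) ∧
      (∀ i, ((Lists i).card : ℝ) ≤ 2 * (1 + γ) / ε) ∧
      ((∑ i, (Lists i).card : ℝ) ≤ (1 + γ) * n) ∧
      ∀ M' : Finset (ℕ × ℕ), IsMonotoneMatching S S' M' →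
        (1 - δ) * n ≤ (M'.card : ℝ) →
        (1 - δ - ε) * n ≤
          ((Finset.univ.filter
            (fun i : Fin n => ∃ j ∈ Lists i, ((i : ℕ), j) ∈ M')).card : ℝ) := by
  classical
  subst hS hS'
  have hγ1 : 0 < 1 + γ := by linarith
  set η := ε ^ 2 / (4 * (1 + γ))
  have hη : 0 ≤ η := by positivity
  have hKε : (K : ℝ) * ε = 2 * (1 + γ) := by rw [hK]; field_simp
  have hKη : (K : ℝ) * η = ε / 2 := by rw [hK]; simp only [η]; field_simp; norm_num
  have hKpos' : (0 : ℝ) < K := by exact_mod_cast hKpos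
  obtain ⟨R, D, f, hR0, hRs, hDR, hemb, hmax⟩ :=
    exists_greedy_isLetterEmbedding S S' S'.length
  have hanti : Antitone R := antitone_nat_of_succ_le fun t => by
    rw [hRs]
    exact Finset.sdiff_subset
  have hsum : ∀ t, ∑ s ∈ Finset.range t, (D s).card + (R t).card = S'.length := by
    intro t
    induction t with
    | zero => simp [hR0]
    | succ t ih =>
      rw [Finset.sum_range_succ, hRs, ← ih, ← Finset.card_sdiff_add_card_eq_card (hDR t)]
      ring
  have hcover : ∀ t, ∀ j < S'.length, j ∉ R t → ∃ s < t, j ∈ D s := by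
    intro t j hj
    induction t with
    | zero => simp [hR0, hj]
    | succ t ih =>
      intro hjR
      by_cases hjt : j ∈ R t
      · exact ⟨t, t.lt_succ_self, by simpa [hRs, hjt] using hjR⟩
      · obtain ⟨s, hs, hjs⟩ := ih hjt
        exact ⟨s, by omega, hjs⟩
  let L : Fin S.length → Finset ℕ := fun i =>
    (Finset.range K).biUnion fun t => (D t).filter fun j => f t j = i
  have hLcard : ∀ i, (L i).card ≤ ∑ t ∈ Finset.range K, ((D t).filter fun j => f t j = i).card :=
    fun i => Finset.card_biUnion_le
  refine ⟨L, fun i j hj => ?_, fun i => ?_, ?_, fun M hM hMcard => ?_⟩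
  · obtain ⟨t, -, hjt⟩ := Finset.mem_biUnion.1 hj
    have := hanti t.zero_le (hDR t (Finset.mem_filter.1 hjt).1)
    simpa [hR0] using this
  · rw [← hK]
    have : (L i).card ≤ K := by
      refine (hLcard i).trans ((Finset.sum_le_card_nsmul _ _ 1 fun t _ => ?_).trans (by simp))
      refine Finset.card_le_one.2 fun a ha b hb => ?_
      simp only [Finset.mem_filter] at ha hb
      exact (hemb t).1.injOn ha.1 hb.1 (ha.2.trans hb.2.symm)
    exact_mod_cast this
  · refine le_trans ?_ hm
    have : ∑ i, (L i).card ≤ S'.length := by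
      refine (Finset.sum_le_sum fun i _ => hLcard i).trans ?_
      rw [Finset.sum_comm]
      refine le_trans (Finset.sum_le_sum fun t _ => ?_) ((Nat.le_add_right _ _).trans (hsum K).le)
      rw [← Finset.card_biUnion]
      · exact Finset.card_le_card (Finset.biUnion_subset.2 fun i _ => Finset.filter_subset _ _)
      · intro i _ i' _ hii'
        refine Finset.disjoint_filter.2 fun j _ h h' => hii' (Fin.ext (h.symm.trans h'))
    exact_mod_cast this
  obtain ⟨g, hg, hgM, hJ⟩ := hM.exists_isLetterEmbedding
  set J := M.image Prod.snd
  have hJlt : ∀ j ∈ J, j < S'.length := fun j hj => (hM.1 _ (hgM j hj)).2.1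
  let bad : ℕ → Finset ℕ := fun t => (J ∩ D t).filter fun j => f t j ≠ g j
  have hbad : ∀ t, ((bad t).card : ℝ) ≤ η * S.length := by
    intro t
    have hsubJ : bad t ⊆ J := (Finset.filter_subset _ _).trans Finset.inter_subset_left
    have hsubD : bad t ⊆ D t := (Finset.filter_subset _ _).trans Finset.inter_subset_right
    have h₁ := (hemb t).mono hsubD
    have h₂ := hg.mono hsubJ
    exact card_le_of_sync_of_ne hη hsync h₁.1 h₂.1 (fun j hj => (Finset.mem_filter.1 hj).2)
      (fun j hj => (h₁.2 j hj).1) (fun j hj => (h₂.2 j hj).1)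
      (fun j hj => (h₁.2 j hj).2.trans (h₂.2 j hj).2.symm)
  have hleft : ((J ∩ R K).card : ℝ) ≤ ε / 2 * S.length := by
    have : K * (J ∩ R K).card ≤ S'.length := by
      refine le_trans ?_ ((Nat.le_add_right _ _).trans (hsum K).le)
      have := Finset.card_nsmul_le_sum (Finset.range K) (fun s => (D s).card) (J ∩ R K).card
        fun t ht => hmax t _ g
          (Finset.inter_subset_right.trans (hanti (Finset.mem_range.1 ht).le))
          (hg.mono Finset.inter_subset_left)
      simpa using this
    have : (K : ℝ) * (J ∩ R K).card ≤ S'.length := by exact_mod_cast this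
    refine le_of_mul_le_mul_left ?_ hKpos'
    calc (K : ℝ) * (J ∩ R K).card ≤ (1 + γ) * S.length := this.trans hm
      _ = K * (ε / 2 * S.length) := by linear_combination (-(S.length : ℝ) / 2) * hKε
  set W := Finset.univ.filter (fun i : Fin S.length => ∃ j ∈ L i, ((i : ℕ), j) ∈ M)
  have hgood : (J.filter fun j => ∃ t < K, j ∈ D t ∧ f t j = g j).card ≤ W.card := by
    rw [← Finset.card_map Fin.valEmbedding]
    refine Finset.card_le_card_of_injOn g ?_ (hg.1.injOn.mono fun j hj => (Finset.mem_filter.1 hj).1)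
    intro j hj
    rw [Finset.mem_coe, Finset.mem_filter] at hj
    obtain ⟨hj, t, ht, hjt, hfg⟩ := hj
    refine Finset.mem_coe.2 (Finset.mem_map.2 ⟨⟨g j, (hg.2 j hj).1⟩, ?_, rfl⟩)
    refine Finset.mem_filter.2 ⟨Finset.mem_univ _, j, ?_, hgM j hj⟩
    exact Finset.mem_biUnion.2 ⟨t, Finset.mem_range.2 ht, Finset.mem_filter.2 ⟨hjt, hfg⟩⟩
  have hsplit : J ⊆ ((J.filter fun j => ∃ t < K, j ∈ D t ∧ f t j = g j) ∪ (J ∩ R K)) ∪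
      (Finset.range K).biUnion bad := by
    intro j hj
    by_cases hjR : j ∈ R K
    · simp [hj, hjR]
    obtain ⟨t, ht, hjt⟩ := hcover K j (hJlt j hj) hjR
    by_cases hfg : f t j = g j
    · exact Finset.mem_union_left _
        (Finset.mem_union_left _ (Finset.mem_filter.2 ⟨hj, t, ht, hjt, hfg⟩))
    · exact Finset.mem_union_right _ (Finset.mem_biUnion.2 ⟨t, Finset.mem_range.2 ht,
        Finset.mem_filter.2 ⟨Finset.mem_inter.2 ⟨hj, hjt⟩, hfg⟩⟩)
  have hbadsum : (((Finset.range K).biUnion bad).card : ℝ) ≤ ε / 2 * S.length := by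
    calc (((Finset.range K).biUnion bad).card : ℝ)
        ≤ ∑ t ∈ Finset.range K, ((bad t).card : ℝ) := by exact_mod_cast Finset.card_biUnion_le
      _ ≤ ∑ _t ∈ Finset.range K, η * S.length := Finset.sum_le_sum fun t _ => hbad t
      _ = ε / 2 * S.length := by
        rw [Finset.sum_const, Finset.card_range, nsmul_eq_mul, ← mul_assoc, hKη]
  have hcount : (M.card : ℝ) ≤ W.card + (J ∩ R K).card + ((Finset.range K).biUnion bad).card := by
    have h₁ := Finset.card_le_card hsplit
    have h₂ := Finset.card_union_le
      ((J.filter fun j => ∃ t < K, j ∈ D t ∧ f t j = g j) ∪ (J ∩ R K))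
      ((Finset.range K).biUnion bad)
    have h₃ := Finset.card_union_le
      (J.filter fun j => ∃ t < K, j ∈ D t ∧ f t j = g j) (J ∩ R K)
    have : M.card ≤ W.card + (J ∩ R K).card + ((Finset.range K).biUnion bad).card := by omega
    exact_mod_cast this
  linarith
end

section
/- Let Σ and Γ be finite alphabets, let C ⊆ Σ^n be an (α, l, L)-list recoverable code, and let ε, γ > 0 and 0 ≤ δ ≤ 1 − α − ε be reals such that K := 2(1+γ)/ε is an integer with K ≤ l. Let T ∈ Γ^n be an (ε²/(4(1+γ)))-synchronization string, and let C' ⊆ (Σ×Γ)^n be the indexed code C' := { ((x₁,T₁), …, (x_n,T_n)) : x ∈ C }. Then C' is list-decodable from ⌊δn⌋ deletions and ⌊γn⌋ insertions with list size L: for every word w over Σ×Γ, the number of codewords of C' from which w is obtainable by at most ⌊δn⌋ deletions followed by at most ⌊γn⌋ insertions is at most L. -/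
/-- `M` is a set of index pairs matching equal symbols of `A` and `B` without crossings. -/
def IsMatching {β : Type*} (A B : List β) (M : Finset (ℕ × ℕ)) : Prop :=
  (∀ p ∈ M, ∀ q ∈ M, p.1 < q.1 ↔ p.2 < q.2) ∧ ∀ p ∈ M, ∃ s, A[p.1]? = some s ∧ B[p.2]? = some s

/-- Disjoint adjacent factors of `A` have no common subsequence of length at least `η / 2` times
their total length. -/
def IsSynchronizing {β : Type*} (A : List β) (η : ℝ) : Prop :=
  ∀ i j k : ℕ, i < j → j < k → k ≤ A.length → ∀ v : List β,
    v.Sublist ((A.drop i).take (j - i)) → v.Sublist ((A.drop j).take (k - j)) →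
    (v.length : ℝ) < η * ((k : ℝ) - i) / 2

namespace IsMatching

variable {β : Type*} {A B : List β} {M N : Finset (ℕ × ℕ)}

theorem mono (hM : IsMatching A B M) (h : N ⊆ M) : IsMatching A B N :=
  ⟨fun p hp q hq => hM.1 p (h hp) q (h hq), fun p hp => hM.2 p (h hp)⟩

theorem eq_of_fst_eq (hM : IsMatching A B M) {p q : ℕ × ℕ} (hp : p ∈ M) (hq : q ∈ M)
    (h : p.1 = q.1) : p = q := by
  have h1 := hM.1 p hp q hq
  have h2 := hM.1 q hq p hp
  ext <;> omega

theorem swap (hM : IsMatching A B M) : IsMatching B A (M.image Prod.swap) := by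
  simp only [IsMatching, Finset.forall_mem_image, Prod.fst_swap, Prod.snd_swap]
  refine ⟨fun p hp q hq => (hM.1 p hp q hq).symm, fun p hp => ?_⟩
  obtain ⟨s, h1, h2⟩ := hM.2 p hp
  exact ⟨s, h2, h1⟩

theorem exists_sublist (hM : IsMatching A B M) :
    ∃ v : List β, v.Sublist A ∧ v.Sublist B ∧ v.length = M.card := by
  induction hc : M.card generalizing A B M with
  | zero => exact ⟨[], by simp, by simp, rfl⟩
  | succ c ih =>
    have hne : M.Nonempty := Finset.card_pos.1 (by omega)
    obtain ⟨p, hp, hmax⟩ := M.exists_max_image Prod.fst hne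
    have hlt : ∀ q ∈ M.erase p, q.1 < p.1 ∧ q.2 < p.2 := fun q hq => by
      rw [Finset.mem_erase] at hq
      have hq1 : q.1 < p.1 :=
        lt_of_le_of_ne (hmax q hq.2) fun h => hq.1 (hM.eq_of_fst_eq hq.2 hp h)
      exact ⟨hq1, (hM.1 q hq.2 p hp).1 hq1⟩
    have hM' : IsMatching (A.take p.1) (B.take p.2) (M.erase p) := by
      refine ⟨(hM.mono (M.erase_subset p)).1, fun q hq => ?_⟩
      obtain ⟨s, h1, h2⟩ := hM.2 q (Finset.mem_of_mem_erase hq)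
      refine ⟨s, ?_, ?_⟩
      · rwa [List.getElem?_take_of_lt (hlt q hq).1]
      · rwa [List.getElem?_take_of_lt (hlt q hq).2]
    obtain ⟨v, hv1, hv2, hv⟩ := ih hM' (by rw [Finset.card_erase_of_mem hp]; omega)
    obtain ⟨s, h1, h2⟩ := hM.2 p hp
    refine ⟨v ++ [s], ?_, ?_, by simp [hv]⟩
    · refine List.Sublist.trans ?_ (List.take_sublist (p.1 + 1) A)
      rw [List.take_add_one, h1]
      exact hv1.append (List.Sublist.refl _)
    · refine List.Sublist.trans ?_ (List.take_sublist (p.2 + 1) B)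
      rw [List.take_add_one, h2]
      exact hv2.append (List.Sublist.refl _)

theorem card_le_of_separated {η : ℝ} (hA : IsSynchronizing A η) (hη : 0 ≤ η)
    (hM : IsMatching A A M) {i j k : ℕ} (hik : i ≤ k) (hk : k ≤ A.length)
    (hsep : ∀ p ∈ M, i ≤ p.1 ∧ p.1 < j ∧ j ≤ p.2 ∧ p.2 < k) :
    (M.card : ℝ) ≤ η * ((k : ℝ) - i) / 2 := by
  rcases M.eq_empty_or_nonempty with rfl | ⟨p₀, hp₀⟩
  · have : (i : ℝ) ≤ k := by exact_mod_cast hik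
    have := mul_nonneg hη (sub_nonneg.2 this)
    simp; linarith
  have h₀ := hsep p₀ hp₀
  set f : ℕ × ℕ → ℕ × ℕ := fun p => (p.1 - i, p.2 - j) with hf
  have hcard : (M.image f).card = M.card := by
    refine Finset.card_image_of_injOn fun p hp q hq h => hM.eq_of_fst_eq hp hq ?_
    have := congrArg Prod.fst h
    have := hsep p hp
    have := hsep q hq
    simp only [hf] at *
    omega
  have hshift : IsMatching ((A.drop i).take (j - i)) ((A.drop j).take (k - j)) (M.image f) := by
    simp only [IsMatching, Finset.forall_mem_image, hf]
    refine ⟨fun p hp q hq => ?_, fun p hp => ?_⟩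
    · have := hsep p hp
      have := hsep q hq
      have := hM.1 p hp q hq
      omega
    · have hp' := hsep p hp
      obtain ⟨s, h1, h2⟩ := hM.2 p hp
      refine ⟨s, ?_, ?_⟩
      · rw [List.getElem?_take_of_lt (by omega), List.getElem?_drop, ← h1]
        congr 1; omega
      · rw [List.getElem?_take_of_lt (by omega), List.getElem?_drop, ← h2]
        congr 1; omega
  obtain ⟨v, hv1, hv2, hv⟩ := hshift.exists_sublist
  rw [← hcard, ← hv]
  exact (hA i j k (by omega) (by omega) hk v hv1 hv2).le

/-- A self-matching without fixed points whose pairs all have minimum at least `x` and maximum at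
least `y` has at most `η / 2 * ((|A| - x) + (|A| - y))` pairs. -/
theorem card_le_of_ne_of_le {η : ℝ} (hA : IsSynchronizing A η) (hη : 0 ≤ η)
    (hM : IsMatching A A M) (hne : ∀ p ∈ M, p.1 ≠ p.2) {x y : ℕ} (hx : x ≤ A.length)
    (hy : y ≤ A.length) (hxM : ∀ p ∈ M, x ≤ min p.1 p.2) (hyM : ∀ p ∈ M, y ≤ max p.1 p.2) :
    (M.card : ℝ) ≤ η / 2 * ((A.length - x) + (A.length - y)) := by
  induction hc : M.card using Nat.strong_induction_on generalizing M x y with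
  | _ c ih =>
  subst hc
  have hlen : ∀ p ∈ M, p.1 < A.length ∧ p.2 < A.length := fun p hp => by
    obtain ⟨s, h1, h2⟩ := hM.2 p hp
    exact ⟨(List.getElem?_eq_some_iff.1 h1).1, (List.getElem?_eq_some_iff.1 h2).1⟩
  have hx' : (x : ℝ) ≤ A.length := by exact_mod_cast hx
  have hy' : (y : ℝ) ≤ A.length := by exact_mod_cast hy
  rcases M.eq_empty_or_nonempty with rfl | hne'
  · simp only [Finset.card_empty, Nat.cast_zero]
    exact mul_nonneg (by linarith) (by linarith)
  obtain ⟨p, hp, hmin⟩ := M.exists_min_image Prod.fst hne'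
  have hpM : ∀ q ∈ M, p.1 ≤ q.1 ∧ p.2 ≤ q.2 := fun q hq =>
    ⟨hmin q hq, by have := hmin q hq; have := hM.1 q hq p hp; omega⟩
  set G := M.filter fun q => min q.1 q.2 < max p.1 p.2 with hG
  set k := G.sup fun q => max q.1 q.2 + 1 with hk
  have hpp := hne p hp
  have hpG : p ∈ G := by simp only [hG, Finset.mem_filter]; exact ⟨hp, by omega⟩
  have hGk : ∀ q ∈ G, max q.1 q.2 < k := fun q hq =>
    Finset.le_sup (f := fun q : ℕ × ℕ => max q.1 q.2 + 1) hq
  have hpk := hGk p hpG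
  have hkA : k ≤ A.length := Finset.sup_le fun q hq => by
    have := hlen q (Finset.mem_filter.1 hq).1
    omega
  have hGM : G ⊆ M := Finset.filter_subset _ _
  have hGcard : (G.card : ℝ) ≤ η * ((k : ℝ) - (min p.1 p.2 : ℕ)) / 2 := by
    rcases Nat.lt_or_gt_of_ne hpp with h | h
    · refine (hM.mono hGM).card_le_of_separated hA hη (j := p.2) (by omega) hkA fun q hq => ?_
      have := hpM q (hGM hq)
      have := hGk q hq
      have := (Finset.mem_filter.1 hq).2
      omega
    · rw [← Finset.card_image_of_injective G Prod.swap_injective]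
      refine (hM.mono hGM).swap.card_le_of_separated hA hη (j := p.1) (by omega) hkA ?_
      simp only [Finset.forall_mem_image, Prod.fst_swap, Prod.snd_swap]
      intro q hq
      have := hpM q (hGM hq)
      have := hGk q hq
      have := (Finset.mem_filter.1 hq).2
      omega
  have hsplit : G.card + (M \ G).card = M.card := by
    rw [add_comm]; exact Finset.card_sdiff_add_card_eq_card hGM
  have hGpos : 0 < G.card := Finset.card_pos.2 ⟨p, hpG⟩
  have hrest_lo : ∀ q ∈ M \ G, max p.1 p.2 ≤ min q.1 q.2 := fun q hq => by
    simp only [hG, Finset.mem_sdiff, Finset.mem_filter, not_and, not_lt] at hq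
    exact hq.2 hq.1
  have hrest := ih (M \ G).card (by omega) (hM.mono Finset.sdiff_subset)
    (fun q hq => hne q (Finset.mem_sdiff.1 hq).1) (x := max p.1 p.2) (y := k)
    (by omega) hkA hrest_lo
    (fun q hq => Finset.sup_le fun g hg => by
      have hq' := hrest_lo q hq
      have hg' := (Finset.mem_filter.1 hg).2
      have := hM.1 g (hGM hg) q (Finset.mem_sdiff.1 hq).1
      have := hM.1 q (Finset.mem_sdiff.1 hq).1 g (hGM hg)
      omega) rfl
  have hsplit' : (G.card : ℝ) + (M \ G).card = M.card := by exact_mod_cast hsplit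
  have hxp : (x : ℝ) ≤ (min p.1 p.2 : ℕ) := by exact_mod_cast hxM p hp
  have hyp : (y : ℝ) ≤ (max p.1 p.2 : ℕ) := by exact_mod_cast hyM p hp
  nlinarith [mul_nonneg hη (sub_nonneg.2 hxp), mul_nonneg hη (sub_nonneg.2 hyp)]

theorem card_le_of_ne {η : ℝ} (hA : IsSynchronizing A η) (hη : 0 ≤ η)
    (hM : IsMatching A A M) (hne : ∀ p ∈ M, p.1 ≠ p.2) : (M.card : ℝ) ≤ η * A.length := by
  have := hM.card_le_of_ne_of_le hA hη hne (Nat.zero_le _) (Nat.zero_le _)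
    (fun _ _ => Nat.zero_le _) (fun _ _ => Nat.zero_le _)
  push_cast at this
  linarith

/-- Two matchings into the same string disagree on few positions if the source is
synchronizing. -/
theorem card_disagree_le {η : ℝ} (hA : IsSynchronizing A η) (hη : 0 ≤ η)
    (hN : IsMatching A B N) (hM : IsMatching A B M) :
    ((N.filter fun p => ∃ q ∈ M, q.2 = p.2 ∧ q.1 ≠ p.1).card : ℝ) ≤ η * A.length := by
  set F := (N ×ˢ M).filter fun z => z.2.2 = z.1.2 ∧ z.2.1 ≠ z.1.1 with hF
  have hmem : ∀ z ∈ F, z.1 ∈ N ∧ z.2 ∈ M ∧ z.2.2 = z.1.2 ∧ z.2.1 ≠ z.1.1 := fun z hz => by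
    simpa [hF, and_assoc] using hz
  have h1 : (N.filter fun p => ∃ q ∈ M, q.2 = p.2 ∧ q.1 ≠ p.1) ⊆ F.image Prod.fst := by
    intro p hp
    obtain ⟨hpN, q, hq, h⟩ := Finset.mem_filter.1 hp
    exact Finset.mem_image.2 ⟨(p, q), by simp [hF, hpN, hq, h], rfl⟩
  have h2 : (F.image fun z => (z.1.1, z.2.1)).card = F.card := by
    refine Finset.card_image_of_injOn fun z hz y hy h => ?_
    obtain ⟨hz1, hz2, -⟩ := hmem z hz
    obtain ⟨hy1, hy2, -⟩ := hmem y hy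
    rw [Prod.mk.injEq] at h
    exact Prod.ext (hN.eq_of_fst_eq hz1 hy1 h.1) (hM.eq_of_fst_eq hz2 hy2 h.2)
  have h3 : IsMatching A A (F.image fun z => (z.1.1, z.2.1)) := by
    simp only [IsMatching, Finset.forall_mem_image]
    refine ⟨fun z hz y hy => ?_, fun z hz => ?_⟩
    · obtain ⟨hz1, hz2, hz3, -⟩ := hmem z hz
      obtain ⟨hy1, hy2, hy3, -⟩ := hmem y hy
      rw [hN.1 _ hz1 _ hy1, hM.1 _ hz2 _ hy2, hz3, hy3]
    · obtain ⟨hz1, hz2, hz3, -⟩ := hmem z hz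
      obtain ⟨s, hs1, hs2⟩ := hN.2 _ hz1
      obtain ⟨t, ht1, ht2⟩ := hM.2 _ hz2
      rw [hz3, hs2, Option.some.injEq] at ht2
      exact ⟨s, hs1, ht2 ▸ ht1⟩
  have h4 := h3.card_le_of_ne hA hη (by
    simp only [Finset.forall_mem_image]
    exact fun z hz => (hmem z hz).2.2.2.symm)
  have h5 := (Finset.card_le_card h1).trans Finset.card_image_le
  rw [h2] at h4
  exact le_trans (by exact_mod_cast h5) h4

theorem card_le_length (hM : IsMatching A B M) : M.card ≤ A.length := by
  obtain ⟨v, hv, -, h⟩ := hM.exists_sublist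
  exact h ▸ hv.length_le

theorem snd_injOn (hM : IsMatching A B M) : Set.InjOn Prod.snd (M : Set (ℕ × ℕ)) := by
  intro p hp q hq h
  refine hM.eq_of_fst_eq hp hq ?_
  have h1 := hM.1 p hp q hq
  have h2 := hM.1 q hq p hp
  omega

end IsMatching

/-- Greedily choosing `K` successive maximum matchings, each on the indices of `B` not used so far,
leaves only small matchings on the remaining indices. -/
theorem exists_greedy_matchings {β : Type*} (A B : List β) (K : ℕ) (R : Finset ℕ) :
    ∃ Ms : Finset (Finset (ℕ × ℕ)), Ms.card ≤ K ∧ (∀ M ∈ Ms, IsMatching A B M) ∧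
      ∀ N, IsMatching A B N → (∀ p ∈ N, p.2 ∈ R ∧ ∀ M ∈ Ms, ∀ q ∈ M, q.2 ≠ p.2) →
        K * N.card ≤ R.card := by
  classical
  induction K generalizing R with
  | zero => exact ⟨∅, by simp⟩
  | succ K ih =>
    obtain ⟨M, ⟨hM, hMR⟩, hmax⟩ : ∃ M, (IsMatching A B M ∧ ∀ p ∈ M, p.2 ∈ R) ∧
        ∀ N, (IsMatching A B N ∧ ∀ p ∈ N, p.2 ∈ R) → N.card ≤ M.card := by
      let P : ℕ → Prop := fun c => ∃ M, (IsMatching A B M ∧ ∀ p ∈ M, p.2 ∈ R) ∧ M.card = c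
      have h0 : P 0 := ⟨∅, ⟨⟨by simp, by simp⟩, by simp⟩, rfl⟩
      obtain ⟨M, hM, hc⟩ := Nat.findGreatest_spec (Nat.zero_le A.length) h0
      exact ⟨M, hM, fun N hN => hc ▸ Nat.le_findGreatest hN.1.card_le_length ⟨N, hN, rfl⟩⟩
    obtain ⟨Ms, hcard, hMs, hres⟩ := ih (R \ M.image Prod.snd)
    refine ⟨insert M Ms, (Finset.card_insert_le _ _).trans (by omega), ?_, fun N hN hNR => ?_⟩
    · simpa [hM] using hMs
    have h1 := hres N hN fun p hp => by
      obtain ⟨hpR, hp'⟩ := hNR p hp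
      refine ⟨Finset.mem_sdiff.2 ⟨hpR, fun h => ?_⟩, fun M' hM' =>
        hp' M' (Finset.mem_insert_of_mem hM')⟩
      obtain ⟨q, hq, hqp⟩ := Finset.mem_image.1 h
      exact hp' M (Finset.mem_insert_self _ _) q hq hqp
    have h2 := hmax N ⟨hN, fun p hp => (hNR p hp).1⟩
    have h3 : (R \ M.image Prod.snd).card + M.card = R.card := by
      rw [← Finset.card_image_of_injOn hM.snd_injOn]
      exact Finset.card_sdiff_add_card_eq_card (Finset.image_subset_iff.2 hMR)
    rw [add_one_mul]
    omega

theorem exists_isMatching_of_sublist {β : Type*} {A B v : List β} (hA : v.Sublist A)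
    (hB : v.Sublist B) : ∃ N, IsMatching A B N ∧ N.card = v.length := by
  obtain ⟨f, hf⟩ := List.sublist_iff_exists_orderEmbedding_getElem?_eq.1 hA
  obtain ⟨g, hg⟩ := List.sublist_iff_exists_orderEmbedding_getElem?_eq.1 hB
  refine ⟨(Finset.range v.length).image fun i => (f i, g i), ?_, ?_⟩
  · simp only [IsMatching, Finset.forall_mem_image, Finset.mem_range]
    refine ⟨fun i _ j _ => by simp, fun i hi => ⟨v[i], ?_, ?_⟩⟩
    · rw [← hf, List.getElem?_eq_getElem hi]
    · rw [← hg, List.getElem?_eq_getElem hi]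
  · rw [Finset.card_image_of_injective, Finset.card_range]
    exact fun i j h => f.injective (congrArg Prod.fst h)

theorem IsMatching.map {β β' : Type*} {A B : List β} {M : Finset (ℕ × ℕ)}
    (hM : IsMatching A B M) (f : β → β') : IsMatching (A.map f) (B.map f) M := by
  refine ⟨hM.1, fun p hp => ?_⟩
  obtain ⟨s, h1, h2⟩ := hM.2 p hp
  exact ⟨f s, by simp [h1], by simp [h2]⟩

/-- Of a matching `N`, all but few pairs occur in some member of `Ms`, if matchings avoiding the
members of `Ms` are small and the source is synchronizing. -/
theorem IsMatching.card_le_add_of_greedy {β : Type*} {A B : List β} {η : ℝ}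
    (hA : IsSynchronizing A η) (hη : 0 ≤ η) {N : Finset (ℕ × ℕ)} (hN : IsMatching A B N)
    {Ms : Finset (Finset (ℕ × ℕ))} (hMs : ∀ M ∈ Ms, IsMatching A B M) {K : ℕ}
    (hK : Ms.card ≤ K)
    (hgreedy : ∀ N, IsMatching A B N →
      (∀ p ∈ N, p.2 ∈ Finset.range B.length ∧ ∀ M ∈ Ms, ∀ q ∈ M, q.2 ≠ p.2) →
        K * N.card ≤ (Finset.range B.length).card) :
    ∃ b : ℕ, K * b ≤ B.length ∧
      (N.card : ℝ) ≤ (N.filter fun p => ∃ M ∈ Ms, p ∈ M).card + b + K * (η * A.length) := by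
  set N₀ := N.filter fun p => ∀ M ∈ Ms, ∀ q ∈ M, q.2 ≠ p.2 with hN₀
  set D := fun M : Finset (ℕ × ℕ) => N.filter fun p => ∃ q ∈ M, q.2 = p.2 ∧ q.1 ≠ p.1 with hD
  refine ⟨N₀.card, ?_, ?_⟩
  · have := hgreedy N₀ (hN.mono (Finset.filter_subset _ _)) fun p hp => by
      obtain ⟨hp1, hp2⟩ := Finset.mem_filter.1 hp
      obtain ⟨s, -, h⟩ := hN.2 p hp1
      exact ⟨Finset.mem_range.2 (List.getElem?_eq_some_iff.1 h).1, hp2⟩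
    rwa [Finset.card_range] at this
  have hcover : N ⊆ ((N.filter fun p => ∃ M ∈ Ms, p ∈ M) ∪ N₀) ∪ Ms.biUnion D := by
    intro p hp
    by_cases h0 : p ∈ N₀
    · simp [h0]
    simp only [hN₀, Finset.mem_filter, not_and, not_forall, not_not] at h0
    obtain ⟨M, hM, q, hq, hqp⟩ := h0 hp
    by_cases h1 : q.1 = p.1
    · have : q = p := Prod.ext h1 hqp
      simp only [Finset.mem_union, Finset.mem_filter]
      exact Or.inl (Or.inl ⟨hp, M, hM, this ▸ hq⟩)
    · refine Finset.mem_union_right _ (Finset.mem_biUnion.2 ⟨M, hM, ?_⟩)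
      exact Finset.mem_filter.2 ⟨hp, q, hq, hqp, h1⟩
  have h1 := (Finset.card_le_card hcover).trans ((Finset.card_union_le _ _).trans
    (Nat.add_le_add (Finset.card_union_le _ _) Finset.card_biUnion_le))
  have h1' : (N.card : ℝ) ≤ (N.filter fun p => ∃ M ∈ Ms, p ∈ M).card + N₀.card
      + ∑ M ∈ Ms, ((D M).card : ℝ) := by exact_mod_cast h1
  have h2 : ∑ M ∈ Ms, ((D M).card : ℝ) ≤ Ms.card • (η * A.length) :=
    Finset.sum_le_card_nsmul _ _ _ fun M hM => hN.card_disagree_le hA hη (hMs M hM)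
  have h3 : (Ms.card : ℝ) * (η * A.length) ≤ K * (η * A.length) :=
    mul_le_mul_of_nonneg_right (by exact_mod_cast hK) (by positivity)
  rw [nsmul_eq_mul] at h2
  linarith

/-- The symbols of `w` assigned to position `i` by some matching in `Ms`. -/
def candidates {Sig Γ : Type*} [DecidableEq Sig] (w : List (Sig × Γ))
    (Ms : Finset (Finset (ℕ × ℕ))) (i : ℕ) : Finset Sig :=
  Ms.biUnion fun M => (M.filter fun p => p.1 = i).biUnion fun p =>
    (w[p.2]?.map Prod.fst).toFinset

theorem card_candidates_le {Sig Γ : Type*} [DecidableEq Sig] (w : List (Sig × Γ)) {A B : List Γ}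
    {Ms : Finset (Finset (ℕ × ℕ))} (hMs : ∀ M ∈ Ms, IsMatching A B M) (i : ℕ) :
    (candidates w Ms i).card ≤ Ms.card := by
  refine (Finset.card_biUnion_le_card_mul _ _ 1 fun M hM => ?_).trans_eq (mul_one _)
  refine (Finset.card_biUnion_le_card_mul _ _ 1 fun p _ => ?_).trans ?_
  · cases w[p.2]? <;> simp
  · rw [mul_one, Finset.card_le_one]
    intro p hp q hq
    simp only [Finset.mem_filter] at hp hq
    exact (hMs M hM).eq_of_fst_eq hp.1 hq.1 (hp.2.trans hq.2.symm)

theorem card_filter_le_card_mem_candidates {Sig Γ : Type*} [DecidableEq Sig] {n : ℕ}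
    (x : Fin n → Sig) (T : Fin n → Γ) (w : List (Sig × Γ)) (Ms : Finset (Finset (ℕ × ℕ)))
    {N : Finset (ℕ × ℕ)} (hN : IsMatching (List.ofFn fun i => (x i, T i)) w N) :
    (N.filter fun p => ∃ M ∈ Ms, p ∈ M).card ≤
      (Finset.univ.filter fun i : Fin n => x i ∈ candidates w Ms i).card := by
  set G := N.filter fun p => ∃ M ∈ Ms, p ∈ M with hG
  have h1 : (G.image Prod.fst).card = G.card :=
    Finset.card_image_of_injOn fun p hp q hq h =>
      hN.eq_of_fst_eq (Finset.mem_filter.1 hp).1 (Finset.mem_filter.1 hq).1 h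
  rw [← h1, ← Finset.card_image_of_injective _ (Fin.val_injective (n := n))]
  refine Finset.card_le_card (Finset.image_subset_iff.2 fun p hp => ?_)
  obtain ⟨hpN, M, hM, hpM⟩ := Finset.mem_filter.1 hp
  obtain ⟨s, hs1, hs2⟩ := hN.2 p hpN
  obtain ⟨hlt, hs⟩ := List.getElem?_eq_some_iff.1 hs1
  rw [List.length_ofFn] at hlt
  rw [List.getElem_ofFn] at hs
  refine Finset.mem_image.2 ⟨⟨p.1, hlt⟩, Finset.mem_filter.2 ⟨Finset.mem_univ _, ?_⟩, rfl⟩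
  simp only [candidates, Finset.mem_biUnion]
  exact ⟨M, hM, p, Finset.mem_filter.2 ⟨hpM, rfl⟩, by simp [hs2, ← hs]⟩


/-- `C ⊆ Σ^n` is `(α, l, L)`-list recoverable: for every collection of candidate sets
`S₁, …, S_n ⊆ Σ` of size at most `l`, at most `L` codewords agree with the lists in at
least `αn` positions. -/
def ListRecoverable {Sig : Type*} [DecidableEq Sig] {n : ℕ} (C : Finset (Fin n → Sig))
    (α : ℝ) (l L : ℕ) : Prop :=
  ∀ Sets : Fin n → Finset Sig, (∀ i, (Sets i).card ≤ l) →
    (C.filter (fun x =>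
      (α * n) ≤ ((Finset.univ.filter (fun i : Fin n => x i ∈ Sets i)).card : ℝ))).card ≤ L

open Classical in
/-- Theorem 8 of the paper. Indexing an `(α, l, L)`-list recoverable code `C ⊆ Σ^n`
with an `(ε²/(4(1+γ)))`-synchronization string `T ∈ Γ^n` (where `K := 2(1+γ)/ε` is an
integer with `K ≤ l` and `0 ≤ δ ≤ 1−α−ε`) yields a code `C' ⊆ (Σ×Γ)^n` that is
list-decodable from `⌊δn⌋` deletions and `⌊γn⌋` insertions with list size `L`. -/
theorem stmt_14 {Sig Γ : Type*} [DecidableEq Sig] [DecidableEq Γ]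
    (n : ℕ) (α ε γ δ : ℝ) (l L : ℕ) (hε : 0 < ε) (hγ : 0 < γ)
    (hδ0 : 0 ≤ δ) (hδ : δ ≤ 1 - α - ε)
    (K : ℕ) (hK : (K : ℝ) = 2 * (1 + γ) / ε) (hKl : K ≤ l)
    (C : Finset (Fin n → Sig)) (hC : ListRecoverable C α l L)
    (T : Fin n → Γ)
    (hsync : ∀ i j k : ℕ, i < j → j < k → k ≤ n → ∀ v : List Γ,
      v.Sublist (((List.ofFn T).drop i).take (j - i)) →
      v.Sublist (((List.ofFn T).drop j).take (k - j)) →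
      (v.length : ℝ) < (ε ^ 2 / (4 * (1 + γ))) * ((k : ℝ) - i) / 2) :
    ∀ w : List (Sig × Γ),
      ((C.image (fun x => List.ofFn (fun i => (x i, T i)))).filter
        (fun c => Obtainable ⌊δ * n⌋₊ ⌊γ * n⌋₊ c w)).card ≤ L := by
  intro w
  set η := ε ^ 2 / (4 * (1 + γ)) with hηdef
  have hη : 0 ≤ η := by positivity
  have hT : IsSynchronizing (List.ofFn T) η := fun i j k hij hjk hk =>
    hsync i j k hij hjk (by simpa using hk)
  obtain ⟨Ms, hcard, hMs, hgreedy⟩ := exists_greedy_matchings (List.ofFn T) (w.map Prod.snd) K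
    (Finset.range (w.map Prod.snd).length)
  refine le_trans ?_ (hC (fun i => candidates w Ms i) fun i =>
    (card_candidates_le w hMs i).trans (hcard.trans hKl))
  rw [Finset.filter_image]
  refine Finset.card_image_le.trans (Finset.card_le_card fun x hx => ?_)
  obtain ⟨hxC, v, hvx, hvw, hdel, hins⟩ := Finset.mem_filter.1 hx
  refine Finset.mem_filter.2 ⟨hxC, ?_⟩
  obtain ⟨N, hN, hNcard⟩ := exists_isMatching_of_sublist hvx hvw
  have hvn : v.length ≤ n := by simpa using hvx.length_le
  have hN' : IsMatching (List.ofFn T) (w.map Prod.snd) N := by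
    have := hN.map Prod.snd
    rwa [List.map_ofFn] at this
  obtain ⟨b, hb, hNb⟩ := hN'.card_le_add_of_greedy hT hη hMs hcard hgreedy
  have hgood := card_filter_le_card_mem_candidates x T w Ms hN
  rw [List.length_ofFn] at hdel hNb
  rw [List.length_map] at hb
  have hdel' : (n : ℝ) ≤ v.length + δ * n := by
    have h1 : (n : ℝ) ≤ v.length + ⌊δ * n⌋₊ := by exact_mod_cast hdel
    linarith [Nat.floor_le (mul_nonneg hδ0 (Nat.cast_nonneg (α := ℝ) n))]
  have hins' : (w.length : ℝ) ≤ (1 + γ) * n := by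
    have h1 : (w.length : ℝ) ≤ n + ⌊γ * n⌋₊ := by
      exact_mod_cast hins.trans (Nat.add_le_add_right hvn _)
    linarith [Nat.floor_le (mul_nonneg hγ.le (Nat.cast_nonneg (α := ℝ) n))]
  have hb' : (b : ℝ) ≤ ε / 2 * n := by
    have h1 : (K : ℝ) * b ≤ (1 + γ) * n := le_trans (by exact_mod_cast hb) hins'
    have h2 : (1 + γ) * n = K * (ε / 2 * n) := by rw [hK]; field_simp
    have hKpos : (0 : ℝ) < K := by rw [hK]; positivity
    exact le_of_mul_le_mul_left (h2 ▸ h1) hKpos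
  have hKη : (K : ℝ) * (η * n) = ε / 2 * n := by
    rw [hK, hηdef]; field_simp; ring
  have hgood' : ((N.filter fun p => ∃ M ∈ Ms, p ∈ M).card : ℝ) ≤
      (Finset.univ.filter fun i : Fin n => x i ∈ candidates w Ms i).card := by
    exact_mod_cast hgood
  rw [hNcard] at hNb
  have hαn := mul_le_mul_of_nonneg_right hδ (Nat.cast_nonneg (α := ℝ) n)
  refine le_trans ?_ hgood'
  linarith
end

section
/- For every pair of reals 0 < δ, ε < 1 and every real γ > 0, there exists an integer q ≥ 2 such that for every N there exist n ≥ N and a code C ⊆ (Fin q)^n with |C| ≥ q^{(1−δ−ε)n} that is list-decodable from ⌊δn⌋ deletions and ⌊γn⌋ insertions with list size at most n: for every word w over Fin q, the number of codewords x ∈ C from which w is obtainable by at most ⌊δn⌋ deletions followed by at most ⌊γn⌋ insertions is at most n. -/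
/-- The union bound for random subsets: if the expected number of `k`-subsets of a uniformly
random `M`-subset of `A` that lie in one of the sets `S i` is less than one, some `M`-subset of `A`
meets every `S i` in fewer than `k` points. -/
theorem exists_subset_card_inter_lt {α ι : Type*} [DecidableEq α]
    (A : Finset α) (W : Finset ι) (S : ι → Finset α) (B M k : ℕ)
    (hS : ∀ i ∈ W, (S i).card ≤ B) (hM : M ≤ A.card)
    (h : W.card * (B.choose k * M.choose k) < A.card.choose k) :
    ∃ C ⊆ A, C.card = M ∧ ∀ i ∈ W, (C ∩ S i).card < k := by
  by_contra! hcon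
  have hW : ∃ C ⊆ A, C.card = M := Finset.exists_subset_card_eq hM
  have hkM : k ≤ M := by
    obtain ⟨C, hCA, hC⟩ := hW
    obtain ⟨i, -, hi⟩ := hcon C hCA hC
    exact hi.trans ((Finset.card_le_card Finset.inter_subset_left).trans hC.le)
  have hcover : Finset.powersetCard M A ⊆ W.biUnion fun i =>
      (Finset.powersetCard k (A ∩ S i)).biUnion fun T =>
        (Finset.powersetCard (M - k) (A \ T)).image fun U => T ∪ U := by
    intro C hC
    rw [Finset.mem_powersetCard] at hC
    obtain ⟨i, hi, hik⟩ := hcon C hC.1 hC.2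
    obtain ⟨T, hT, hTk⟩ := Finset.exists_subset_card_eq hik
    have hTC : T ⊆ C := hT.trans Finset.inter_subset_left
    simp only [Finset.mem_biUnion, Finset.mem_image, Finset.mem_powersetCard]
    refine ⟨i, hi, T, ⟨hT.trans (Finset.inter_subset_inter_right hC.1), hTk⟩, C \ T,
      ⟨Finset.sdiff_subset_sdiff hC.1 le_rfl, ?_⟩, Finset.union_sdiff_of_subset hTC⟩
    rw [Finset.card_sdiff_of_subset hTC, hC.2, hTk]
  have hcard := Finset.card_le_card hcover
  rw [Finset.card_powersetCard] at hcard
  set D := (A.card - k).choose (M - k) with hD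
  have hbound : A.card.choose M ≤ W.card * (B.choose k * D) := by
    refine hcard.trans (Finset.card_biUnion_le_card_mul _ _ _ fun i hi => ?_)
    refine (Finset.card_biUnion_le_card_mul _ _ D fun T hT => ?_).trans ?_
    · rw [Finset.mem_powersetCard] at hT
      refine Finset.card_image_le.trans (le_of_eq ?_)
      rw [Finset.card_powersetCard,
        Finset.card_sdiff_of_subset (hT.1.trans Finset.inter_subset_left), hT.2]
    · rw [Finset.card_powersetCard]
      gcongr
      exact (Finset.card_le_card Finset.inter_subset_right).trans (hS i hi)
  have hDpos : 0 < D := Nat.choose_pos (Nat.sub_le_sub_right hM k)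
  have hmul : A.card.choose M * M.choose k = A.card.choose k * D := Nat.choose_mul hkM
  have : A.card.choose k * D ≤ W.card * (B.choose k * M.choose k) * D := by
    rw [← hmul]
    calc _ ≤ W.card * (B.choose k * D) * M.choose k := by gcongr
      _ = _ := by ring
  exact absurd (le_of_mul_le_mul_right this hDpos) h.not_ge

/-- The words of length `n` containing `v` as a subsequence number at most
`2 ^ n * q ^ (n - |v|)`. -/
theorem exists_finset_superlists {α : Type*} [Fintype α] (n : ℕ) (v : List α) :
    ∃ F : Finset (List α), F.card ≤ 2 ^ n * Fintype.card α ^ (n - v.length) ∧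
      ∀ x : List α, x.length = n → v.Sublist x → x ∈ F := by
  classical
  induction n generalizing v with
  | zero => exact ⟨{[]}, by simp, by simp⟩
  | succ n ih =>
    rcases lt_or_ge n v.length with hv | hv
    · refine ⟨{v}, ?_, fun x hx hvx => ?_⟩
      · rw [Nat.sub_eq_zero_of_le hv]
        simpa using Nat.one_le_two_pow
      · rw [Finset.mem_singleton]
        exact (hvx.eq_of_length_le (by omega)).symm
    · obtain ⟨F, hF, hFm⟩ := ih v
      obtain ⟨G, hG, hGm⟩ := ih v.tail
      have hcons : ((Finset.univ ×ˢ F).image fun p : α × List α => p.1 :: p.2).card ≤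
          2 ^ n * Fintype.card α ^ (n + 1 - v.length) := by
        refine Finset.card_image_le.trans ?_
        rw [Finset.card_product, Finset.card_univ, Nat.succ_sub hv, pow_succ]
        calc _ ≤ Fintype.card α * (2 ^ n * Fintype.card α ^ (n - v.length)) := by gcongr
          _ = _ := by ring
      cases v with
      | nil =>
        refine ⟨_, hcons.trans ?_, fun x hx _ => ?_⟩
        · gcongr <;> omega
        · obtain ⟨a, y, rfl⟩ := List.exists_cons_of_length_eq_add_one hx
          exact Finset.mem_image.2 ⟨(a, y), by simpa using hFm y (by simpa using hx) (by simp), rfl⟩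
      | cons b v =>
        refine ⟨((Finset.univ ×ˢ F).image fun p : α × List α => p.1 :: p.2) ∪
          G.image (List.cons b), ?_, fun x hx hvx => ?_⟩
        · refine (Finset.card_union_le _ _).trans ?_
          have h2 : (G.image (List.cons b)).card ≤
              2 ^ n * Fintype.card α ^ (n + 1 - (b :: v).length) := by
            refine Finset.card_image_le.trans (hG.trans (le_of_eq ?_))
            simp
          rw [pow_succ]
          linarith
        · obtain ⟨a, y, rfl⟩ := List.exists_cons_of_length_eq_add_one hx
          have hy : y.length = n := by simpa using hx
          rw [Finset.mem_union]
          cases hvx with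
          | cons _ h =>
            exact .inl (Finset.mem_image.2 ⟨(a, y), by simpa using hFm y hy h, rfl⟩)
          | cons_cons _ h =>
            exact .inr (Finset.mem_image_of_mem _ (hGm y hy h))

/-- The words of length `n` from which `w` is obtainable by `t` deletions and any number of
insertions number at most `2 ^ |w| * (2 ^ n * q ^ t)`. -/
theorem exists_finset_obtainable {α : Type*} [Fintype α] {n t : ℕ} (s : ℕ) (ht : t ≤ n)
    (w : List α) :
    ∃ F : Finset (List α), F.card ≤ 2 ^ w.length * (2 ^ n * Fintype.card α ^ t) ∧
      ∀ x : List α, x.length = n → Obtainable t s x w → x ∈ F := by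
  classical
  choose G hG hGm using fun v : List α => exists_finset_superlists n v
  refine ⟨(w.sublists.toFinset.filter fun v => v.length = n - t).biUnion G, ?_, ?_⟩
  · refine (Finset.card_biUnion_le_card_mul _ _ (2 ^ n * Fintype.card α ^ t) ?_).trans ?_
    · intro v hv
      have h := hG v
      rwa [(Finset.mem_filter.1 hv).2, Nat.sub_sub_self ht] at h
    · gcongr
      refine (Finset.card_filter_le _ _).trans ((List.toFinset_card_le _).trans ?_)
      rw [List.length_sublists]
  · rintro x hx ⟨v, hvx, hvw, hxv, -⟩
    have htake := List.take_sublist (n - t) v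
    refine Finset.mem_biUnion.2 ⟨v.take (n - t), ?_, hGm _ x hx (htake.trans hvx)⟩
    simp only [Finset.mem_filter, List.mem_toFinset, List.mem_sublists, List.length_take]
    exact ⟨htake.trans hvw, by omega⟩

/-- The words of length at most `m` number at most `(q + 1) ^ m`. -/
theorem exists_finset_length_le {α : Type*} [Fintype α] (m : ℕ) :
    ∃ F : Finset (List α), F.card ≤ (Fintype.card α + 1) ^ m ∧
      ∀ w : List α, w.length ≤ m ↔ w ∈ F := by
  classical
  induction m with
  | zero => exact ⟨{[]}, by simp, by simp⟩
  | succ m ih =>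
    obtain ⟨F, hF, hFm⟩ := ih
    refine ⟨insert [] ((Finset.univ ×ˢ F).image fun p : α × List α => p.1 :: p.2), ?_, ?_⟩
    · refine (Finset.card_insert_le _ _).trans ?_
      have h1 := Finset.card_image_le (s := Finset.univ ×ˢ F)
        (f := fun p : α × List α => p.1 :: p.2)
      rw [Finset.card_product, Finset.card_univ] at h1
      have h2 : Fintype.card α * F.card ≤ Fintype.card α * (Fintype.card α + 1) ^ m := by gcongr
      have h3 : 1 ≤ (Fintype.card α + 1) ^ m := Nat.one_le_pow _ _ (by omega)
      rw [pow_succ]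
      linarith
    · intro w
      cases w with
      | nil => simp
      | cons a w => simp [← hFm]

open Classical in
/-- A random code of size `M` in `α ^ n` is list-decodable with list size `n`, provided the
union bound over the received words leaves room. -/
theorem exists_listDecodable_code {α : Type*} [Fintype α] {n t s M : ℕ} (ht : t ≤ n)
    (hM : M ≤ Fintype.card α ^ n) (hn : 2 * n ≤ Fintype.card α ^ n)
    (h : (Fintype.card α + 1) ^ (n + s) *
      (2 * (2 ^ (n + s) * (2 ^ n * Fintype.card α ^ t)) * M) ^ (n + 1) <
        (Fintype.card α ^ n) ^ (n + 1)) :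
    ∃ C : Finset (List α), (∀ x ∈ C, x.length = n) ∧ C.card = M ∧
      ∀ w : List α, (C.filter fun x => Obtainable t s x w).card ≤ n := by
  obtain ⟨W, hW, hWm⟩ := exists_finset_length_le (α := α) (n + s)
  choose S hS hSm using fun w : List α => exists_finset_obtainable s ht w
  set A : Finset (List α) :=
    (Finset.univ : Finset (Fin n → α)).map ⟨List.ofFn, List.ofFn_injective⟩ with hA
  have hAcard : A.card = Fintype.card α ^ n := by simp [hA]
  have hAlen : ∀ x ∈ A, x.length = n := by
    intro x hx
    obtain ⟨f, -, rfl⟩ := Finset.mem_map.1 hx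
    simp
  set B := 2 ^ (n + s) * (2 ^ n * Fintype.card α ^ t) with hB
  have hchoose : W.card * (B.choose (n + 1) * M.choose (n + 1)) < A.card.choose (n + 1) := by
    have hA1 : A.card ≤ 2 * (A.card + 1 - (n + 1)) := by omega
    have hA2 : (A.card + 1 - (n + 1)) ^ (n + 1) ≤ (n + 1).factorial * A.card.choose (n + 1) := by
      rw [← Nat.descFactorial_eq_factorial_mul_choose]
      exact Nat.pow_sub_le_descFactorial _ _
    have hB1 : (n + 1).factorial * B.choose (n + 1) ≤ B ^ (n + 1) := by
      rw [← Nat.descFactorial_eq_factorial_mul_choose]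
      exact Nat.descFactorial_le_pow _ _
    have hM1 : M.choose (n + 1) ≤ M ^ (n + 1) := Nat.choose_le_pow _ _
    refine lt_of_mul_lt_mul_left (a := 2 ^ (n + 1) * (n + 1).factorial) ?_ (Nat.zero_le _)
    calc 2 ^ (n + 1) * (n + 1).factorial * (W.card * (B.choose (n + 1) * M.choose (n + 1)))
        = W.card * (2 ^ (n + 1) * ((n + 1).factorial * B.choose (n + 1)) * M.choose (n + 1)) := by
          ring
      _ ≤ (Fintype.card α + 1) ^ (n + s) * (2 ^ (n + 1) * B ^ (n + 1) * M ^ (n + 1)) := by gcongr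
      _ = (Fintype.card α + 1) ^ (n + s) * (2 * B * M) ^ (n + 1) := by
        rw [mul_pow (2 * B), mul_pow 2 B]
      _ < (Fintype.card α ^ n) ^ (n + 1) := h
      _ = A.card ^ (n + 1) := by rw [hAcard]
      _ ≤ (2 * (A.card + 1 - (n + 1))) ^ (n + 1) := by gcongr
      _ = 2 ^ (n + 1) * (A.card + 1 - (n + 1)) ^ (n + 1) := by rw [mul_pow]
      _ ≤ 2 ^ (n + 1) * ((n + 1).factorial * A.card.choose (n + 1)) := by gcongr
      _ = _ := by ring
  obtain ⟨C, hCA, hCM, hC⟩ := exists_subset_card_inter_lt A W S B M (n + 1)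
    (fun w hw => (hS w).trans (by
      have := (hWm w).2 hw
      rw [hB]
      gcongr
      norm_num)) (hAcard ▸ hM) hchoose
  refine ⟨C, fun x hx => hAlen x (hCA hx), hCM, fun w => ?_⟩
  by_cases hw : w.length ≤ n + s
  · refine (Finset.card_le_card ?_).trans (Nat.lt_succ_iff.1 (hC w ((hWm w).1 hw)))
    intro x hx
    rw [Finset.mem_filter] at hx
    exact Finset.mem_inter.2 ⟨hx.1, hSm w x (hAlen x (hCA hx.1)) hx.2⟩
  · rw [Finset.filter_false_of_mem]
    · simp
    · rintro x hx ⟨v, hvx, -, -, hwv⟩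
      have := hvx.length_le
      have := hAlen x (hCA hx)
      omega

open Classical in
/-- Existence of list-decodable codes when the rate `1 - δ - ε` is positive. -/
theorem exists_listDecodable_code_of_add_lt_one {δ ε γ : ℝ} (hδ0 : 0 < δ)
    (hε0 : 0 < ε) (hδε : δ + ε < 1) (hγ : 0 < γ) :
    ∃ q : ℕ, 2 ≤ q ∧ ∀ N : ℕ, ∃ n : ℕ, N ≤ n ∧
      ∃ C : Finset (List (Fin q)),
        (∀ x ∈ C, x.length = n) ∧
        ((q : ℝ) ^ ((1 - δ - ε) * n) ≤ (C.card : ℝ)) ∧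
        ∀ w : List (Fin q),
          (C.filter (fun x => Obtainable ⌊δ * n⌋₊ ⌊γ * n⌋₊ x w)).card ≤ n := by
  set a := ⌈2 * (4 + γ) / ε⌉₊ with ha
  have haε : 4 + γ ≤ a * (ε / 2) := by
    have h := Nat.le_ceil (2 * (4 + γ) / ε)
    rw [div_le_iff₀ hε0] at h
    linarith
  have ha2 : 2 ≤ a := by
    have : (2 : ℝ) ≤ a := by nlinarith [(Nat.cast_nonneg a : (0 : ℝ) ≤ a)]
    exact_mod_cast this
  have hq4 : 4 ≤ 2 ^ a := (by norm_num : 4 = 2 ^ 2).trans_le (Nat.pow_le_pow_right (by norm_num) ha2)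
  obtain ⟨q, hq⟩ : ∃ q, q = 2 ^ a := ⟨_, rfl⟩
  rw [← hq] at hq4
  refine ⟨q, by omega, fun N => ?_⟩
  obtain ⟨n, hn⟩ : ∃ n, n = max (max N 1) ⌈4 * (1 + γ) / ε⌉₊ := ⟨_, rfl⟩
  have hnN : N ≤ n := hn ▸ (le_max_left _ _).trans (le_max_left _ _)
  have hn1 : 1 ≤ n := hn ▸ (le_max_right _ _).trans (le_max_left _ _)
  have hnε : 4 * (1 + γ) ≤ n * ε := by
    rw [← div_le_iff₀ hε0]
    exact (Nat.le_ceil _).trans (by exact_mod_cast hn ▸ le_max_right _ _)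
  clear hn
  have hn1' : (1 : ℝ) ≤ n := by exact_mod_cast hn1
  have hqR : (1 : ℝ) < q := by exact_mod_cast (by omega : 1 < q)
  have hq0 : (0 : ℝ) < q := by linarith
  have ht : (⌊δ * n⌋₊ : ℝ) ≤ δ * n := Nat.floor_le (by positivity)
  have hs : (⌊γ * n⌋₊ : ℝ) ≤ γ * n := Nat.floor_le (by positivity)
  obtain ⟨t, hteq⟩ : ∃ t, t = ⌊δ * n⌋₊ := ⟨_, rfl⟩
  obtain ⟨s, hseq⟩ : ∃ s, s = ⌊γ * n⌋₊ := ⟨_, rfl⟩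
  rw [← hteq] at ht
  rw [← hseq] at hs
  have htn : t ≤ n := by
    have : (t : ℝ) ≤ n := by nlinarith
    exact_mod_cast this
  obtain ⟨M, hM⟩ : ∃ M, M = ⌈(q : ℝ) ^ ((1 - δ - ε) * n)⌉₊ := ⟨_, rfl⟩
  have hMle : (q : ℝ) ^ ((1 - δ - ε) * n) ≤ M := hM ▸ Nat.le_ceil _
  have hMq : M ≤ q ^ n := by
    rw [hM, Nat.ceil_le, Nat.cast_pow, ← Real.rpow_natCast]
    exact Real.rpow_le_rpow_of_exponent_le hqR.le (by nlinarith)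
  have hM2 : (M : ℝ) ≤ 2 * (q : ℝ) ^ ((1 - δ - ε) * n) := by
    have h1 : 1 ≤ (q : ℝ) ^ ((1 - δ - ε) * n) :=
      Real.one_le_rpow hqR.le (mul_nonneg (by linarith) (by linarith))
    have h2 := (Nat.ceil_lt_add_one (zero_le_one.trans h1)).le
    rw [← hM] at h2
    linarith
  have h2n : 2 * n ≤ q ^ n := by
    have h1 : n < 2 ^ n := Nat.lt_two_pow_self
    calc 2 * n ≤ 2 ^ n * 2 ^ n := Nat.mul_le_mul (Nat.le_self_pow (by omega) 2) h1.le
      _ = 4 ^ n := by rw [← mul_pow]; norm_num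
      _ ≤ q ^ n := Nat.pow_le_pow_left hq4 n
  have hW : ((q : ℝ) + 1) ^ (n + s) ≤ (q : ℝ) ^ (2 * (1 + γ) * n) := by
    have h1 : (q : ℝ) + 1 ≤ (q : ℝ) ^ 2 := by
      have : (4 : ℝ) ≤ q := by exact_mod_cast hq4
      nlinarith
    calc ((q : ℝ) + 1) ^ (n + s) ≤ ((q : ℝ) ^ 2) ^ (n + s) := by gcongr
      _ = (q : ℝ) ^ ((2 * (n + s) : ℕ) : ℝ) := by rw [← pow_mul, Real.rpow_natCast]
      _ ≤ _ := by
        refine Real.rpow_le_rpow_of_exponent_le hqR.le ?_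
        push_cast
        linarith
  have hball : 2 * (2 ^ (n + s) * (2 ^ n * (q : ℝ) ^ t)) * M ≤ (q : ℝ) ^ ((1 - ε / 2) * n) := by
    have h1 : (2 : ℝ) ^ (2 + 2 * n + s) ≤ (q : ℝ) ^ (ε / 2 * n) := by
      rw [hq, Nat.cast_pow, Nat.cast_ofNat, ← Real.rpow_natCast, ← Real.rpow_natCast,
        ← Real.rpow_mul (by norm_num)]
      refine Real.rpow_le_rpow_of_exponent_le (by norm_num) ?_
      push_cast
      nlinarith
    have h2 : (q : ℝ) ^ t ≤ (q : ℝ) ^ (δ * n) := by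
      rw [← Real.rpow_natCast]
      exact Real.rpow_le_rpow_of_exponent_le hqR.le ht
    calc 2 * (2 ^ (n + s) * (2 ^ n * (q : ℝ) ^ t)) * M
        ≤ 2 * (2 ^ (n + s) * (2 ^ n * (q : ℝ) ^ t)) * (2 * (q : ℝ) ^ ((1 - δ - ε) * n)) := by gcongr
      _ = 2 ^ (2 + 2 * n + s) * (q : ℝ) ^ t * (q : ℝ) ^ ((1 - δ - ε) * n) := by ring
      _ ≤ (q : ℝ) ^ (ε / 2 * n) * (q : ℝ) ^ (δ * n) * (q : ℝ) ^ ((1 - δ - ε) * n) := by gcongr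
      _ = _ := by
        rw [← Real.rpow_add hq0, ← Real.rpow_add hq0]
        ring_nf
  obtain ⟨C, hC1, hC2, hC3⟩ := exists_listDecodable_code (α := Fin q) (s := s) htn
    (by simpa using hMq) (by simpa using h2n) (by
      rw [Fintype.card_fin, ← Nat.cast_lt (α := ℝ)]
      push_cast
      calc _ ≤ (q : ℝ) ^ (2 * (1 + γ) * n) * ((q : ℝ) ^ ((1 - ε / 2) * n)) ^ (n + 1) := by gcongr
        _ = (q : ℝ) ^ (2 * (1 + γ) * n + (1 - ε / 2) * n * (n + 1 : ℕ)) := by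
          rw [Real.rpow_add hq0, Real.rpow_mul hq0.le _ ((n + 1 : ℕ) : ℝ), Real.rpow_natCast]
        _ < (q : ℝ) ^ ((n * (n + 1) : ℕ) : ℝ) := by
          refine Real.rpow_lt_rpow_of_exponent_lt hqR ?_
          push_cast
          nlinarith
        _ = _ := by rw [Real.rpow_natCast, pow_mul])
  exact ⟨n, hnN, C, hC1, hC2 ▸ hMle, by rwa [← hteq, ← hseq]⟩

open Classical in
/-- Combinatorial content of the paper's Theorem 1. For all `0 < δ, ε < 1` and `γ > 0`
there is a constant alphabet size `q` such that for infinitely many `n` there is a code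
`C ⊆ (Fin q)^n` of size at least `q^{(1−δ−ε)n}` that is list-decodable from `⌊δn⌋`
deletions and `⌊γn⌋` insertions with list size at most `n`. -/
theorem stmt_15 (δ ε γ : ℝ) (hδ0 : 0 < δ) (hδ1 : δ < 1)
    (hε0 : 0 < ε) (hε1 : ε < 1) (hγ : 0 < γ) :
    ∃ q : ℕ, 2 ≤ q ∧ ∀ N : ℕ, ∃ n : ℕ, N ≤ n ∧
      ∃ C : Finset (List (Fin q)),
        (∀ x ∈ C, x.length = n) ∧
        ((q : ℝ) ^ ((1 - δ - ε) * n) ≤ (C.card : ℝ)) ∧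
        ∀ w : List (Fin q),
          (C.filter (fun x => Obtainable ⌊δ * n⌋₊ ⌊γ * n⌋₊ x w)).card ≤ n := by
  have hmin : min ε ((1 - δ) / 2) ≤ (1 - δ) / 2 := min_le_right _ _
  obtain ⟨q, hq, h⟩ := exists_listDecodable_code_of_add_lt_one hδ0
    (lt_min hε0 (by linarith : 0 < (1 - δ) / 2)) (by linarith) hγ
  refine ⟨q, hq, fun N => ?_⟩
  obtain ⟨n, hn, C, hC1, hC2, hC3⟩ := h N
  refine ⟨n, hn, C, hC1, le_trans ?_ hC2, hC3⟩
  have hq1 : (1 : ℝ) ≤ q := by exact_mod_cast (by omega : 1 ≤ q)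
  gcongr
  exact min_le_left _ _
end

section
/- Fix integers q ≥ 2 and l ≥ 1 and reals δ, R with 0 < δ < (q−1)/q and R < 1 − (1−δ)·log_q(1/(1−δ)) − δ·log_q(1/δ) − δ·log_q(q−1) − (1−δ)/(l+1). For each n, let M_n := q^{⌊Rn⌋} and let E_n : Fin M_n → (Fin q)^n be a uniformly random function (each of the M_n codewords chosen independently and uniformly from (Fin q)^n). Then the probability that there exist a word z ∈ (Fin q)^{n−⌊δn⌋} and l+1 distinct messages m₁, …, m_{l+1} ∈ Fin M_n such that z is a subsequence of each of E_n(m₁), …, E_n(m_{l+1}) tends to 0 as n → ∞. -/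
open Classical in
/-- Counting the words of length `n` that contain a fixed word `z` as a subsequence,
weighted by any `0 < x ≤ 1`. -/
lemma card_supersequences_mul_pow_le {α : Type*} [Fintype α] [Nonempty α] {x : ℝ}
    (hx0 : 0 < x) (hx1 : x ≤ 1) (n : ℕ) (z : List α) :
    ((Finset.univ.filter fun w : Fin n → α => z.Sublist (List.ofFn w)).card : ℝ) * x ^ n
      ≤ x ^ z.length * (1 + ((Fintype.card α : ℝ) - 1) * x) ^ n := by
  have hcard : (1 : ℝ) ≤ Fintype.card α := by exact_mod_cast Fintype.card_pos
  induction n generalizing z with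
  | zero =>
    cases z with
    | nil => simp
    | cons b z => simp; positivity
  | succ n ih =>
    cases z with
    | nil =>
      simp only [List.nil_sublist, Finset.filter_true, Finset.card_univ, Fintype.card_fun,
        Fintype.card_fin, List.length_nil, pow_zero, one_mul, Nat.cast_pow]
      rw [← mul_pow]
      gcongr
      nlinarith
    | cons b z =>
      have hsum : (Finset.univ.filter fun w : Fin (n + 1) → α =>
            (b :: z).Sublist (List.ofFn w)).card
          = ∑ a : α, (Finset.univ.filter fun w : Fin n → α =>
            (b :: z).Sublist (a :: List.ofFn w)).card := by
        simp only [Finset.card_filter]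
        rw [← Fintype.sum_prod_type' (f := fun (a : α) (w : Fin n → α) =>
          if (b :: z).Sublist (a :: List.ofFn w) then 1 else 0)]
        refine (Fintype.sum_equiv (Fin.consEquiv fun _ => α) _ _ fun p => ?_).symm
        simp [Fin.consEquiv, List.ofFn_succ]
      have hne : ∀ a ∈ Finset.univ.erase b, (Finset.univ.filter fun w : Fin n → α =>
            (b :: z).Sublist (a :: List.ofFn w)).card
          = (Finset.univ.filter fun w : Fin n → α => (b :: z).Sublist (List.ofFn w)).card := by
        intro a ha
        congr 1
        ext w
        have hab : b ≠ a := (Finset.ne_of_mem_erase ha).symm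
        simp [List.cons_sublist_cons', hab]
      rw [hsum, ← Finset.add_sum_erase _ _ (Finset.mem_univ b), Finset.sum_congr rfl hne]
      simp only [List.cons_sublist_cons, Finset.sum_const, smul_eq_mul,
        Finset.card_erase_of_mem (Finset.mem_univ b), Finset.card_univ]
      have h1 := ih z
      have h2 := ih (b :: z)
      rw [List.length_cons] at h2 ⊢
      push_cast [Nat.cast_sub (Fintype.card_pos (α := α))]
      have h3 := mul_le_mul_of_nonneg_left h1 hx0.le
      have h4 := mul_le_mul_of_nonneg_left h2
        (mul_nonneg (sub_nonneg.2 hcard) hx0.le)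
      refine le_trans (le_of_eq ?_) ((add_le_add h3 h4).trans (le_of_eq ?_)) <;> ring

open Classical in
/-- A uniformly random function sends `k` given distinct points into `S` with probability
`(|S| / |α|) ^ k`. -/
lemma card_forall_mem_div_card {ι κ α : Type*} [Fintype ι] [Fintype κ] [Fintype α] [Nonempty α]
    (S : Finset α) {f : κ → ι} (hf : Function.Injective f) :
    ((Finset.univ.filter fun E : ι → α => ∀ i, E (f i) ∈ S).card : ℝ) / Fintype.card (ι → α)
      = ((S.card : ℝ) / Fintype.card α) ^ Fintype.card κ := by
  have hpi : (Finset.univ.filter fun E : ι → α => ∀ i, E (f i) ∈ S)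
      = Fintype.piFinset fun m => if m ∈ Finset.univ.image f then S else Finset.univ := by
    ext E
    simp only [Finset.mem_filter, Finset.mem_univ, true_and, Fintype.mem_piFinset]
    constructor
    · intro h m
      split_ifs with hm
      · obtain ⟨i, -, rfl⟩ := Finset.mem_image.1 hm
        exact h i
      · exact Finset.mem_univ _
    · intro h i
      simpa using h (f i)
  have hα : (Fintype.card α : ℝ) ≠ 0 := by exact_mod_cast Fintype.card_ne_zero
  have hden : (Fintype.card (ι → α) : ℝ) = ∏ _m : ι, (Fintype.card α : ℝ) := by simp
  rw [hpi, Fintype.card_piFinset, hden, Nat.cast_prod, ← Finset.prod_div_distrib,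
    ← Finset.card_univ (α := κ), ← Finset.card_image_of_injective _ hf, ← Finset.prod_const,
    ← Finset.prod_subset (Finset.subset_univ (Finset.univ.image f))]
  · exact Finset.prod_congr rfl fun m hm => by rw [if_pos hm]
  · intro m _ hm
    rw [if_neg hm, Finset.card_univ, div_self hα]

open Classical in
/-- Union bound over the common subsequence and the tuple of messages. -/
lemma card_exists_common_subsequence_div_card_le {α ι : Type*} [Fintype α] [Nonempty α]
    [Fintype ι] (n k l : ℕ) {p : ℝ}
    (hp : ∀ z : Fin k → α, ((Finset.univ.filter fun w : Fin n → α =>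
      (List.ofFn z).Sublist (List.ofFn w)).card : ℝ) / Fintype.card (Fin n → α) ≤ p) :
    ((Finset.univ.filter fun E : ι → Fin n → α => ∃ z : Fin k → α, ∃ f : Fin l → ι,
        Function.Injective f ∧ ∀ i, (List.ofFn z).Sublist (List.ofFn (E (f i)))).card : ℝ)
      / Fintype.card (ι → Fin n → α)
      ≤ (Fintype.card α : ℝ) ^ k * ((Fintype.card ι : ℝ) ^ l * p ^ l) := by
  have hp0 : 0 ≤ p := le_trans (by positivity) (hp fun _ => Classical.arbitrary α)
  let B (z : Fin k → α) (f : Fin l → ι) : Finset (ι → Fin n → α) :=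
    Finset.univ.filter fun E => Function.Injective f ∧
      ∀ i, (List.ofFn z).Sublist (List.ofFn (E (f i)))
  have hB (z : Fin k → α) (f : Fin l → ι) :
      ((B z f).card : ℝ) / Fintype.card (ι → Fin n → α) ≤ p ^ l := by
    by_cases hf : Function.Injective f
    · have h := card_forall_mem_div_card (Finset.univ.filter fun w : Fin n → α =>
        (List.ofFn z).Sublist (List.ofFn w)) hf
      simp only [Finset.mem_filter, Finset.mem_univ, true_and, Fintype.card_fin] at h
      simp only [B, hf, true_and]
      rw [h]
      exact pow_le_pow_left₀ (by positivity) (hp z) l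
    · simp only [B, hf, false_and, Finset.filter_false, Finset.card_empty, Nat.cast_zero,
        zero_div]
      positivity
  have hunion : (Finset.univ.filter fun E : ι → Fin n → α => ∃ z : Fin k → α,
        ∃ f : Fin l → ι, Function.Injective f ∧
          ∀ i, (List.ofFn z).Sublist (List.ofFn (E (f i)))).card
      ≤ ∑ z : Fin k → α, ∑ f : Fin l → ι, (B z f).card := by
    refine le_trans (Finset.card_le_card (t := Finset.univ.biUnion fun z =>
      Finset.univ.biUnion fun f => B z f) ?_) (Finset.card_biUnion_le.trans
        (Finset.sum_le_sum fun z _ => Finset.card_biUnion_le))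
    intro E hE
    simpa [B] using hE
  calc _ ≤ ((∑ z : Fin k → α, ∑ f : Fin l → ι, (B z f).card : ℕ) : ℝ)
        / Fintype.card (ι → Fin n → α) := by gcongr
    _ = ∑ z : Fin k → α, ∑ f : Fin l → ι, ((B z f).card : ℝ)
        / Fintype.card (ι → Fin n → α) := by
      push_cast
      simp only [Finset.sum_div]
    _ ≤ ∑ _z : Fin k → α, ∑ _f : Fin l → ι, p ^ l :=
      Finset.sum_le_sum fun z _ => Finset.sum_le_sum fun f _ => hB z f
    _ = _ := by simp

open Classical in
/-- A fixed word of length at least `(1 - δ) n` is a subsequence of a uniformly random word of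
length `n` with probability at most `q ^ ((H_q(δ) - 1) n)`. -/
lemma card_supersequences_div_card_le {q : ℕ} (hq : 2 ≤ q) {δ : ℝ} (hδ0 : 0 < δ)
    (hδ1 : δ < ((q : ℝ) - 1) / q) {n k : ℕ} (hk : (1 - δ) * n ≤ k) (z : Fin k → Fin q) :
    ((Finset.univ.filter fun w : Fin n → Fin q =>
        (List.ofFn z).Sublist (List.ofFn w)).card : ℝ) / Fintype.card (Fin n → Fin q)
      ≤ (q : ℝ) ^ (((1 - δ) * Real.logb q (1 / (1 - δ)) + δ * Real.logb q (1 / δ)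
        + δ * Real.logb q ((q : ℝ) - 1) - 1) * n) := by
  have hq2 : (2 : ℝ) ≤ q := by exact_mod_cast hq
  have hq0 : (0 : ℝ) < q := by linarith
  have hq1 : (0 : ℝ) < (q : ℝ) - 1 := by linarith
  have hδq : δ * q < (q : ℝ) - 1 := (lt_div_iff₀ hq0).1 hδ1
  have hδ : 0 < 1 - δ := by nlinarith
  have : Nonempty (Fin q) := ⟨⟨0, by omega⟩⟩
  set x : ℝ := δ / ((1 - δ) * ((q : ℝ) - 1)) with hx
  have hx0 : 0 < x := by positivity
  have hx1 : x ≤ 1 := by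
    rw [hx, div_le_one (by positivity)]
    linarith
  have hbase : 1 + ((q : ℝ) - 1) * x = (1 - δ)⁻¹ := by
    rw [hx]
    field_simp
    ring
  have hcount := card_supersequences_mul_pow_le hx0 hx1 n (List.ofFn z)
  rw [List.length_ofFn, Fintype.card_fin, hbase] at hcount
  have hxk : x ^ k ≤ x ^ ((1 - δ) * n) := by
    rw [← Real.rpow_natCast]
    exact Real.rpow_le_rpow_of_exponent_ge hx0 hx1 hk
  have hentropy : (q : ℝ) ^ (((1 - δ) * Real.logb q (1 / (1 - δ)) + δ * Real.logb q (1 / δ)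
        + δ * Real.logb q ((q : ℝ) - 1) - 1) * n) * (q : ℝ) ^ n * x ^ n
      = x ^ ((1 - δ) * n) * ((1 - δ)⁻¹) ^ n := by
    have hlogq : Real.log q ≠ 0 := (Real.log_pos (by linarith)).ne'
    have hlogx : Real.log x = Real.log δ - (Real.log (1 - δ) + Real.log ((q : ℝ) - 1)) := by
      rw [hx, Real.log_div hδ0.ne' (by positivity), Real.log_mul hδ.ne' hq1.ne']
    rw [← Real.rpow_natCast, ← Real.rpow_natCast, ← Real.rpow_natCast,
      Real.rpow_def_of_pos hq0, Real.rpow_def_of_pos hq0, Real.rpow_def_of_pos hx0,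
      Real.rpow_def_of_pos hx0, Real.rpow_def_of_pos (inv_pos.2 hδ), ← Real.exp_add,
      ← Real.exp_add, ← Real.exp_add, hlogx, Real.log_inv]
    simp only [Real.logb, one_div, Real.log_inv]
    congr 1
    field_simp
    ring
  rw [Fintype.card_fun, Fintype.card_fin, Fintype.card_fin, Nat.cast_pow,
    div_le_iff₀ (by positivity)]
  refine le_of_mul_le_mul_right ?_ (pow_pos hx0 n)
  rw [hentropy]
  convert hcount.trans (mul_le_mul_of_nonneg_right hxk (by positivity))

open Classical in
/-- Achievability direction of the paper's Theorem 6. Fix `q ≥ 2`, `l ≥ 1`,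
`0 < δ < (q−1)/q` and `R < 1 − (1−δ)log_q(1/(1−δ)) − δ log_q(1/δ) − δ log_q(q−1)
 − (1−δ)/(l+1)`. For a uniformly random code `E : Fin q^{⌊Rn⌋} → (Fin q)^n`, the
probability that some word `z` of length `n − ⌊δn⌋` is a subsequence of `l+1` distinct
codewords tends to `0` as `n → ∞`. -/
theorem stmt_16 (q l : ℕ) (hq : 2 ≤ q) (hl : 1 ≤ l) (δ R : ℝ)
    (hδ0 : 0 < δ) (hδ1 : δ < ((q : ℝ) - 1) / q)
    (hR : R < 1 - (1 - δ) * Real.logb q (1 / (1 - δ)) - δ * Real.logb q (1 / δ)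
      - δ * Real.logb q ((q : ℝ) - 1) - (1 - δ) / (l + 1)) :
    Filter.Tendsto
      (fun n : ℕ =>
        (((Finset.univ : Finset (Fin (q ^ ⌊R * (n : ℝ)⌋₊) → (Fin n → Fin q))).filter
            (fun E => ∃ z : Fin (n - ⌊δ * (n : ℝ)⌋₊) → Fin q,
              ∃ f : Fin (l + 1) → Fin (q ^ ⌊R * (n : ℝ)⌋₊),
                Function.Injective f ∧
                ∀ i, (List.ofFn z).Sublist (List.ofFn (E (f i))))).card : ℝ)
          / (Fintype.card (Fin (q ^ ⌊R * (n : ℝ)⌋₊) → (Fin n → Fin q)) : ℝ))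
      Filter.atTop (nhds 0) := by
  have hq2 : (2 : ℝ) ≤ q := by exact_mod_cast hq
  have hq0 : (0 : ℝ) < q := by linarith
  have hq1 : (1 : ℝ) ≤ q := by linarith
  have : Nonempty (Fin q) := ⟨⟨0, by omega⟩⟩
  rcases lt_or_ge R 0 with hR0 | hR0
  · refine tendsto_const_nhds.congr fun n => ?_
    have hfloor : ⌊R * (n : ℝ)⌋₊ = 0 :=
      Nat.floor_of_nonpos (mul_nonpos_of_nonpos_of_nonneg hR0.le n.cast_nonneg)
    rw [Finset.filter_false_of_mem]
    · simp
    · rintro E - ⟨z, f, hf, -⟩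
      have hcard := Fintype.card_le_of_injective f hf
      simp only [Fintype.card_fin, hfloor, pow_zero] at hcard
      omega
  set H : ℝ := (1 - δ) * Real.logb q (1 / (1 - δ)) + δ * Real.logb q (1 / δ)
    + δ * Real.logb q ((q : ℝ) - 1) with hH
  set c : ℝ := (1 - δ) + (l + 1) * (R + (H - 1)) with hc
  have hc0 : c < 0 := by
    have hl0 : (0 : ℝ) < (l : ℝ) + 1 := by positivity
    have h1 : R + (H - 1) < -((1 - δ) / (l + 1)) := by rw [hH]; linarith
    have h2 := mul_lt_mul_of_pos_left h1 hl0
    rw [mul_neg, mul_div_cancel₀ _ hl0.ne'] at h2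
    linarith
  have hlim : Filter.Tendsto (fun n : ℕ => (q : ℝ) * ((q : ℝ) ^ c) ^ n) Filter.atTop (nhds 0) := by
    simpa using (tendsto_pow_atTop_nhds_zero_of_lt_one (Real.rpow_nonneg hq0.le c)
      (Real.rpow_lt_one_of_one_lt_of_neg (by linarith) hc0)).const_mul (q : ℝ)
  refine squeeze_zero (fun n => by positivity) (fun n => ?_) hlim
  have hδ : δ < 1 := hδ1.trans_le ((div_le_one hq0).2 (by linarith))
  have hfloor : ⌊δ * (n : ℝ)⌋₊ ≤ n := Nat.floor_le_of_le (by nlinarith [n.cast_nonneg (α := ℝ)])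
  have hk1 : (1 - δ) * n ≤ ((n - ⌊δ * (n : ℝ)⌋₊ : ℕ) : ℝ) := by
    rw [Nat.cast_sub hfloor]
    linarith [Nat.floor_le (a := δ * n) (by positivity)]
  have hk2 : ((n - ⌊δ * (n : ℝ)⌋₊ : ℕ) : ℝ) ≤ (1 - δ) * n + 1 := by
    rw [Nat.cast_sub hfloor]
    linarith [Nat.lt_floor_add_one (δ * n)]
  have hunion := card_exists_common_subsequence_div_card_le (α := Fin q)
    (ι := Fin (q ^ ⌊R * (n : ℝ)⌋₊)) n (n - ⌊δ * (n : ℝ)⌋₊) (l + 1)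
    (p := (q : ℝ) ^ ((H - 1) * n))
    fun z => by convert card_supersequences_div_card_le hq hδ0 hδ1 hk1 z
  refine le_trans (le_of_eq ?_) (hunion.trans ?_)
  · congr!
  rw [Fintype.card_fin, Fintype.card_fin, Nat.cast_pow]
  have hwords : (q : ℝ) ^ (n - ⌊δ * (n : ℝ)⌋₊) ≤ (q : ℝ) ^ ((1 - δ) * n + 1) := by
    rw [← Real.rpow_natCast]
    exact Real.rpow_le_rpow_of_exponent_le hq1 hk2
  have hmessages : (q : ℝ) ^ ⌊R * (n : ℝ)⌋₊ ≤ (q : ℝ) ^ (R * n) := by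
    rw [← Real.rpow_natCast]
    exact Real.rpow_le_rpow_of_exponent_le hq1 (Nat.floor_le (by positivity))
  calc _ ≤ (q : ℝ) ^ ((1 - δ) * n + 1)
        * (((q : ℝ) ^ (R * n)) ^ (l + 1) * ((q : ℝ) ^ ((H - 1) * n)) ^ (l + 1)) := by gcongr
    _ = (q : ℝ) ^ ((1 - δ) * n + 1 + (R * n + (H - 1) * n) * (l + 1 : ℕ)) := by
      rw [← mul_pow, ← Real.rpow_add hq0, ← Real.rpow_mul_natCast hq0.le, ← Real.rpow_add hq0]
    _ = (q : ℝ) ^ (1 + c * n) := by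
      congr 1
      rw [hc]
      push_cast
      ring
    _ = q * ((q : ℝ) ^ c) ^ n := by
      rw [Real.rpow_add hq0, Real.rpow_one, Real.rpow_mul_natCast hq0.le]
end

section
/- Fix integers q ≥ 2 and l ≥ 1 and reals δ, R with 0 < δ < (q−1)/q and R > 1 − (1−δ)·log_q(1/(1−δ)) − δ·log_q(1/δ) − δ·log_q(q−1). For each n, let M_n := q^{⌊Rn⌋} and let E_n : Fin M_n → (Fin q)^n be a uniformly random function (each codeword chosen independently and uniformly). Then the probability that there exists a word z ∈ (Fin q)^{n−⌊δn⌋} that is a subsequence of E_n(m) for more than l distinct messages m ∈ Fin M_n tends to 1 as n → ∞. -/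
open Finset in
/-- Chernoff-type lower-tail bound: a uniformly random function hits `S` at most `l` times with
probability at most `2 ^ l * exp (-(|ι| * |S| / |α|) / 2)`. -/
theorem card_filter_hits_le {ι α : Type*} [Fintype ι] [DecidableEq ι] [Fintype α] [DecidableEq α]
    [Nonempty α] (S : Finset α) (l : ℕ) :
    (#{E : ι → α | #{m | E m ∈ S} ≤ l} : ℝ) ≤
      Fintype.card (ι → α) *
        (2 ^ l * Real.exp (-(Fintype.card ι * (#S / Fintype.card α) / 2))) := by
  have hα : (0 : ℝ) < Fintype.card α := by exact_mod_cast Fintype.card_pos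
  have hsum : ∑ a : α, (if a ∈ S then (1 / 2 : ℝ) else 1)
      = Fintype.card α * (1 - #S / Fintype.card α / 2) := by
    have h (a : α) : (if a ∈ S then (1 / 2 : ℝ) else 1) = 1 - if a ∈ S then 1 / 2 else 0 := by
      split_ifs <;> norm_num
    simp only [h, sum_sub_distrib, sum_ite_mem, univ_inter, sum_const, card_univ, nsmul_eq_mul]
    field_simp
  have hmgf : ∑ E : ι → α, (1 / 2 : ℝ) ^ #{m | E m ∈ S}
      = (Fintype.card α * (1 - #S / Fintype.card α / 2)) ^ Fintype.card ι := by
    rw [← hsum, ← card_univ, ← prod_const, prod_univ_sum, Fintype.piFinset_univ]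
    refine sum_congr rfl fun E _ => ?_
    rw [prod_ite, prod_const, prod_const_one, mul_one]
  have hS : (#S : ℝ) / Fintype.card α ≤ 1 :=
    div_le_one_of_le₀ (by exact_mod_cast card_le_univ S) hα.le
  calc (#{E : ι → α | #{m | E m ∈ S} ≤ l} : ℝ)
      = ∑ E : ι → α with #{m | E m ∈ S} ≤ l, 1 := by simp
    _ ≤ ∑ E : ι → α with #{m | E m ∈ S} ≤ l, 2 ^ l * (1 / 2 : ℝ) ^ #{m | E m ∈ S} := by
        refine sum_le_sum fun E hE => ?_
        have hE' := (mem_filter.1 hE).2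
        calc (1 : ℝ) = 2 ^ l * (1 / 2) ^ l := by rw [← mul_pow]; norm_num
          _ ≤ _ := by
            gcongr ?_ * ?_
            exact pow_le_pow_of_le_one (by norm_num) (by norm_num) hE'
    _ ≤ ∑ E : ι → α, 2 ^ l * (1 / 2 : ℝ) ^ #{m | E m ∈ S} :=
        sum_le_sum_of_subset_of_nonneg (filter_subset _ _) fun _ _ _ => by positivity
    _ = Fintype.card (ι → α) * (2 ^ l * (1 - #S / Fintype.card α / 2) ^ Fintype.card ι) := by
        rw [← mul_sum, hmgf, mul_pow, Fintype.card_fun]; push_cast; ring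
    _ ≤ _ := by
        gcongr
        calc (1 - (#S : ℝ) / Fintype.card α / 2) ^ Fintype.card ι
            ≤ Real.exp (-((#S : ℝ) / Fintype.card α / 2)) ^ Fintype.card ι :=
              pow_le_pow_left₀ (by linarith) (Real.one_sub_le_exp_neg _) _
          _ = _ := by rw [← Real.exp_nat_mul]; congr 1; ring

theorem List.count_ofFn_eq_card {α : Type*} [DecidableEq α] (a : α) :
    ∀ {n : ℕ} (f : Fin n → α), (List.ofFn f).count a = Finset.card {i | f i = a}
  | 0, f => by simp
  | n + 1, f => by
    rw [List.ofFn_succ, List.count_cons, List.count_ofFn_eq_card a, Fin.card_filter_univ_succ]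
    by_cases h : f 0 = a <;> simp [h]

open Finset in
/-- At least `n.choose d * (|α| - 1) ^ d` words of length `n` contain the constant word of length
`n - d` as a subsequence. -/
theorem choose_mul_pow_le_card_supersequences {α : Type*} [Fintype α] [DecidableEq α] (a : α)
    {n d : ℕ} :
    n.choose d * (Fintype.card α - 1) ^ d ≤
      #{w : Fin n → α | n - d ≤ (List.ofFn w).count a} := by
  let supp (w : Fin n → α) : Finset (Fin n) := {i | w i ≠ a}
  have hfib (T : Finset (Fin n)) :
      #{w : Fin n → α | supp w = T} = (Fintype.card α - 1) ^ #T := by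
    have : ({w : Fin n → α | supp w = T} : Finset (Fin n → α))
        = Fintype.piFinset fun i => if i ∈ T then univ.erase a else {a} := by
      ext w
      simp only [mem_filter, mem_univ, true_and, Fintype.mem_piFinset, Finset.ext_iff, supp]
      refine forall_congr' fun i => ?_
      by_cases hi : i ∈ T <;> simp [hi]
    rw [this, Fintype.card_piFinset]
    simp [apply_ite card, card_erase_of_mem]
  calc n.choose d * (Fintype.card α - 1) ^ d
      = #{w : Fin n → α | #(supp w) = d} := by
        rw [card_eq_sum_card_fiberwise (f := supp) (t := powersetCard d univ)
          (fun w hw => by simpa [mem_powersetCard] using hw)]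
        rw [sum_congr rfl (g := fun _ => (Fintype.card α - 1) ^ d)]
        · simp
        · intro T hT
          have hT := (mem_powersetCard.1 hT).2
          rw [filter_filter, ← hT, ← hfib]
          congr 1
          ext w
          simp only [mem_filter, mem_univ, true_and, and_iff_right_iff_imp]
          rintro rfl
          rfl
    _ ≤ _ := by
        refine card_le_card fun w hw => ?_
        simp only [mem_filter, mem_univ, true_and] at hw ⊢
        have h := card_filter_add_card_filter_not (s := (univ : Finset (Fin n))) (fun i => w i = a)
        rw [List.count_ofFn_eq_card]
        simp only [card_univ, Fintype.card_fin] at h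
        change #{i | ¬ w i = a} = d at hw
        omega

theorem Nat.factorial_mul_pow_le_factorial_mul_pow_self (d i : ℕ) :
    d.factorial * d ^ i ≤ i.factorial * d ^ d := by
  rcases le_total d i with h | h
  · calc d.factorial * d ^ i = d.factorial * d ^ (i - d) * d ^ d := by
          rw [mul_assoc, ← pow_add, Nat.sub_add_cancel h]
      _ ≤ _ := by gcongr; exact Nat.factorial_mul_pow_sub_le_factorial h
  · calc d.factorial * d ^ i = i.factorial * (d.descFactorial (d - i) * d ^ i) := by
          rw [← Nat.factorial_mul_descFactorial (Nat.sub_le d i), Nat.sub_sub_self h, mul_assoc]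
      _ ≤ i.factorial * (d ^ (d - i) * d ^ i) := by gcongr; exact Nat.descFactorial_le_pow _ _
      _ = _ := by rw [← pow_add, Nat.sub_add_cancel h]

/-- The term `i = d` is the largest in the binomial expansion of `(d + k) ^ (d + k)`. -/
theorem Nat.add_pow_self_le_succ_mul_choose (d k : ℕ) :
    (d + k) ^ (d + k) ≤ (d + k + 1) * ((d + k).choose d * d ^ d * k ^ k) := by
  suffices h : ∀ i ∈ Finset.range (d + k + 1),
      d ^ i * k ^ (d + k - i) * (d + k).choose i ≤ (d + k).choose d * d ^ d * k ^ k by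
    simpa [add_pow] using Finset.sum_le_card_nsmul _ _ _ h
  intro i hi
  rw [Finset.mem_range, Order.lt_add_one_iff] at hi
  obtain ⟨j, hj⟩ := Nat.exists_eq_add_of_le hi
  have hji : d + k - i = j := by omega
  have hchoose_i : (d + k).choose i * i.factorial * j.factorial = (d + k).factorial := by
    rw [← hji]; exact Nat.choose_mul_factorial_mul_factorial hi
  have hchoose_d : (d + k).choose d * d.factorial * k.factorial = (d + k).factorial := by
    rw [Nat.choose_symm_add]; exact Nat.add_choose_mul_factorial_mul_factorial d k
  rw [hji]
  have hpos : 0 < d.factorial * k.factorial * (i.factorial * j.factorial) := by positivity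
  refine Nat.le_of_mul_le_mul_left ?_ hpos
  calc _ = ((d + k).choose i * i.factorial * j.factorial)
          * ((d.factorial * d ^ i) * (k.factorial * k ^ j)) := by ring
    _ ≤ ((d + k).choose d * d.factorial * k.factorial)
          * ((i.factorial * d ^ d) * (j.factorial * k ^ k)) := by
        rw [hchoose_i, hchoose_d]
        exact Nat.mul_le_mul_left _ (Nat.mul_le_mul
          (Nat.factorial_mul_pow_le_factorial_mul_pow_self d i)
          (Nat.factorial_mul_pow_le_factorial_mul_pow_self k j))
    _ = _ := by ring

theorem exp_mul_binEntropy_mul (d k : ℕ) :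
    Real.exp ((d + k : ℕ) * Real.binEntropy (d / (d + k : ℕ))) * (d ^ d * k ^ k)
      = ((d + k : ℕ) : ℝ) ^ (d + k) := by
  have hpow (m : ℕ) : (m : ℝ) ^ m = Real.exp (m * Real.log m) := by
    rcases m.eq_zero_or_pos with rfl | hm
    · simp
    · rw [Real.exp_nat_mul, Real.exp_log (by exact_mod_cast hm)]
  rcases (d + k).eq_zero_or_pos with h0 | hpos
  · obtain ⟨rfl, rfl⟩ : d = 0 ∧ k = 0 := by omega
    simp
  have hn : (0 : ℝ) < (d + k : ℕ) := by exact_mod_cast hpos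
  have hterm (m : ℕ) : ((d + k : ℕ) : ℝ) * Real.negMulLog (m / (d + k : ℕ))
      = m * Real.log (d + k : ℕ) - m * Real.log m := by
    rcases m.eq_zero_or_pos with rfl | hm
    · simp
    · rw [Real.negMulLog, Real.log_div (by exact_mod_cast hm.ne') hn.ne']
      field_simp
      ring
  have hk : 1 - (d : ℝ) / (d + k : ℕ) = k / (d + k : ℕ) := by
    rw [eq_div_iff hn.ne', sub_mul, div_mul_cancel₀ _ hn.ne']; push_cast; ring
  rw [hpow d, hpow k, hpow (d + k), ← Real.exp_add, ← Real.exp_add,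
    Real.binEntropy_eq_negMulLog_add_negMulLog_one_sub, hk, mul_add, hterm, hterm]
  congr 1
  push_cast
  ring

theorem exp_mul_qaryEntropy_le {q n d : ℕ} (hq : 2 ≤ q) (hd : d ≤ n) :
    Real.exp (n * Real.qaryEntropy q (d / n)) ≤
      (n + 1) * ((n.choose d * (q - 1) ^ d : ℕ) : ℝ) := by
  obtain ⟨k, rfl⟩ := Nat.exists_eq_add_of_le hd
  have hpp : (0 : ℝ) < d ^ d * k ^ k := by
    have h (m : ℕ) : (0 : ℝ) < m ^ m := by
      rcases m.eq_zero_or_pos with rfl | hm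
      · simp
      · positivity
    exact mul_pos (h d) (h k)
  have hbin : Real.exp ((d + k : ℕ) * Real.binEntropy (d / (d + k : ℕ))) ≤
      ((d + k : ℕ) + 1) * ((d + k).choose d : ℝ) := by
    refine le_of_mul_le_mul_right ?_ hpp
    rw [exp_mul_binEntropy_mul]
    calc (((d + k : ℕ) : ℝ)) ^ (d + k)
        ≤ (((d + k + 1) * ((d + k).choose d * d ^ d * k ^ k) : ℕ) : ℝ) := by
          exact_mod_cast Nat.add_pow_self_le_succ_mul_choose d k
      _ = _ := by push_cast; ring
  have hq1 : (0 : ℝ) < ((q - 1 : ℕ) : ℝ) := by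
    exact_mod_cast Nat.sub_pos_of_lt hq
  have hlog : ((d + k : ℕ) : ℝ) * (d / (d + k : ℕ) * Real.log ((q - 1 : ℕ) : ℝ))
      = d * Real.log ((q - 1 : ℕ) : ℝ) := by
    rcases (d + k).eq_zero_or_pos with h0 | hpos
    · obtain ⟨rfl, rfl⟩ : d = 0 ∧ k = 0 := by omega
      simp
    · have : ((d + k : ℕ) : ℝ) ≠ 0 := by exact_mod_cast hpos.ne'
      field_simp
  have hcast : (((q : ℤ) - 1 : ℤ) : ℝ) = ((q - 1 : ℕ) : ℝ) := by
    push_cast [Nat.cast_sub (show 1 ≤ q by omega)]; ring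
  rw [Real.qaryEntropy, hcast, mul_add, hlog, Real.exp_add, Real.exp_nat_mul, Real.exp_log hq1,
    Nat.cast_mul, Nat.cast_pow]
  calc _ ≤ ((q - 1 : ℕ) : ℝ) ^ d * (((d + k : ℕ) + 1) * ((d + k).choose d : ℝ)) := by gcongr
    _ = _ := by ring

theorem tendsto_exponent_atTop {u : ℕ → ℝ} {c : ℝ} (hc : 0 < c) (b : ℝ)
    (hu : Filter.Tendsto u Filter.atTop (nhds c)) :
    Filter.Tendsto (fun n : ℕ => n * u n - b - Real.log (n + 1)) Filter.atTop Filter.atTop := by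
  have hlog : Filter.Tendsto (fun n : ℕ => Real.log (n + 1) / n) Filter.atTop (nhds 0) := by
    have h := (Real.tendsto_pow_log_div_mul_add_atTop 1 (-1) 1 one_ne_zero).comp
      (Filter.tendsto_atTop_add_const_right _ 1 (tendsto_natCast_atTop_atTop (R := ℝ)))
    refine h.congr fun n => ?_
    simp
  have h := (tendsto_natCast_atTop_atTop (R := ℝ)).atTop_mul_pos
    (show 0 < c - 0 by simpa using hc) (hu.sub hlog)
  refine (Filter.tendsto_atTop_add_const_right _ (-b) h).congr' ?_
  filter_upwards [Filter.eventually_gt_atTop 0] with n hn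
  have : (n : ℝ) ≠ 0 := by exact_mod_cast hn.ne'
  field_simp
  ring

theorem logb_entropy_mul_log {q : ℕ} (hq : 2 ≤ q) (δ : ℝ) :
    ((1 - δ) * Real.logb q (1 / (1 - δ)) + δ * Real.logb q (1 / δ)
      + δ * Real.logb q ((q : ℝ) - 1)) * Real.log q = Real.qaryEntropy q δ := by
  have hlog : Real.log q ≠ 0 := (Real.log_pos (by exact_mod_cast hq)).ne'
  simp only [Real.logb, Real.qaryEntropy, Real.binEntropy, one_div]
  push_cast
  field_simp
  ring

/-- Lower bound on the expected number of codewords containing the constant word. -/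
theorem exp_le_expected_hits {q n d s : ℕ} (hq : 2 ≤ q) (hd : d ≤ n) (R : ℝ)
    (hs : n.choose d * (q - 1) ^ d ≤ s) :
    Real.exp (n * ((R - 1) * Real.log q + Real.qaryEntropy q (d / n)) - Real.log q
      - Real.log (n + 1)) ≤ ((q ^ ⌊R * (n : ℝ)⌋₊ : ℕ) : ℝ) * (s / (q ^ n : ℕ)) := by
  have hq0 : (0 : ℝ) < q := by exact_mod_cast (by omega : 0 < q)
  have hlog : 0 < Real.log q := Real.log_pos (by exact_mod_cast hq)
  have hpow (m : ℕ) : ((q ^ m : ℕ) : ℝ) = Real.exp (m * Real.log q) := by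
    rw [Real.exp_nat_mul, Real.exp_log hq0, Nat.cast_pow]
  have hn1 : (0 : ℝ) < n + 1 := by positivity
  have hent : Real.exp (n * Real.qaryEntropy q (d / n)) ≤ (n + 1) * s :=
    (exp_mul_qaryEntropy_le hq hd).trans (by gcongr)
  have hfloor := (Nat.sub_one_lt_floor (R * (n : ℝ))).le
  calc _ = Real.exp ((R * n - 1) * Real.log q)
          * (Real.exp (n * Real.qaryEntropy q (d / n)) / (n + 1) / Real.exp (n * Real.log q)) := by
        conv_rhs => rw [← Real.exp_log hn1]
        rw [← Real.exp_sub, ← Real.exp_sub, ← Real.exp_add]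
        congr 1
        ring
    _ ≤ _ := by
        rw [hpow, hpow]
        gcongr
        rwa [div_le_iff₀' hn1]


open Classical in
/-- Converse direction of the paper's Theorem 6. Fix `q ≥ 2`, `l ≥ 1`,
`0 < δ < (q−1)/q` and `R > 1 − (1−δ)log_q(1/(1−δ)) − δ log_q(1/δ) − δ log_q(q−1)`.
For a uniformly random code `E : Fin q^{⌊Rn⌋} → (Fin q)^n`, the probability that some
word `z` of length `n − ⌊δn⌋` is a subsequence of more than `l` distinct codewords
tends to `1` as `n → ∞`. -/
theorem stmt_17 (q l : ℕ) (hq : 2 ≤ q) (hl : 1 ≤ l) (δ R : ℝ)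
    (hδ0 : 0 < δ) (hδ1 : δ < ((q : ℝ) - 1) / q)
    (hR : R > 1 - (1 - δ) * Real.logb q (1 / (1 - δ)) - δ * Real.logb q (1 / δ)
      - δ * Real.logb q ((q : ℝ) - 1)) :
    Filter.Tendsto
      (fun n : ℕ =>
        (((Finset.univ : Finset (Fin (q ^ ⌊R * (n : ℝ)⌋₊) → (Fin n → Fin q))).filter
            (fun E => ∃ z : Fin (n - ⌊δ * (n : ℝ)⌋₊) → Fin q,
              l < ((Finset.univ : Finset (Fin (q ^ ⌊R * (n : ℝ)⌋₊))).filter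
                (fun m => (List.ofFn z).Sublist (List.ofFn (E m)))).card)).card : ℝ)
          / (Fintype.card (Fin (q ^ ⌊R * (n : ℝ)⌋₊) → (Fin n → Fin q)) : ℝ))
      Filter.atTop (nhds 1) := by
  set d : ℕ → ℕ := fun n => ⌊δ * (n : ℝ)⌋₊ with hd_def
  set M : ℕ → ℕ := fun n => q ^ ⌊R * (n : ℝ)⌋₊ with hM_def
  have hq0 : (0 : ℝ) < q := by exact_mod_cast (by omega : 0 < q)
  have hlog : 0 < Real.log q := Real.log_pos (by exact_mod_cast hq)
  have hδ_lt : δ < 1 := hδ1.trans (by rw [div_lt_one hq0]; linarith)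
  have hdn (n : ℕ) : d n ≤ n := by
    refine Nat.floor_le_of_le ?_
    nlinarith [(Nat.cast_nonneg n : (0 : ℝ) ≤ n)]
  have hc : 0 < (R - 1) * Real.log q + Real.qaryEntropy q δ := by
    rw [← logb_entropy_mul_log hq, ← add_mul]
    exact mul_pos (by linarith) hlog
  have hexp := tendsto_exponent_atTop hc (Real.log q)
    (u := fun n => (R - 1) * Real.log q + Real.qaryEntropy q (d n / n))
    (((Real.qaryEntropy_continuous.tendsto δ).comp
      ((tendsto_nat_floor_mul_div_atTop hδ0.le).comp tendsto_natCast_atTop_atTop)).const_add _)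
  have hbound : Filter.Tendsto (fun n : ℕ => 1 - 2 ^ l * Real.exp (-(Real.exp
      (n * ((R - 1) * Real.log q + Real.qaryEntropy q (d n / n)) - Real.log q
        - Real.log (n + 1)) / 2))) Filter.atTop (nhds 1) := by
    have h := Real.tendsto_exp_neg_atTop_nhds_zero.comp
      ((Real.tendsto_exp_atTop.comp hexp).atTop_div_const (show (0 : ℝ) < 2 by norm_num))
    simpa [Function.comp_def] using (h.const_mul (2 ^ l)).const_sub 1
  refine tendsto_of_tendsto_of_tendsto_of_le_of_le hbound tendsto_const_nhds
    (fun n => ?_) (fun n => ?_)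
  · have : NeZero q := ⟨by omega⟩
    let a : Fin q := 0
    let S : Finset (Fin n → Fin q) :=
      {w | n - d n ≤ (List.ofFn w).count a}
    have hS : n.choose (d n) * (q - 1) ^ d n ≤ S.card := by
      have h := choose_mul_pow_le_card_supersequences a (n := n) (d := d n)
      rw [Fintype.card_fin] at h
      convert h
    have hhits := card_filter_hits_le (ι := Fin (M n)) S l
    have hmean := exp_le_expected_hits hq (hdn n) R hS
    have hcard : (0 : ℝ) < Fintype.card (Fin (M n) → (Fin n → Fin q)) := by
      exact_mod_cast Fintype.card_pos
    rw [le_div_iff₀ hcard]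
    have hsplit := Finset.card_filter_add_card_filter_not
      (s := (Finset.univ : Finset (Fin (M n) → (Fin n → Fin q))))
      (fun E => (Finset.univ.filter fun m => E m ∈ S).card ≤ l)
    rw [Finset.card_univ] at hsplit
    have hsub : (Finset.univ.filter fun E : Fin (M n) → (Fin n → Fin q) =>
          ¬ (Finset.univ.filter fun m => E m ∈ S).card ≤ l).card ≤
        (Finset.univ.filter fun E : Fin (M n) → (Fin n → Fin q) =>
          ∃ z : Fin (n - d n) → Fin q, l < (Finset.univ.filter fun m =>
            (List.ofFn z).Sublist (List.ofFn (E m))).card).card := by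
      refine Finset.card_le_card fun E hE => ?_
      simp only [Finset.mem_filter, Finset.mem_univ, true_and, not_le] at hE ⊢
      refine ⟨fun _ => a, hE.trans_le (Finset.card_le_card fun m hm => ?_)⟩
      simp only [Finset.mem_filter, Finset.mem_univ, true_and, S] at hm ⊢
      rw [List.ofFn_const]
      exact List.replicate_sublist_iff.2 hm
    have hsplit' : ((Finset.univ.filter fun E : Fin (M n) → (Fin n → Fin q) =>
          (Finset.univ.filter fun m => E m ∈ S).card ≤ l).card : ℝ)
        + (Finset.univ.filter fun E : Fin (M n) → (Fin n → Fin q) =>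
          ¬ (Finset.univ.filter fun m => E m ∈ S).card ≤ l).card
        = Fintype.card (Fin (M n) → (Fin n → Fin q)) := by exact_mod_cast hsplit
    have hsub' := (Nat.cast_le (α := ℝ)).2 hsub
    refine le_trans ?_ hsub'
    have htail : (2 : ℝ) ^ l * Real.exp (-(Fintype.card (Fin (M n)) *
          (S.card / Fintype.card (Fin n → Fin q)) / 2)) ≤
        2 ^ l * Real.exp (-(Real.exp (n * ((R - 1) * Real.log q
          + Real.qaryEntropy q (d n / n)) - Real.log q - Real.log (n + 1)) / 2)) := by
      gcongr
      simpa [hM_def] using hmean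
    have := mul_le_mul_of_nonneg_left htail hcard.le
    linarith
  · exact div_le_one_of_le₀ (Nat.cast_le.2 (Finset.card_le_univ _)) (by positivity)
end

section
/- Fix integers q ≥ 2 and l ≥ 1 and reals γ, R with 0 < γ < q−1 and R < 1 − log_q(γ+1) − γ·log_q((γ+1)/γ) − (γ+1)/(l+1). For each n, let M_n := q^{⌊Rn⌋} and let E_n : Fin M_n → (Fin q)^n be a uniformly random function (each codeword chosen independently and uniformly). Then the probability that there exist a word z ∈ (Fin q)^{n+⌊γn⌋} and l+1 distinct messages m₁, …, m_{l+1} ∈ Fin M_n such that each of E_n(m₁), …, E_n(m_{l+1}) is a subsequence of z tends to 0 as n → ∞. -/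
/-- At most `N.choose n` words of length `n` are subsequences of a given word of length `N`. -/
theorem card_filter_sublist_le_choose {α : Type*} [Fintype α] [DecidableEq α] {n N : ℕ}
    (z : Fin N → α) :
    (Finset.univ.filter
      (fun w : Fin n → α => (List.ofFn w).Sublist (List.ofFn z))).card ≤ N.choose n := by
  calc _ ≤ ((List.ofFn z).sublistsLen n).toFinset.card := by
        refine Finset.card_le_card_of_injOn List.ofFn ?_ List.ofFn_injective.injOn
        intro w hw
        simpa [List.mem_sublistsLen] using hw
    _ ≤ ((List.ofFn z).sublistsLen n).length := List.toFinset_card_le _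
    _ = N.choose n := by simp

/-- The number of functions mapping the `k` distinct points `f i` into `S`. -/
theorem card_filter_forall_mem_mul {α β : Type*} [Fintype α] [DecidableEq α] [Fintype β]
    [DecidableEq β] {k : ℕ} {f : Fin k → α} (hf : Function.Injective f) (S : Finset β) :
    (Finset.univ.filter (fun E : α → β => ∀ i, E (f i) ∈ S)).card * Fintype.card β ^ k
      = S.card ^ k * Fintype.card β ^ Fintype.card α := by
  set T : Finset α := Finset.univ.image f with hT
  have hTk : T.card = k := by simp [hT, Finset.card_image_of_injective _ hf]
  have hfilter : Finset.univ.filter (fun E : α → β => ∀ i, E (f i) ∈ S)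
      = Fintype.piFinset (fun a => if a ∈ T then S else Finset.univ) := by
    ext E
    simp only [Finset.mem_filter, Finset.mem_univ, true_and, Fintype.mem_piFinset]
    constructor
    · intro h a
      split_ifs with ha
      · obtain ⟨i, -, rfl⟩ := Finset.mem_image.1 ha
        exact h i
      · simp
    · intro h i
      simpa [hT] using h (f i)
  have hcard : Fintype.card α = Tᶜ.card + k := by
    rw [← hTk, add_comm, Finset.card_add_card_compl]
  rw [hfilter, Fintype.card_piFinset, hcard, pow_add, ← mul_assoc]
  congr 1
  simp only [apply_ite Finset.card, Finset.prod_ite, Finset.prod_const, Finset.card_univ]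
  rw [Finset.filter_mem_eq_inter, Finset.univ_inter, hTk]
  congr 2
  congr 1
  ext a
  simp

open Classical in
/-- Union bound for the number of codes some word of length `N` of which contains `k`
distinct codewords as subsequences. -/
theorem card_not_list_decodable_mul_le (q n N M k : ℕ) :
    ((Finset.univ : Finset (Fin M → (Fin n → Fin q))).filter
        (fun E => ∃ z : Fin N → Fin q, ∃ f : Fin k → Fin M, Function.Injective f ∧
          ∀ i, (List.ofFn (E (f i))).Sublist (List.ofFn z))).card * (q ^ n) ^ k
      ≤ q ^ N * M ^ k * (N.choose n ^ k * (q ^ n) ^ M) := by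
  set P : Finset ((Fin N → Fin q) × (Fin k → Fin M)) :=
    Finset.univ.filter (fun p => Function.Injective p.2) with hP
  set A : (Fin N → Fin q) × (Fin k → Fin M) → Finset (Fin M → (Fin n → Fin q)) := fun p =>
    Finset.univ.filter (fun E => ∀ i, E (p.2 i) ∈ Finset.univ.filter
      (fun w : Fin n → Fin q => (List.ofFn w).Sublist (List.ofFn p.1))) with hA
  have hPcard : P.card ≤ q ^ N * M ^ k := by
    refine (Finset.card_filter_le _ _).trans ?_
    simp [Finset.card_univ]
  calc _ ≤ (P.biUnion A).card * (q ^ n) ^ k := by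
        gcongr
        intro E hE
        simp only [Finset.mem_filter, Finset.mem_univ, true_and] at hE
        obtain ⟨z, f, hf, h⟩ := hE
        simp only [Finset.mem_biUnion]
        exact ⟨(z, f), by simpa [hP] using hf, by simpa [hA] using h⟩
    _ ≤ (∑ p ∈ P, (A p).card) * (q ^ n) ^ k := by
        gcongr
        exact Finset.card_biUnion_le
    _ = ∑ p ∈ P, (A p).card * (q ^ n) ^ k := Finset.sum_mul _ _ _
    _ ≤ ∑ _p ∈ P, N.choose n ^ k * (q ^ n) ^ M := by
        refine Finset.sum_le_sum fun p hp => ?_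
        have hinj : Function.Injective p.2 := by simpa [hP] using hp
        have h := card_filter_forall_mem_mul hinj (Finset.univ.filter
          (fun w : Fin n → Fin q => (List.ofFn w).Sublist (List.ofFn p.1)))
        simp only [Fintype.card_fun, Fintype.card_fin] at h
        simp only [hA]
        refine le_trans (le_of_eq ?_) ((h.trans_le (Nat.mul_le_mul_right _
          (Nat.pow_le_pow_left ?_ k))))
        · congr!
        · convert card_filter_sublist_le_choose p.1
    _ = P.card * (N.choose n ^ k * (q ^ n) ^ M) := by simp
    _ ≤ _ := by gcongr

/-- The entropy bound on the binomial coefficient `(n + m).choose n` for `m ≤ γ n`. -/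
theorem choose_add_le_rpow {γ : ℝ} (hγ : 0 < γ) {n m : ℕ} (hm : (m : ℝ) ≤ γ * n) :
    ((n + m).choose n : ℝ) ≤ (γ + 1) ^ (n : ℝ) * ((γ + 1) / γ) ^ (γ * n) := by
  have hγ' : 0 < γ + 1 := by linarith
  have h1 : (1 / (γ + 1)) ^ n * (γ / (γ + 1)) ^ m * ((n + m).choose n : ℝ) ≤ 1 := by
    have h := add_pow (1 / (γ + 1)) (γ / (γ + 1)) (n + m)
    rw [← add_div, add_comm 1 γ, div_self hγ'.ne', one_pow] at h
    refine le_of_le_of_eq ?_ h.symm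
    have := Finset.single_le_sum (f := fun i => (1 / (γ + 1)) ^ i *
      (γ / (γ + 1)) ^ (n + m - i) * ((n + m).choose i : ℝ)) (s := Finset.range (n + m + 1))
      (fun i _ => by positivity) (Finset.mem_range.2 (show n < n + m + 1 by omega))
    simpa using this
  have h2 : ((n + m).choose n : ℝ) ≤ (γ + 1) ^ n * ((γ + 1) / γ) ^ m := by
    have h3 : ((γ + 1) ^ n * ((γ + 1) / γ) ^ m) * ((1 / (γ + 1)) ^ n * (γ / (γ + 1)) ^ m)
        = 1 := by
      rw [mul_mul_mul_comm, ← mul_pow, ← mul_pow]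
      field_simp
      simp
    calc ((n + m).choose n : ℝ)
        = ((γ + 1) ^ n * ((γ + 1) / γ) ^ m) *
          ((1 / (γ + 1)) ^ n * (γ / (γ + 1)) ^ m * ((n + m).choose n : ℝ)) := by
          rw [← mul_assoc, h3, one_mul]
      _ ≤ ((γ + 1) ^ n * ((γ + 1) / γ) ^ m) * 1 := by gcongr
      _ = _ := mul_one _
  refine h2.trans ?_
  rw [Real.rpow_natCast, ← Real.rpow_natCast ((γ + 1) / γ)]
  gcongr
  rw [le_div_iff₀ hγ]
  linarith


open Classical in
/-- The paper's Theorem 7. Fix `q ≥ 2`, `l ≥ 1`, `0 < γ < q−1` and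
`R < 1 − log_q(γ+1) − γ log_q((γ+1)/γ) − (γ+1)/(l+1)`. For a uniformly random code
`E : Fin q^{⌊Rn⌋} → (Fin q)^n`, the probability that some word `z` of length
`n + ⌊γn⌋` contains `l+1` distinct codewords as subsequences tends to `0` as
`n → ∞`. -/
theorem stmt_18 (q l : ℕ) (hq : 2 ≤ q) (hl : 1 ≤ l) (γ R : ℝ)
    (hγ0 : 0 < γ) (hγ1 : γ < (q : ℝ) - 1)
    (hR : R < 1 - Real.logb q (γ + 1) - γ * Real.logb q ((γ + 1) / γ)
      - (γ + 1) / (l + 1)) :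
    Filter.Tendsto
      (fun n : ℕ =>
        (((Finset.univ : Finset (Fin (q ^ ⌊R * (n : ℝ)⌋₊) → (Fin n → Fin q))).filter
            (fun E => ∃ z : Fin (n + ⌊γ * (n : ℝ)⌋₊) → Fin q,
              ∃ f : Fin (l + 1) → Fin (q ^ ⌊R * (n : ℝ)⌋₊),
                Function.Injective f ∧
                ∀ i, (List.ofFn (E (f i))).Sublist (List.ofFn z))).card : ℝ)
          / (Fintype.card (Fin (q ^ ⌊R * (n : ℝ)⌋₊) → (Fin n → Fin q)) : ℝ))
      Filter.atTop (nhds 0) := by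
  rcases le_or_gt R 0 with hR0 | hR0
  · refine tendsto_const_nhds.congr fun n => ?_
    have hfloor : ⌊R * (n : ℝ)⌋₊ = 0 :=
      Nat.floor_of_nonpos (mul_nonpos_of_nonpos_of_nonneg hR0 n.cast_nonneg)
    rw [Finset.filter_false_of_mem]
    · simp
    · rintro E - ⟨z, f, hf, -⟩
      have h := Fintype.card_le_of_injective f hf
      simp only [Fintype.card_fin, hfloor, pow_zero] at h
      omega
  have hq1 : (1 : ℝ) < q := by exact_mod_cast hq
  have hq0 : (0 : ℝ) < q := by linarith
  have hγ' : 0 < γ + 1 := by linarith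
  set a := Real.logb q (γ + 1) with ha
  set b := Real.logb q ((γ + 1) / γ) with hb
  have hqa : (q : ℝ) ^ a = γ + 1 := Real.rpow_logb hq0 hq1.ne' hγ'
  have hqb : (q : ℝ) ^ b = (γ + 1) / γ := Real.rpow_logb hq0 hq1.ne' (by positivity)
  set e : ℝ := (1 + γ) + (R + (a + γ * b) - 1) * (l + 1) with he
  have he0 : e < 0 := by
    have hl0 : (0 : ℝ) < l + 1 := by positivity
    have h := mul_lt_mul_of_pos_right hR hl0
    rw [sub_mul _ ((γ + 1) / ((l : ℝ) + 1)), div_mul_cancel₀ _ hl0.ne'] at h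
    rw [he]
    linarith
  have hr : Filter.Tendsto (fun n : ℕ => ((q : ℝ) ^ e) ^ n) Filter.atTop (nhds 0) :=
    tendsto_pow_atTop_nhds_zero_of_lt_one (by positivity)
      (Real.rpow_lt_one_of_one_lt_of_neg hq1 he0)
  refine squeeze_zero (fun n => by positivity) (fun n => ?_) hr
  have hmγ : ((⌊γ * (n : ℝ)⌋₊ : ℕ) : ℝ) ≤ γ * n := Nat.floor_le (by positivity)
  have hRn : ((⌊R * (n : ℝ)⌋₊ : ℕ) : ℝ) ≤ R * n := Nat.floor_le (by positivity)
  have hmain := card_not_list_decodable_mul_le q n (n + ⌊γ * (n : ℝ)⌋₊)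
    (q ^ ⌊R * (n : ℝ)⌋₊) (l + 1)
  have hchoose := choose_add_le_rpow hγ0 hmγ
  rw [← hqb, ← hqa, ← Real.rpow_mul hq0.le, ← Real.rpow_mul hq0.le,
    ← Real.rpow_add hq0] at hchoose
  have hN : (q : ℝ) ^ (n + ⌊γ * (n : ℝ)⌋₊) ≤ (q : ℝ) ^ ((1 + γ) * n) := by
    rw [← Real.rpow_natCast]
    refine Real.rpow_le_rpow_of_exponent_le hq1.le ?_
    push_cast
    linarith
  have hM : ((q : ℝ) ^ ⌊R * (n : ℝ)⌋₊) ≤ (q : ℝ) ^ (R * n) := by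
    rw [← Real.rpow_natCast]
    exact Real.rpow_le_rpow_of_exponent_le hq1.le hRn
  have hcard : (Fintype.card (Fin (q ^ ⌊R * (n : ℝ)⌋₊) → (Fin n → Fin q)) : ℝ)
      = ((q : ℝ) ^ n) ^ (q ^ ⌊R * (n : ℝ)⌋₊) := by
    simp
  rw [hcard, div_le_iff₀ (by positivity)]
  refine le_of_mul_le_mul_right ?_ (show (0 : ℝ) < ((q : ℝ) ^ n) ^ (l + 1) by positivity)
  calc _ ≤ (q : ℝ) ^ (n + ⌊γ * (n : ℝ)⌋₊) * ((q : ℝ) ^ ⌊R * (n : ℝ)⌋₊) ^ (l + 1) *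
        (((n + ⌊γ * (n : ℝ)⌋₊).choose n : ℝ) ^ (l + 1) *
          ((q : ℝ) ^ n) ^ (q ^ ⌊R * (n : ℝ)⌋₊)) := by exact_mod_cast hmain
    _ ≤ (q : ℝ) ^ ((1 + γ) * n) * ((q : ℝ) ^ (R * n)) ^ (l + 1) *
        (((q : ℝ) ^ (a * n + b * (γ * n))) ^ (l + 1) *
          ((q : ℝ) ^ n) ^ (q ^ ⌊R * (n : ℝ)⌋₊)) := by gcongr
    _ = (q : ℝ) ^ ((1 + γ) * n) * ((q : ℝ) ^ (R * n)) ^ (l + 1) *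
        ((q : ℝ) ^ (a * n + b * (γ * n))) ^ (l + 1) *
          ((q : ℝ) ^ n) ^ (q ^ ⌊R * (n : ℝ)⌋₊) := by ring
    _ = ((q : ℝ) ^ e) ^ n * ((q : ℝ) ^ n) ^ (l + 1) *
          ((q : ℝ) ^ n) ^ (q ^ ⌊R * (n : ℝ)⌋₊) := by
        congr 1
        simp only [← Real.rpow_mul_natCast hq0.le, ← Real.rpow_natCast (q : ℝ) n,
          ← Real.rpow_add hq0]
        congr 1
        push_cast
        rw [he]
        ring
    _ = _ := by ring
end
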